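/- Let (A₁,B₁) and (A₂,B₂) be pairs of ternary quadratic forms over ℚ (symmetric 3×3 rational matrices) such that for each i = 1,2: Aᵢ and Bᵢ are linearly independent over ℚ; the pair (Aᵢ,Bᵢ) is non-singular and anisotropic over ℚ; and q_ℚ(A₁,B₁) = q_ℚ(A₂,B₂). Then there exist coprime nonzero integers r₁, r₂ such that r₂·det(A₁·X − B₁·Y) = r₁·det(A₂·X − B₂·Y) as polynomials in the two variables X, Y. -/

import Mathlib

open Matrix

/-- The set of simultaneous representations of a pair of ternary quadratic forms
(symmetric 3×3 matrices) over `ℚ`. -/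
def simRepQ (A B : Matrix (Fin 3) (Fin 3) ℚ) : Set (ℚ × ℚ) :=
  {p : ℚ × ℚ | ∃ x : Fin 3 → ℚ, x ≠ 0 ∧ x ⬝ᵥ (A *ᵥ x) = p.1 ∧ x ⬝ᵥ (B *ᵥ x) = p.2}

/-- The two-variable polynomial `det (A·X − B·Y)`. -/
noncomputable def detPolyXY (A B : Matrix (Fin 3) (Fin 3) ℚ) : MvPolynomial (Fin 2) ℚ :=
  (((MvPolynomial.X 0 : MvPolynomial (Fin 2) ℚ) • A.map MvPolynomial.C
    - (MvPolynomial.X 1 : MvPolynomial (Fin 2) ℚ) • B.map MvPolynomial.C :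
      Matrix (Fin 3) (Fin 3) (MvPolynomial (Fin 2) ℚ))).det

section
open scoped ENNReal NNReal

theorem tsum_multiset_prod_map_lt_top {β : Type*} (x : β → ℝ≥0)
    (hx : ∀ i, x i ≤ 1 / 2) (hs : Summable x) :
    ∑' m : Multiset β, (m.map fun i => (x i : ℝ≥0∞)).prod < ∞ := by
  classical
  have fin : ∀ T : Finset β, ∑' m : {m : Multiset β // ∀ a ∈ m, a ∈ T},
      (m.1.map fun i => (x i : ℝ≥0∞)).prod ≤ ∏ i ∈ T, (1 - (x i : ℝ≥0∞))⁻¹ := by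
    intro T
    induction T using Finset.induction_on with
    | empty =>
      have : ∀ m : {m : Multiset β // ∀ a ∈ m, a ∈ (∅ : Finset β)}, m = ⟨0, by simp⟩ := by
        rintro ⟨m, hm⟩
        ext1
        exact Multiset.eq_zero_of_forall_notMem fun a ha => by simpa using hm a ha
      rw [tsum_eq_single ⟨0, by simp⟩ fun m hm => absurd (this m) hm]
      simp
    | insert a T ha ih =>
      rw [Finset.prod_insert ha]
      let f : ℕ × {m : Multiset β // ∀ b ∈ m, b ∈ T} →
          {m : Multiset β // ∀ b ∈ m, b ∈ insert a T} := fun p =>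
        ⟨Multiset.replicate p.1 a + p.2.1, by
          intro b hb
          rcases Multiset.mem_add.1 hb with h | h
          · simp [Multiset.eq_of_mem_replicate h]
          · exact Finset.mem_insert_of_mem (p.2.2 b h)⟩
      have hf : Function.Surjective f := by
        rintro ⟨m, hm⟩
        refine ⟨⟨m.count a, ⟨m.filter (· ≠ a), ?_⟩⟩, ?_⟩
        · intro b hb
          rw [Multiset.mem_filter] at hb
          exact (Finset.mem_insert.1 (hm b hb.1)).resolve_left hb.2
        · ext1
          simp only [f]
          rw [← Multiset.filter_eq' m a, Multiset.filter_add_not]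
      refine (ENNReal.tsum_le_tsum_comp_of_surjective hf _).trans ?_
      have : ∀ p, ((f p).1.map fun i => (x i : ℝ≥0∞)).prod =
          (x a : ℝ≥0∞) ^ p.1 * (p.2.1.map fun i => (x i : ℝ≥0∞)).prod := by
        intro p
        simp [f]
      simp_rw [this]
      rw [ENNReal.tsum_prod (f := fun (k : ℕ) (m : {m : Multiset β // ∀ b ∈ m, b ∈ T}) =>
        (x a : ℝ≥0∞) ^ k * (m.1.map fun i => (x i : ℝ≥0∞)).prod)]
      simp_rw [ENNReal.tsum_mul_left]
      rw [ENNReal.tsum_mul_right, ENNReal.tsum_geometric]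
      gcongr
  have bd : ∀ T : Finset β, ∏ i ∈ T, (1 - (x i : ℝ≥0∞))⁻¹ ≤
      ENNReal.ofReal (Real.exp (2 * ∑' i, (x i : ℝ))) := by
    intro T
    have h1 : ∀ i ∈ T, (1 - (x i : ℝ≥0∞))⁻¹ ≤ ENNReal.ofReal (Real.exp (2 * x i)) := by
      intro i _
      have hxi : (x i : ℝ) ≤ 1 / 2 := by exact_mod_cast hx i
      have : (1 - (x i : ℝ≥0∞)) = ENNReal.ofReal (1 - x i) := by
        rw [ENNReal.ofReal_sub _ (NNReal.coe_nonneg (x i))]; simp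
      rw [this, ← ENNReal.ofReal_inv_of_pos (by linarith)]
      apply ENNReal.ofReal_le_ofReal
      have h2 := Real.add_one_le_exp (2 * (x i : ℝ))
      refine le_trans ?_ h2
      rw [inv_le_iff_one_le_mul₀ (by linarith)]
      nlinarith [(x i).2]
    refine (Finset.prod_le_prod' h1).trans ?_
    rw [← ENNReal.ofReal_prod_of_nonneg (fun _ _ => (Real.exp_pos _).le), ← Real.exp_sum,
      ← Finset.mul_sum]
    apply ENNReal.ofReal_le_ofReal
    apply Real.exp_le_exp.2
    gcongr
    exact (NNReal.summable_coe.2 hs).sum_le_tsum T (fun i _ => (x i).2)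
  refine lt_of_le_of_lt ?_ (ENNReal.ofReal_lt_top (r := Real.exp (2 * ∑' i, (x i : ℝ))))
  rw [ENNReal.tsum_eq_iSup_sum]
  refine iSup_le fun S => ?_
  let T : Finset β := S.biUnion Multiset.toFinset
  refine le_trans ?_ ((fin T).trans (bd T))
  have hS : ∀ m ∈ S, ∀ a ∈ m, a ∈ T := fun m hm a ha =>
    Finset.mem_biUnion.2 ⟨m, hm, Multiset.mem_toFinset.2 ha⟩
  rw [← Finset.sum_attach]
  refine le_trans (le_of_eq ?_) (ENNReal.sum_le_tsum
    (S.attach.image fun m => (⟨m.1, hS m.1 m.2⟩ : {m : Multiset β // ∀ a ∈ m, a ∈ T})))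
  rw [Finset.sum_image]
  intro a _ b _ h
  ext1
  simpa using h

end

section
open scoped ENNReal NNReal
open Filter Topology NumberField ComplexOrder

/-- The Dedekind zeta function as an extended nonnegative sum over nonzero ideals. -/
noncomputable def idealZeta (K : Type*) [Field K] [NumberField K] (s : ℝ) : ℝ≥0∞ :=
  ∑' I : {I : Ideal (𝓞 K) // I ≠ ⊥}, ENNReal.ofReal ((Ideal.absNorm I.1 : ℝ) ^ (-s))

theorem idealZeta_eq (K : Type*) [Field K] [NumberField K] (s : ℝ) :
    idealZeta K s = ∑' n : ℕ, ENNReal.ofReal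
      (LSeries.term (fun n ↦ Nat.card {I : Ideal (𝓞 K) // Ideal.absNorm I = n}) s n).re := by
  let f : {I : Ideal (𝓞 K) // I ≠ ⊥} → ℕ := fun I => Ideal.absNorm I.1
  rw [idealZeta, ← (Equiv.sigmaFiberEquiv f).tsum_eq, ENNReal.tsum_sigma']
  congr 1
  ext n
  have h1 : ∀ I : {I // f I = n}, ENNReal.ofReal
      ((Ideal.absNorm ((Equiv.sigmaFiberEquiv f) ⟨n, I⟩).1 : ℝ) ^ (-s)) =
      ENNReal.ofReal ((n : ℝ) ^ (-s)) := by
    rintro ⟨I, rfl⟩; rfl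
  simp_rw [h1]
  rw [ENNReal.tsum_const]
  rcases eq_or_ne n 0 with rfl | hn
  · have : IsEmpty {I // f I = 0} := ⟨fun I => I.1.2 (Ideal.absNorm_eq_zero_iff.1 I.2)⟩
    rw [(ENat.card_eq_zero_iff_empty _).2 this]
    simp
  · let e : {I // f I = n} ≃ {I : Ideal (𝓞 K) // Ideal.absNorm I = n} :=
      { toFun := fun I => ⟨I.1.1, I.2⟩
        invFun := fun I => ⟨⟨I.1, fun h => hn (by rw [← I.2, h]; simp)⟩, I.2⟩
        left_inv := fun _ => rfl
        right_inv := fun _ => rfl }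
    have : Finite {I : Ideal (𝓞 K) // Ideal.absNorm I = n} :=
      Ideal.finite_setOfPred_absNorm_eq n
    have : Finite {I // f I = n} := Finite.of_equiv _ e.symm
    have h2 : ENat.card {I // f I = n} =
        (Nat.card {I : Ideal (𝓞 K) // Ideal.absNorm I = n} : ℕ) := by
      rw [ENat.card_congr e, ENat.card_eq_coe_natCard]
    rw [h2, LSeries.term_of_ne_zero hn]
    have : ((Nat.card {I : Ideal (𝓞 K) // Ideal.absNorm I = n} : ℂ) / (n : ℂ) ^ (s : ℂ)) =
        (((Nat.card {I : Ideal (𝓞 K) // Ideal.absNorm I = n} : ℝ) * (n : ℝ) ^ (-s) : ℝ) : ℂ) := by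
      rw [Real.rpow_neg (by positivity)]
      push_cast
      rw [Complex.ofReal_cpow (by positivity)]
      simp [div_eq_mul_inv]
    rw [this, Complex.ofReal_re, ENNReal.ofReal_mul (by positivity)]
    simp

theorem tendsto_sub_one_mul_idealZeta (K : Type*) [Field K] [NumberField K] :
    ∃ ρ : ℝ, 0 < ρ ∧ ∀ᶠ s : ℝ in 𝓝[>] 1, ∃ z : ℝ, idealZeta K s = ENNReal.ofReal z ∧
      ρ ≤ (s - 1) * z ∧ (s - 1) * z ≤ 4 * ρ := by
  have hρ := dedekindZeta_residue_pos K
  set r := dedekindZeta_residue K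
  refine ⟨r / 2, by positivity, ?_⟩
  have h1 := (Complex.continuous_re.tendsto _).comp (tendsto_sub_one_mul_dedekindZeta_nhdsGT K)
  rw [Complex.ofReal_re] at h1
  have h2 := h1.eventually (Icc_mem_nhds (a := r / 2) (b := 4 * (r / 2))
    (by linarith) (by linarith))
  filter_upwards [h2, self_mem_nhdsWithin] with s hs hs1
  have hs1 : 1 < s := hs1
  have key : ((s - 1 : ℂ) * dedekindZeta K s).re = (s - 1) * (dedekindZeta K s).re := by
    rw [← Complex.ofReal_one, ← Complex.ofReal_sub, Complex.re_ofReal_mul]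
  simp only [Function.comp, key] at hs
  refine ⟨(dedekindZeta K s).re, ?_, hs.1, hs.2⟩
  rw [idealZeta_eq]
  have hsum : LSeriesSummable (fun n ↦ (Nat.card {I : Ideal (𝓞 K) // Ideal.absNorm I = n} : ℂ))
      s := by
    by_contra h
    have := LSeries.eq_zero_of_not_LSeriesSummable _ _ h
    have h3 : dedekindZeta K s = 0 := this
    rw [h3] at hs
    have := hs.1
    simp at this
    linarith
  have hnn : ∀ n, 0 ≤ (LSeries.term (fun n ↦
      (Nat.card {I : Ideal (𝓞 K) // Ideal.absNorm I = n} : ℂ)) s n).re := by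
    intro n
    have := LSeries.term_nonneg (a := fun n ↦ (Nat.card {I : Ideal (𝓞 K) // Ideal.absNorm I = n} : ℂ))
      (n := n) (Nat.cast_nonneg _) s
    exact (Complex.le_def.1 this).1
  rw [← ENNReal.ofReal_tsum_of_nonneg hnn]
  · congr 1
    exact (Complex.re_tsum hsum).symm
  · exact (Complex.hasSum_re hsum.hasSum).summable

end

section
open scoped ENNReal NNReal
open Filter Topology NumberField IsDedekindDomain

theorem card_le_finrank_of_mem {K : Type*} [Field K] [NumberField K] {q : ℕ} (hq : q.Prime)
    (S : Finset (HeightOneSpectrum (𝓞 K))) (hS : ∀ P ∈ S, (q : 𝓞 K) ∈ P.asIdeal)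
    (hS' : ∀ P ∈ S, q ≤ Ideal.absNorm P.asIdeal) : S.card ≤ Module.finrank ℚ K := by
  have h1 : ∏ P ∈ S, P.asIdeal ∣ Ideal.span {(q : 𝓞 K)} := by
    have := Finset.prod_primes_dvd (s := S.image HeightOneSpectrum.asIdeal)
      (Ideal.span {(q : 𝓞 K)}) ?_ ?_
    · rwa [Finset.prod_image fun P _ Q _ h => HeightOneSpectrum.ext h] at this
    · intro P hP
      obtain ⟨Q, _, rfl⟩ := Finset.mem_image.1 hP
      exact Q.prime
    · intro P hP
      obtain ⟨Q, hQ, rfl⟩ := Finset.mem_image.1 hP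
      rw [Ideal.dvd_span_singleton]
      exact hS Q hQ
  have h2 := Ideal.absNorm_dvd_absNorm_of_le (Ideal.dvd_iff_le.1 h1)
  rw [map_prod, Ideal.absNorm_span_singleton, show (q : 𝓞 K) = algebraMap ℤ (𝓞 K) q by simp,
    Algebra.norm_algebraMap] at h2
  have h3 : q ^ S.card ≤ q ^ Module.finrank ℚ K := by
    calc q ^ S.card ≤ ∏ P ∈ S, Ideal.absNorm P.asIdeal := Finset.pow_card_le_prod _ _ _ hS'
      _ ≤ _ := Nat.le_of_dvd (by have := hq.pos; positivity) h2
      _ = _ := by rw [Int.natAbs_pow, RingOfIntegers.rank]; simp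
  exact (Nat.pow_le_pow_iff_right hq.one_lt).1 h3

theorem HeightOneSpectrum.two_le_absNorm {K : Type*} [Field K] [NumberField K]
    (P : HeightOneSpectrum (𝓞 K)) : 2 ≤ Ideal.absNorm P.asIdeal := by
  have h0 : Ideal.absNorm P.asIdeal ≠ 0 := mt Ideal.absNorm_eq_zero_iff.1 P.ne_bot
  have h1 : Ideal.absNorm P.asIdeal ≠ 1 := mt Ideal.absNorm_eq_one_iff.1 P.isPrime.ne_top
  omega

theorem summable_inv_absNorm_of_not_prime (K : Type*) [Field K] [NumberField K] (N : ℕ) :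
    Summable fun P : {P : HeightOneSpectrum (𝓞 K) //
      ¬ ((Ideal.absNorm P.asIdeal).Prime ∧ N < Ideal.absNorm P.asIdeal)} =>
        (Ideal.absNorm P.1.asIdeal : ℝ≥0)⁻¹ := by
  rw [← ENNReal.tsum_coe_ne_top_iff_summable]
  set β := {P : HeightOneSpectrum (𝓞 K) //
      ¬ ((Ideal.absNorm P.asIdeal).Prime ∧ N < Ideal.absNorm P.asIdeal)}
  let q : β → ℕ := fun P => Ideal.absNorm (Ideal.under ℤ P.1.asIdeal)
  have hq : ∀ P : β, (q P).Prime := fun P => by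
    have := P.1.isPrime
    have : NeZero P.1.asIdeal := ⟨P.1.ne_bot⟩
    exact Nat.absNorm_under_prime _
  have hqP : ∀ P : β, (q P : 𝓞 K) ∈ P.1.asIdeal := fun P => by
    have := Int.absNorm_under_mem P.1.asIdeal
    simpa [q] using this
  let w : ℕ → ℝ≥0 := fun n => if n ≤ N then 1 else ((n : ℝ≥0) ^ 2)⁻¹
  have hw : Summable w := by
    have h2 : Summable fun n : ℕ => ((n : ℝ≥0) ^ 2)⁻¹ :=
      NNReal.summable_coe.1 (by push_cast; exact Real.summable_nat_pow_inv.2 (by norm_num))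
    rw [← NNReal.summable_nat_add_iff (N + 1)] at h2 ⊢
    refine h2.congr fun n => ?_
    simp only [w]
    rw [if_neg (by omega)]
  have hnorm : ∀ P : β, ∃ f : ℕ, Ideal.absNorm P.1.asIdeal = q P ^ f := fun P => by
    have : P.1.asIdeal.LiesOver (Ideal.span {(q P : ℤ)}) := by
      constructor
      exact (Int.ideal_span_absNorm_eq_self _)
    exact ⟨_, Ideal.absNorm_eq_pow_inertiaDeg' P.1.asIdeal (hq P)⟩
  have hle : ∀ P : β, ((Ideal.absNorm P.1.asIdeal : ℝ≥0)⁻¹) ≤ w (q P) ∧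
      q P ≤ Ideal.absNorm P.1.asIdeal := fun P => by
    obtain ⟨f, hf⟩ := hnorm P
    have h2 := HeightOneSpectrum.two_le_absNorm P.1
    have hf0 : f ≠ 0 := by
      rintro rfl
      rw [pow_zero] at hf; omega
    refine ⟨?_, by rw [hf]; exact Nat.le_self_pow hf0 _⟩
    simp only [w]
    split_ifs with h
    · apply inv_le_one_of_one_le₀
      exact_mod_cast (by omega : 1 ≤ Ideal.absNorm P.1.asIdeal)
    · have hf1 : 2 ≤ f := by
        by_contra hlt
        have : f = 1 := by omega
        subst this
        rw [pow_one] at hf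
        refine P.2 ⟨?_, ?_⟩
        · rw [hf]; exact hq P
        · rw [hf]; omega
      have h3 : q P ^ 2 ≤ Ideal.absNorm P.1.asIdeal := by
        rw [hf]; exact Nat.pow_le_pow_right (hq P).pos hf1
      have := (hq P).pos
      gcongr
      exact_mod_cast h3
  refine ne_top_of_le_ne_top (b := ∑' n : ℕ, (Module.finrank ℚ K : ℝ≥0∞) * (w n : ℝ≥0∞)) ?_ ?_
  · rw [ENNReal.tsum_mul_left]
    exact ENNReal.mul_ne_top (by simp) (ENNReal.tsum_coe_ne_top_iff_summable.2 hw)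
  · rw [← (Equiv.sigmaFiberEquiv q).tsum_eq, ENNReal.tsum_sigma']
    refine ENNReal.tsum_le_tsum fun n => ?_
    have : ∀ P : {P // q P = n}, (((Ideal.absNorm ((Equiv.sigmaFiberEquiv q) ⟨n, P⟩).1.asIdeal :
        ℝ≥0)⁻¹ : ℝ≥0) : ℝ≥0∞) ≤ w n := by
      rintro ⟨P, rfl⟩
      exact_mod_cast (hle P).1
    refine (ENNReal.tsum_le_tsum this).trans ?_
    rw [ENNReal.tsum_const]
    gcongr
    by_contra hlt
    push Not at hlt
    have hlt' : ((Module.finrank ℚ K + 1 : ℕ) : ℕ∞) ≤ ENat.card {P // q P = n} := by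
      have : ((Module.finrank ℚ K : ℕ) : ℕ∞) < ENat.card {P // q P = n} := by
        exact_mod_cast hlt
      exact Order.add_one_le_of_lt this
    have hlt2 : ((Module.finrank ℚ K + 1 : ℕ) : ℕ∞) ≤
        Set.encard (Set.univ : Set {P // q P = n}) := by
      rwa [Set.encard_univ]
    obtain ⟨t, -, ht⟩ := Set.exists_subset_encard_eq hlt2
    have htf : t.Finite := Set.finite_of_encard_eq_coe ht
    have hinj : Function.Injective fun P : {P // q P = n} => P.1.1 :=
      Subtype.val_injective.comp Subtype.val_injective
    classical
    have hne : t.Nonempty := by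
      rw [← Set.encard_ne_zero, ht]; simp
    obtain ⟨P₀, _⟩ := hne
    have := card_le_finrank_of_mem (q := n) (P₀.2 ▸ hq P₀.1)
      (htf.toFinset.image fun P => P.1.1) ?_ ?_
    · rw [Finset.card_image_of_injective _ hinj] at this
      rw [htf.encard_eq_coe_toFinset_card] at ht
      have : htf.toFinset.card = Module.finrank ℚ K + 1 := by exact_mod_cast ht
      omega
    · intro P hP
      obtain ⟨Q, _, rfl⟩ := Finset.mem_image.1 hP
      have := hqP Q.1
      rwa [Q.2] at this
    · intro P hP
      obtain ⟨Q, _, rfl⟩ := Finset.mem_image.1 hP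
      have := (hle Q.1).2
      rwa [Q.2] at this

end

section
open scoped ENNReal NNReal
open Filter Topology NumberField IsDedekindDomain

section
variable {K L : Type*} [Field K] [NumberField K] [Field L] [NumberField L] [Algebra K L]


theorem exists_pair_of_isSquare (σ : L ≃ₐ[K] L) (β : 𝓞 L) (δ : 𝓞 K)
    (hβ : β ^ 2 = algebraMap (𝓞 K) (𝓞 L) δ) (hσ : σ β = -(β : L))
    (hL : ∀ x : L, ∃ u v : K, x = algebraMap K L u + algebraMap K L v * β)
    (P : HeightOneSpectrum (𝓞 K)) (hP : 2 * δ ∉ P.asIdeal)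
    (hsq : ∃ b : 𝓞 K, δ - b ^ 2 ∈ P.asIdeal) :
    ∃ Q : Fin 2 → HeightOneSpectrum (𝓞 L), Function.Injective Q ∧
      ∀ i, (Q i).asIdeal.under (𝓞 K) = P.asIdeal ∧
        Ideal.absNorm (Q i).asIdeal = Ideal.absNorm P.asIdeal := by
  have := P.isPrime
  have hmax := P.isMaximal
  have main : ∀ Q : Ideal (𝓞 L), Q.IsPrime → Q.comap (algebraMap (𝓞 K) (𝓞 L)) = P.asIdeal →
      ∀ b : 𝓞 K, β - algebraMap _ _ b ∈ Q → Ideal.absNorm Q = Ideal.absNorm P.asIdeal := by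
    intro Q hQ hcomap b hb
    let f : 𝓞 K ⧸ P.asIdeal →+* 𝓞 L ⧸ Q :=
      Ideal.quotientMap Q (algebraMap (𝓞 K) (𝓞 L)) hcomap.ge
    have hinj : Function.Injective f := Ideal.quotientMap_injective' hcomap.le
    have hsurj : Function.Surjective f := by
      intro y
      obtain ⟨x, rfl⟩ := Ideal.Quotient.mk_surjective y
      obtain ⟨u, v, huv⟩ := hL x
      have hσx : ∀ z : 𝓞 L, IsIntegral ℤ ((z : L) + σ z) := fun z =>
        z.isIntegral_coe.add (z.isIntegral_coe.map (σ : L →ₐ[K] L))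
      have hβ' : (β : L) ^ 2 = algebraMap K L δ := by
        have := congrArg (algebraMap (𝓞 L) L) hβ
        rw [map_pow] at this
        exact this
      have hInt : ∀ k : K, IsIntegral ℤ (algebraMap K L k) → ∃ t : 𝓞 K, (t : K) = k := by
        intro k hk
        exact ⟨⟨k, (isIntegral_algebraMap_iff (algebraMap K L).injective).1 hk⟩, rfl⟩
      obtain ⟨t, ht⟩ := hInt (2 * u) (by
        have := hσx x
        rw [huv] at this
        convert this using 1
        simp only [map_add, map_mul, AlgEquiv.commutes, hσ, map_ofNat]
        ring)
      obtain ⟨c, hc⟩ := hInt (2 * v * δ) (by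
        have := hσx (x * β)
        rw [show ((x * β : 𝓞 L) : L) = x * β from rfl, map_mul, huv] at this
        convert this using 1
        simp only [map_add, map_mul, AlgEquiv.commutes, hσ, map_ofNat]
        rw [← hβ']
        ring)
      have hx : algebraMap (𝓞 K) (𝓞 L) (2 * δ) * x =
          algebraMap (𝓞 K) (𝓞 L) (δ * t) + algebraMap (𝓞 K) (𝓞 L) c * β := by
        apply RingOfIntegers.coe_injective
        change algebraMap K L ((2 * δ : 𝓞 K) : K) * (x : L) =
          algebraMap K L ((δ * t : 𝓞 K) : K) + algebraMap K L (c : K) * (β : L)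
        rw [show ((2 * δ : 𝓞 K) : K) = 2 * δ from rfl,
          show ((δ * t : 𝓞 K) : K) = δ * t from rfl, huv, ht, hc]
        simp only [map_mul, map_ofNat]
        ring
      obtain ⟨e, he⟩ : ∃ e : 𝓞 K, 2 * δ * e - 1 ∈ P.asIdeal := by
        obtain ⟨e, he⟩ := hmax.exists_inv hP
        obtain ⟨i, hi, h⟩ := he
        refine ⟨e, ?_⟩
        rw [← h]
        convert neg_mem hi using 1
        ring
      refine ⟨Ideal.Quotient.mk _ (e * (δ * t + c * b)), ?_⟩
      simp only [f, Ideal.quotientMap_mk]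
      rw [Ideal.Quotient.eq]
      have h1 : algebraMap (𝓞 K) (𝓞 L) (2 * δ * e - 1) ∈ Q := by
        rw [← Ideal.mem_comap, hcomap]; exact he
      have : algebraMap (𝓞 K) (𝓞 L) (e * (δ * t + c * b)) - x =
          algebraMap (𝓞 K) (𝓞 L) (2 * δ * e - 1) * x -
          algebraMap (𝓞 K) (𝓞 L) (e * c) * (β - algebraMap _ _ b) := by
        simp only [map_mul, map_add, map_sub, map_one, map_ofNat] at hx ⊢
        linear_combination (-(algebraMap (𝓞 K) (𝓞 L) e)) * hx
      rw [this]
      exact sub_mem (Q.mul_mem_right _ h1) (Q.mul_mem_left _ hb)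
    rw [Ideal.absNorm_apply, Ideal.absNorm_apply, Submodule.cardQuot_apply,
      Submodule.cardQuot_apply]
    exact (Nat.card_congr (Equiv.ofBijective f ⟨hinj, hsurj⟩)).symm
  obtain ⟨b, hb⟩ := hsq
  obtain ⟨Q, -, hQ, hcomap⟩ := Ideal.exists_ideal_over_prime_of_isIntegral P.asIdeal
    (⊥ : Ideal (𝓞 L)) (by
      rw [Ideal.comap_bot_of_injective _ (FaithfulSMul.algebraMap_injective (𝓞 K) (𝓞 L))]
      exact bot_le)
  have hmul : (β - algebraMap _ _ b) * (β - algebraMap _ _ (-b)) ∈ Q := by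
    have : algebraMap (𝓞 K) (𝓞 L) (δ - b ^ 2) ∈ Q := by
      rw [← Ideal.mem_comap, hcomap]; exact hb
    convert this using 1
    simp only [map_sub, map_neg, map_pow]
    rw [← hβ]; ring
  obtain ⟨c, hc, hcb⟩ : ∃ c : 𝓞 K, β - algebraMap _ _ c ∈ Q ∧ δ - c ^ 2 ∈ P.asIdeal := by
    rcases hQ.mem_or_mem hmul with h | h
    · exact ⟨_, h, hb⟩
    · exact ⟨_, h, by rwa [neg_sq]⟩
  let τ : 𝓞 L ≃+* 𝓞 L := RingOfIntegers.mapRingEquiv σ.toRingEquiv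
  have hτβ : τ β = -β := RingOfIntegers.coe_injective hσ
  have hτ : ∀ k : 𝓞 K, τ (algebraMap _ _ k) = algebraMap _ _ k := fun k =>
    RingOfIntegers.coe_injective (σ.commutes k)
  have hcomap' : (Q.comap τ).comap (algebraMap (𝓞 K) (𝓞 L)) = P.asIdeal := by
    rw [← hcomap]
    ext k
    simp [Ideal.mem_comap, hτ]
  have hQ' : (Q.comap τ).IsPrime := Ideal.comap_isPrime _ _
  have hc' : β - algebraMap _ _ (-c) ∈ Q.comap τ := by
    rw [Ideal.mem_comap, map_sub, hτβ, hτ]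
    convert neg_mem hc using 1
    simp only [map_neg]
    ring
  have hne : ∀ I : Ideal (𝓞 L), I.comap (algebraMap (𝓞 K) (𝓞 L)) = P.asIdeal → I ≠ ⊥ := by
    rintro I hI rfl
    apply P.ne_bot
    rw [← hI, Ideal.comap_bot_of_injective _ (FaithfulSMul.algebraMap_injective (𝓞 K) (𝓞 L))]
  refine ⟨![⟨Q, hQ, hne _ hcomap⟩, ⟨Q.comap τ, hQ', hne _ hcomap'⟩], ?_, ?_⟩
  · have hdiff : Q ≠ Q.comap τ := by
      intro h
      rw [← h] at hc'
      have h2 : algebraMap (𝓞 K) (𝓞 L) (2 * c) ∈ Q := by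
        convert sub_mem hc' hc using 1
        simp only [map_mul, map_neg, map_ofNat]
        ring
      rw [← Ideal.mem_comap, hcomap] at h2
      apply hP
      have : (2 * δ : 𝓞 K) = 2 * (δ - c ^ 2) + 2 * c * c := by ring
      rw [this]
      exact add_mem (P.asIdeal.mul_mem_left _ hcb) (P.asIdeal.mul_mem_right _ h2)
    intro i j hij
    fin_cases i <;> fin_cases j
    · rfl
    · exact absurd (congrArg HeightOneSpectrum.asIdeal hij) hdiff
    · exact absurd (congrArg HeightOneSpectrum.asIdeal hij) hdiff.symm
    · rfl
  · intro i
    fin_cases i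
    · exact ⟨hcomap, main _ hQ hcomap c hc⟩
    · exact ⟨hcomap', main _ hQ' hcomap' (-c) hc'⟩
end

end

section
open scoped ENNReal NNReal
open Filter Topology NumberField IsDedekindDomain

section
variable {K L : Type*} [Field K] [NumberField K] [Field L] [NumberField L] [Algebra K L]

noncomputable def idealWeight (K : Type*) [Field K] [NumberField K] (s : ℝ) :
    Ideal (𝓞 K) →* ℝ≥0∞ where
  toFun I := ENNReal.ofReal ((Ideal.absNorm I : ℝ) ^ (-s))
  map_one' := by simp
  map_mul' I J := by
    rw [map_mul, Nat.cast_mul, Real.mul_rpow (by positivity) (by positivity),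
      ENNReal.ofReal_mul (by positivity)]

theorem exists_multisets_prod_eq (p : HeightOneSpectrum (𝓞 K) → Prop) (I : Ideal (𝓞 K))
    (hI : I ≠ ⊥) : ∃ (g : Multiset {P // p P}) (b : Multiset {P // ¬ p P}),
      (g.map fun P => P.1.asIdeal).prod * (b.map fun P => P.1.asIdeal).prod = I := by
  classical
  induction I using UniqueFactorizationMonoid.induction_on_prime with
  | h₁ => exact absurd rfl hI
  | h₂ x hx =>
    rw [Ideal.isUnit_iff] at hx
    exact ⟨0, 0, by simp [hx]⟩
  | h₃ a q ha hq ih =>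
    obtain ⟨g, b, hgb⟩ := ih ha
    let P : HeightOneSpectrum (𝓞 K) := ⟨q, Ideal.isPrime_of_prime hq, hq.ne_zero⟩
    by_cases hP : p P
    · exact ⟨⟨P, hP⟩ ::ₘ g, b, by simp [← hgb, P, mul_assoc]⟩
    · exact ⟨g, ⟨P, hP⟩ ::ₘ b, by simp [← hgb, P, mul_left_comm]⟩

theorem prod_asIdeal_ne_bot {F ι : Type*} [Field F] (Q : ι → HeightOneSpectrum (𝓞 F))
    (m : Multiset ι) :
    (m.map fun i => (Q i).asIdeal).prod ≠ ⊥ := by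
  rw [← Ideal.zero_eq_bot, Ne, Multiset.prod_eq_zero_iff, Multiset.mem_map]
  rintro ⟨i, -, hi⟩
  exact (Q i).ne_bot hi

theorem prod_asIdeal_injective {ι : Type*} (Q : ι → HeightOneSpectrum (𝓞 K))
    (hQ : Function.Injective Q) :
    Function.Injective fun m : Multiset ι => (m.map fun i => (Q i).asIdeal).prod := by
  intro m m' h
  have key : ∀ m : Multiset ι, UniqueFactorizationMonoid.normalizedFactors
      (m.map fun i => (Q i).asIdeal).prod = m.map fun i => (Q i).asIdeal := fun m => by
    apply UniqueFactorizationMonoid.normalizedFactors_prod_of_prime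
    intro p hp
    obtain ⟨i, -, rfl⟩ := Multiset.mem_map.1 hp
    exact (Q i).prime
  have := congrArg UniqueFactorizationMonoid.normalizedFactors h
  simp only [key] at this
  refine Multiset.map_injective (fun i j hij => hQ ?_) this
  exact HeightOneSpectrum.ext hij

theorem multiset_map_add_map_injective {ι κ : Type*} (f g : ι → κ) (hf : Function.Injective f)
    (hg : Function.Injective g) (hfg : ∀ i j, f i ≠ g j) :
    Function.Injective fun m : Multiset ι × Multiset ι => m.1.map f + m.2.map g := by
  classical
  rintro ⟨m, n⟩ ⟨m', n'⟩ h
  simp only [Prod.mk.injEq]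
  have h1 : ∀ i, ∀ m n : Multiset ι, (m.map f + n.map g).count (f i) = m.count i := by
    intro i m n
    rw [Multiset.count_add, Multiset.count_map_eq_count' f _ hf, Nat.add_eq_left,
      Multiset.count_eq_zero]
    simp only [Multiset.mem_map, not_exists, not_and]
    exact fun j _ h => hfg _ _ h.symm
  have h2 : ∀ i, ∀ m n : Multiset ι, (m.map f + n.map g).count (g i) = n.count i := by
    intro i m n
    rw [Multiset.count_add, Multiset.count_map_eq_count' g _ hg, Nat.add_eq_right,
      Multiset.count_eq_zero]
    simp only [Multiset.mem_map, not_exists, not_and]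
    exact fun j _ h => hfg _ _ h
  constructor <;> ext i
  · rw [← h1 i m n, ← h1 i m' n']; exact congrArg _ h
  · rw [← h2 i m n, ← h2 i m' n']; exact congrArg _ h

theorem idealZeta_le (p : HeightOneSpectrum (𝓞 K) → Prop) (s : ℝ) :
    idealZeta K s ≤
      (∑' m : Multiset {P // p P}, (m.map fun P => idealWeight K s P.1.asIdeal).prod) *
      ∑' m : Multiset {P // ¬ p P}, (m.map fun P => idealWeight K s P.1.asIdeal).prod := by
  let f : Multiset {P // p P} × Multiset {P // ¬ p P} → {I : Ideal (𝓞 K) // I ≠ ⊥} := fun m =>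
    ⟨(m.1.map fun P => P.1.asIdeal).prod * (m.2.map fun P => P.1.asIdeal).prod,
      mul_ne_zero (prod_asIdeal_ne_bot _ _) (prod_asIdeal_ne_bot _ _)⟩
  have hf : Function.Surjective f := by
    rintro ⟨I, hI⟩
    obtain ⟨g, b, h⟩ := exists_multisets_prod_eq p I hI
    exact ⟨(g, b), Subtype.ext h⟩
  refine (ENNReal.tsum_le_tsum_comp_of_surjective hf _).trans_eq ?_
  refine (ENNReal.tsum_prod (f := fun m n => idealWeight K s (f (m, n)).1)).trans ?_
  rw [← ENNReal.tsum_mul_right]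
  refine tsum_congr fun m => ?_
  rw [← ENNReal.tsum_mul_left]
  refine tsum_congr fun n => ?_
  change idealWeight K s (_ * _) = _
  rw [map_mul, map_multiset_prod, map_multiset_prod, Multiset.map_map, Multiset.map_map]
  rfl

theorem sq_le_idealZeta {ι : Type*} (Q : ι → Fin 2 → HeightOneSpectrum (𝓞 L))
    (hQ : ∀ i j k l, Q i j = Q k l → i = k ∧ j = l) (s : ℝ) (x : ι → ℝ≥0∞)
    (hx : ∀ i j, idealWeight L s (Q i j).asIdeal = x i) :
    (∑' m : Multiset ι, (m.map x).prod) ^ 2 ≤ idealZeta L s := by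
  let f : Multiset ι × Multiset ι → {I : Ideal (𝓞 L) // I ≠ ⊥} := fun m =>
    ⟨((m.1.map (Q · 0) + m.2.map (Q · 1)).map fun P => P.asIdeal).prod,
      prod_asIdeal_ne_bot _ _⟩
  have hf : Function.Injective f := by
    intro m n h
    have := prod_asIdeal_injective id Function.injective_id (congrArg Subtype.val h)
    refine multiset_map_add_map_injective _ _ ?_ ?_ ?_ this
    · exact fun i j h => (hQ _ _ _ _ h).1
    · exact fun i j h => (hQ _ _ _ _ h).1
    · exact fun i j h => absurd (hQ _ _ _ _ h).2 (by decide)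
  refine le_trans (le_of_eq ?_) (ENNReal.tsum_comp_le_tsum_of_injective hf _)
  refine Eq.trans ?_ (ENNReal.tsum_prod (f := fun m n => idealWeight L s (f (m, n)).1)).symm
  rw [sq, ← ENNReal.tsum_mul_right]
  refine tsum_congr fun m => ?_
  rw [← ENNReal.tsum_mul_left]
  refine tsum_congr fun n => ?_
  change _ = idealWeight L s
    ((m.map (Q · 0) + n.map (Q · 1)).map fun P => P.asIdeal).prod
  simp only [Multiset.map_add, Multiset.map_map, Multiset.prod_add, map_mul, map_multiset_prod,
    Function.comp_def, hx]

end

theorem exists_quadratic_extension {K : Type} [Field K] [NumberField K] (δ : K)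
    (hδ : ¬ IsSquare δ) : ∃ (L : Type) (_ : Field L) (_ : NumberField L) (_ : Algebra K L)
      (σ : L ≃ₐ[K] L) (β : L), β ^ 2 = algebraMap K L δ ∧ σ β = -β ∧
      ∀ x : L, ∃ u v : K, x = algebraMap K L u + algebraMap K L v * β := by
  have hirr : Irreducible (Polynomial.X ^ 2 - Polynomial.C δ) := by
    apply Polynomial.irreducible_of_degree_le_three_of_not_isRoot
    · rw [Polynomial.natDegree_X_pow_sub_C]; decide
    · intro x hx
      apply hδ
      simp only [Polynomial.IsRoot, Polynomial.eval_sub, Polynomial.eval_pow, Polynomial.eval_X,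
        Polynomial.eval_C] at hx
      exact ⟨x, by linear_combination -hx⟩
  have : Fact (Irreducible (Polynomial.X ^ 2 - Polynomial.C δ)) := ⟨hirr⟩
  have hmonic : (Polynomial.X ^ 2 - Polynomial.C δ).Monic :=
    Polynomial.monic_X_pow_sub_C δ two_ne_zero
  let L := AdjoinRoot (Polynomial.X ^ 2 - Polynomial.C δ)
  let β : L := AdjoinRoot.root _
  have hβ : β ^ 2 = algebraMap K L δ := by
    have := AdjoinRoot.eval₂_root (Polynomial.X ^ 2 - Polynomial.C δ)
    simp only [Polynomial.eval₂_sub, Polynomial.eval₂_pow, Polynomial.eval₂_X,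
      Polynomial.eval₂_C] at this
    exact sub_eq_zero.1 this
  have : Module.Finite K L := hmonic.finite_adjoinRoot
  have : CharZero L := charZero_of_injective_algebraMap (algebraMap K L).injective
  have : NumberField L :=
    { to_charZero := inferInstance, to_finiteDimensional := Module.Finite.trans K L }
  let σ0 : L →ₐ[K] L := AdjoinRoot.liftAlgHom _ (Algebra.ofId K L) (-β) (by
    simp only [Polynomial.eval₂_sub, Polynomial.eval₂_pow, Polynomial.eval₂_X,
      Polynomial.eval₂_C]
    rw [neg_sq, hβ]
    exact sub_self _)
  have hσ0 : σ0 β = -β := AdjoinRoot.liftAlgHom_root _ _ _ _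
  refine ⟨L, inferInstance, inferInstance, inferInstance,
    AlgEquiv.ofBijective σ0 (Algebra.IsAlgebraic.algHom_bijective σ0), β, hβ, hσ0, ?_⟩
  intro x
  obtain ⟨p, rfl⟩ := AdjoinRoot.mk_surjective x
  rw [← Polynomial.modByMonic_add_div p (q := Polynomial.X ^ 2 - Polynomial.C δ)]
  have hdeg : (p %ₘ (Polynomial.X ^ 2 - Polynomial.C δ)).natDegree ≤ 1 := by
    have := Polynomial.natDegree_modByMonic_lt p hmonic (by
      intro h
      have := congrArg Polynomial.natDegree h
      rw [Polynomial.natDegree_X_pow_sub_C] at this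
      simp at this)
    rw [Polynomial.natDegree_X_pow_sub_C] at this
    omega
  obtain ⟨a, b, hab⟩ := Polynomial.exists_eq_X_add_C_of_natDegree_le_one hdeg
  refine ⟨b, a, ?_⟩
  rw [hab]
  simp only [map_add, map_mul, AdjoinRoot.mk_self, zero_mul, add_zero, AdjoinRoot.mk_C,
    AdjoinRoot.mk_X]
  rw [add_comm]
  rfl

end

section
open scoped ENNReal NNReal
open Filter Topology NumberField IsDedekindDomain
theorem idealWeight_le_inv {K : Type*} [Field K] [NumberField K] (s : ℝ) (hs : 1 ≤ s)
    (P : HeightOneSpectrum (𝓞 K)) :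
    idealWeight K s P.asIdeal ≤ (((Ideal.absNorm P.asIdeal : ℝ≥0)⁻¹ : ℝ≥0) : ℝ≥0∞) := by
  have h2 : (1 : ℝ) ≤ Ideal.absNorm P.asIdeal := by
    exact_mod_cast (HeightOneSpectrum.two_le_absNorm P).trans' one_le_two
  change ENNReal.ofReal _ ≤ _
  rw [ENNReal.ofReal_le_iff_le_toReal ENNReal.coe_ne_top]
  simp only [ENNReal.coe_toReal, NNReal.coe_inv, NNReal.coe_natCast]
  rw [← Real.rpow_neg_one]
  exact Real.rpow_le_rpow_of_exponent_le h2 (by linarith)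

theorem exists_prime_not_square_aux {K L : Type*} [Field K] [NumberField K] [Field L]
    [NumberField L] [Algebra K L] (σ : L ≃ₐ[K] L) (β : 𝓞 L) (δ : 𝓞 K) (hδ : δ ≠ 0)
    (hβ : β ^ 2 = algebraMap (𝓞 K) (𝓞 L) δ) (hσ : σ β = -(β : L))
    (hL : ∀ x : L, ∃ u v : K, x = algebraMap K L u + algebraMap K L v * β) (N : ℕ) :
    ∃ P : HeightOneSpectrum (𝓞 K), (Ideal.absNorm P.asIdeal).Prime ∧
      N < Ideal.absNorm P.asIdeal ∧ ∀ b : 𝓞 K, δ - b ^ 2 ∉ P.asIdeal := by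
  by_contra! hcon
  have h2δ : (2 * δ : 𝓞 K) ≠ 0 := mul_ne_zero two_ne_zero hδ
  set N' := max N (Ideal.absNorm (Ideal.span {2 * δ})) with hN'
  let good : HeightOneSpectrum (𝓞 K) → Prop := fun P =>
    (Ideal.absNorm P.asIdeal).Prime ∧ N' < Ideal.absNorm P.asIdeal
  have hpair : ∀ P : {P // good P}, ∃ Q : Fin 2 → HeightOneSpectrum (𝓞 L), Function.Injective Q ∧
      ∀ i, (Q i).asIdeal.under (𝓞 K) = P.1.asIdeal ∧
        Ideal.absNorm (Q i).asIdeal = Ideal.absNorm P.1.asIdeal := by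
    rintro ⟨P, hP, hP'⟩
    refine exists_pair_of_isSquare σ β δ hβ hσ hL P ?_
      (hcon P hP ((le_max_left _ _).trans_lt hP'))
    intro hmem
    have h1 : Ideal.absNorm P.asIdeal ∣ Ideal.absNorm (Ideal.span {2 * δ}) :=
      Ideal.absNorm_dvd_absNorm_of_le ((Ideal.span_singleton_le_iff_mem _).2 hmem)
    have h2 : Ideal.absNorm (Ideal.span {2 * δ}) ≠ 0 := by
      rw [Ne, Ideal.absNorm_eq_zero_iff, Ideal.span_singleton_eq_bot]
      exact h2δ
    exact absurd (Nat.le_of_dvd (Nat.pos_of_ne_zero h2) h1)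
      ((le_max_right _ _).trans_lt hP').not_ge
  choose Q hQinj hQ using hpair
  have hQ' : ∀ i j k l, Q i j = Q k l → i = k ∧ j = l := by
    intro i j k l h
    have : i = k := by
      apply Subtype.ext
      apply HeightOneSpectrum.ext
      rw [← (hQ i j).1, ← (hQ k l).1, h]
    subst this
    exact ⟨rfl, hQinj i h⟩
  set B := ∑' m : Multiset {P // ¬ good P},
    (m.map fun P => (((Ideal.absNorm P.1.asIdeal : ℝ≥0)⁻¹ : ℝ≥0) : ℝ≥0∞)).prod with hB
  have hBtop : B < ∞ := by
    refine tsum_multiset_prod_map_lt_top _ ?_ (summable_inv_absNorm_of_not_prime K N')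
    intro P
    rw [one_div]
    have : (2 : ℝ≥0) ≤ Ideal.absNorm P.1.asIdeal := by
      exact_mod_cast HeightOneSpectrum.two_le_absNorm P.1
    exact inv_anti₀ two_pos this
  have hbound : ∀ s : ℝ, 1 < s → idealZeta K s ^ 2 ≤ idealZeta L s * B ^ 2 := by
    intro s hs
    have h1 := idealZeta_le good s
    have h2 := sq_le_idealZeta Q hQ' s (fun P => idealWeight K s P.1.asIdeal) (fun P j => by
      change ENNReal.ofReal _ = ENNReal.ofReal _
      rw [(hQ P j).2])
    have h3 : ∑' m : Multiset {P // ¬ good P}, (m.map fun P => idealWeight K s P.1.asIdeal).prod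
        ≤ B := by
      refine ENNReal.tsum_le_tsum fun m => ?_
      exact Multiset.prod_map_le_prod_map _ _ fun P _ => idealWeight_le_inv s hs.le P.1
    calc idealZeta K s ^ 2 ≤ (_ * B) ^ 2 := pow_le_pow_left₀ bot_le (h1.trans (by gcongr)) 2
      _ = _ ^ 2 * B ^ 2 := mul_pow _ _ 2
      _ ≤ _ := by gcongr
  obtain ⟨ρ, hρ, hK⟩ := tendsto_sub_one_mul_idealZeta K
  obtain ⟨ρ', hρ', hL'⟩ := tendsto_sub_one_mul_idealZeta L
  have hlim : ∀ᶠ s : ℝ in 𝓝[>] 1, (s - 1) * (4 * ρ' * B.toReal ^ 2) < ρ ^ 2 := by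
    have : Tendsto (fun s : ℝ => (s - 1) * (4 * ρ' * B.toReal ^ 2)) (𝓝[>] 1) (𝓝 0) := by
      have : Continuous fun s : ℝ => (s - 1) * (4 * ρ' * B.toReal ^ 2) := by fun_prop
      have := (this.tendsto 1).mono_left (nhdsWithin_le_nhds (s := Set.Ioi 1))
      simpa using this
    exact this.eventually_lt_const (by positivity)
  obtain ⟨s, ⟨z, hz, hz1, -⟩, ⟨z', hz', hz1', hz2'⟩, hs, hs1⟩ :=
    (hK.and (hL'.and (hlim.and self_mem_nhdsWithin))).exists
  have hs1 : 1 < s := hs1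
  have hs0 : 0 < s - 1 := by linarith
  have hzpos : 0 < z := by
    by_contra! h
    nlinarith
  have hzpos' : 0 < z' := by
    by_contra! h
    nlinarith
  have := hbound s hs1
  rw [hz, hz', ← ENNReal.ofReal_toReal hBtop.ne, ← ENNReal.ofReal_pow hzpos.le,
    ← ENNReal.ofReal_pow ENNReal.toReal_nonneg, ← ENNReal.ofReal_mul hzpos'.le,
    ENNReal.ofReal_le_ofReal_iff (by positivity)] at this
  have h1 : ρ ^ 2 ≤ ((s - 1) * z) ^ 2 := pow_le_pow_left₀ hρ.le hz1 2
  have h2 : ((s - 1) * z) ^ 2 ≤ (s - 1) * (((s - 1) * z') * B.toReal ^ 2) := by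
    calc ((s - 1) * z) ^ 2 = (s - 1) ^ 2 * z ^ 2 := mul_pow _ _ 2
      _ ≤ (s - 1) ^ 2 * (z' * B.toReal ^ 2) := by gcongr
      _ = _ := by ring
  have h3 : (s - 1) * (((s - 1) * z') * B.toReal ^ 2) ≤ (s - 1) * (4 * ρ' * B.toReal ^ 2) := by
    gcongr
  linarith

theorem exists_prime_ringHom_not_isSquare {K : Type} [Field K] [NumberField K] (δ : 𝓞 K)
    (hδ : ¬ IsSquare (δ : K)) (N : ℕ) :
    ∃ p : ℕ, p.Prime ∧ N < p ∧ ∃ φ : 𝓞 K →+* ZMod p, ¬ IsSquare (φ δ) := by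
  obtain ⟨L, _, _, _, σ, β, hβ, hσ, hL⟩ := exists_quadratic_extension (δ : K) hδ
  have hInt : IsIntegral ℤ β := by
    have : IsIntegral ℤ (β ^ 2) := by
      rw [hβ]
      exact δ.isIntegral_coe.map (IsScalarTower.toAlgHom ℤ K L)
    exact this.of_pow two_pos
  have hδ0 : δ ≠ 0 := by
    rintro rfl
    exact hδ ⟨0, by simp⟩
  obtain ⟨P, hP, hN, hsq⟩ := exists_prime_not_square_aux σ ⟨β, hInt⟩ δ hδ0
    (RingOfIntegers.coe_injective hβ) hσ hL N
  have hmax := P.isMaximal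
  have : Fact (Ideal.absNorm P.asIdeal).Prime := ⟨hP⟩
  have hcard : Nat.card (𝓞 K ⧸ P.asIdeal) = Ideal.absNorm P.asIdeal := by
    rw [Ideal.absNorm_apply, Submodule.cardQuot_apply]
  have : Finite (𝓞 K ⧸ P.asIdeal) := Nat.finite_of_card_ne_zero (hcard ▸ hP.ne_zero)
  have := Fintype.ofFinite (𝓞 K ⧸ P.asIdeal)
  let e := (ZMod.ringEquivOfPrime (𝓞 K ⧸ P.asIdeal) hP (by
    rw [← hcard, Nat.card_eq_fintype_card])).symm
  refine ⟨_, hP, hN, e.toRingHom.comp (Ideal.Quotient.mk _), ?_⟩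
  rintro ⟨c, hc⟩
  obtain ⟨b, hb⟩ := Ideal.Quotient.mk_surjective (e.symm c)
  refine hsq b ?_
  rw [← Ideal.Quotient.eq, map_pow, hb]
  apply e.injective
  rw [map_pow, e.apply_symm_apply, sq]
  exact hc

end

section
open NumberField

theorem exists_subring_ringHom_not_isSquare {K : Type} [Field K] [NumberField K] (δ : K)
    (hδ : ¬ IsSquare δ) (S : Finset K) (N : ℕ) :
    ∃ p : ℕ, p.Prime ∧ N < p ∧ ∃ (R : Subring K) (φ : R →+* ZMod p), (∀ x ∈ S, x ∈ R) ∧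
      ∃ h : δ ∈ R, ¬ IsSquare (φ ⟨δ, h⟩) := by
  classical
  have hden : ∀ x : K, ∃ n : ℤ, n ≠ 0 ∧ ∃ a : 𝓞 K, (a : K) = n * x := by
    intro x
    have hx : IsAlgebraic ℤ x :=
      (IsFractionRing.isAlgebraic_iff ℤ ℚ K).2 (Algebra.IsAlgebraic.isAlgebraic x)
    obtain ⟨n, hn, h⟩ := hx.exists_integral_multiple
    exact ⟨n, hn, ⟨_, h⟩, zsmul_eq_mul _ _⟩
  choose n hn a ha using hden
  have h1 : ¬ IsSquare ((((n δ : ℤ) : 𝓞 K) * a δ : 𝓞 K) : K) := by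
    rintro ⟨r, hr⟩
    apply hδ
    have h0 : ((n δ : ℤ) : K) ≠ 0 := by exact_mod_cast hn δ
    refine ⟨r / n δ, ?_⟩
    have : (((n δ : ℤ) : 𝓞 K) * a δ : 𝓞 K) = ((n δ : ℤ) : K) * (n δ * δ) := by
      rw [← ha]; simp
    rw [this] at hr
    field_simp
    linear_combination hr
  obtain ⟨p, hp, hpN, φ, hφ⟩ := exists_prime_ringHom_not_isSquare _ h1
    (max N ((insert δ S).sup fun x => (n x).natAbs))
  have : Fact p.Prime := ⟨hp⟩
  have hnp : ∀ x ∈ insert δ S, φ (n x : ℤ) ≠ 0 := by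
    intro x hx
    rw [map_intCast, Ne, ZMod.intCast_zmod_eq_zero_iff_dvd]
    intro hdvd
    have h1 := Nat.le_of_dvd (Int.natAbs_pos.2 (hn x)) (Int.natCast_dvd.1 hdvd)
    have h2 := Finset.le_sup (f := fun x => (n x).natAbs) hx
    have h3 := (le_max_right N _).trans_lt hpN
    exact absurd (h1.trans h2) h3.not_ge
  let M : Submonoid (𝓞 K) := (nonZeroDivisors (ZMod p)).comap φ
  have hM : M ≤ nonZeroDivisors (𝓞 K) := by
    intro b hb
    apply mem_nonZeroDivisors_of_ne_zero
    rintro rfl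
    exact nonZeroDivisors.ne_zero hb (map_zero φ)
  let R := Localization.subalgebra.ofField K M hM
  have hR : IsLocalization M R := inferInstance
  let ψ : R →+* ZMod p := IsLocalization.lift (M := M) (g := φ) (fun y =>
    (nonZeroDivisors.ne_zero y.2).isUnit)
  have hψ : ∀ a : 𝓞 K, ψ (algebraMap _ R a) = φ a := IsLocalization.lift_eq _
  have hmem : ∀ x ∈ insert δ S, x ∈ R := by
    intro x hx
    refine ⟨a x, (n x : ℤ), mem_nonZeroDivisors_of_ne_zero (hnp x hx), ?_⟩
    have h0 : ((n x : ℤ) : K) ≠ 0 := by exact_mod_cast hn x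
    have h3 : algebraMap (𝓞 K) K (n x : ℤ) = ((n x : ℤ) : K) := map_intCast _ _
    rw [show algebraMap (𝓞 K) K (a x) = n x * x from ha x, h3]
    field_simp
  refine ⟨p, hp, (le_max_left _ _).trans_lt hpN, R.toSubring, ψ,
    fun x hx => hmem x (Finset.mem_insert_of_mem hx), hmem δ (Finset.mem_insert_self _ _), ?_⟩
  rintro ⟨c, hc⟩
  apply hφ
  refine ⟨φ ((n δ : ℤ) : 𝓞 K) * c, ?_⟩
  have h2 : ψ (algebraMap _ R (a δ)) = ψ (algebraMap _ R ((n δ : ℤ) : 𝓞 K)) *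
      ψ ⟨δ, hmem δ (Finset.mem_insert_self _ _)⟩ := by
    rw [← map_mul]
    congr 1
    apply Subtype.ext
    change ((a δ : 𝓞 K) : K) = algebraMap (𝓞 K) K ((n δ : ℤ) : 𝓞 K) * δ
    rw [ha δ, map_intCast]
  rw [hψ, hψ] at h2
  rw [map_mul, h2]
  have hc : ψ ⟨δ, hmem δ (Finset.mem_insert_self _ _)⟩ = c * c := hc
  rw [hc]
  ring

end

section
open NumberField

theorem exists_prime_not_isSquare_isSquare (d e : ℤ) (hd : ¬ IsSquare (d : ℚ))
    (hde : ¬ IsSquare ((d : ℚ) * e)) (N : ℕ) :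
    ∃ p : ℕ, p.Prime ∧ N < p ∧ ¬ IsSquare (d : ZMod p) ∧ IsSquare (e : ZMod p) := by
  have he0 : e ≠ 0 := by
    rintro rfl
    exact hde ⟨0, by simp⟩
  suffices h : ∃ (K : Type) (_ : Field K) (_ : NumberField K),
      ¬ IsSquare (d : K) ∧ IsSquare (e : K) by
    obtain ⟨K, _, _, h1, β, h2⟩ := h
    obtain ⟨p, hp, hN, R, φ, hS, hδ, hφ⟩ := exists_subring_ringHom_not_isSquare _ h1 {β} N
    refine ⟨p, hp, hN, ?_, φ ⟨β, hS β (by simp)⟩, ?_⟩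
    · have : (⟨(d : K), hδ⟩ : R) = (d : R) := Subtype.ext (by simp)
      rwa [this, map_intCast] at hφ
    · rw [← map_mul, ← map_intCast φ]
      congr 1
      exact Subtype.ext (by simp [h2])
  by_cases he : IsSquare (e : ℚ)
  · exact ⟨ℚ, inferInstance, inferInstance, hd, he⟩
  obtain ⟨L, _, _, _, σ, β, hβ, hσ, hL⟩ := exists_quadratic_extension (e : ℚ) he
  refine ⟨L, inferInstance, inferInstance, ?_, β, ?_⟩
  · rintro ⟨x, hx⟩
    obtain ⟨u, v, rfl⟩ := hL x
    have hβ0 : β ≠ 0 := by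
      rintro rfl
      rw [zero_pow two_ne_zero] at hβ
      exact he0 (by simpa using hβ.symm)
    have h1 := congrArg σ hx
    simp only [map_intCast, map_mul, map_add, AlgEquiv.commutes, hσ] at h1
    have h2 : algebraMap ℚ L u * algebraMap ℚ L v * β = 0 := by
      have : (4 : L) * (algebraMap ℚ L u * algebraMap ℚ L v * β) = 0 := by
        linear_combination hx.symm - h1.symm
      simpa using this
    have h3 : u = 0 ∨ v = 0 := by simpa [hβ0] using h2
    rcases h3 with rfl | rfl
    · apply hde
      refine ⟨v * e, ?_⟩
      apply (algebraMap ℚ L).injective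
      simp only [map_mul, map_intCast, map_zero, zero_add] at hx hβ ⊢
      linear_combination (e : L) * hx + (algebraMap ℚ L v) ^ 2 * e * hβ
    · apply hd
      refine ⟨u, ?_⟩
      apply (algebraMap ℚ L).injective
      simp only [map_mul, map_intCast, map_zero, zero_mul, add_zero] at hx ⊢
      exact hx
  · rw [← sq, hβ, map_intCast]

end

theorem dvd_of_mul_sq_add_sq {p : ℕ} [Fact p.Prime] {m X Y : ℤ} (hm : ¬ IsSquare (-m : ZMod p))
    (h : (p : ℤ) ∣ m * X ^ 2 + Y ^ 2) : (p : ℤ) ∣ X ∧ (p : ℤ) ∣ Y := by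
  simp only [← ZMod.intCast_zmod_eq_zero_iff_dvd] at h ⊢
  push_cast at h
  have hX : (X : ZMod p) = 0 := by
    by_contra hX
    exact hm ⟨Y / X, by field_simp; linear_combination -h⟩
  refine ⟨hX, ?_⟩
  rw [hX] at h
  simpa using h

/-- A ternary form is anisotropic at `p` if its determinant has valuation one and its reduction is
anisotropic on a plane. -/
theorem dvd_of_ternary_eq_zero {p : ℕ} [Fact p.Prime] {a b c f g h x y z : ℤ}
    (hm : ¬ IsSquare (-(b * c - f ^ 2 : ℤ) : ZMod p))
    (hdet : (p : ℤ) ∣ a * b * c + 2 * f * g * h - a * f ^ 2 - b * g ^ 2 - c * h ^ 2)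
    (hdet' : ¬ (p : ℤ) ^ 2 ∣ a * b * c + 2 * f * g * h - a * f ^ 2 - b * g ^ 2 - c * h ^ 2)
    (h0 : a * x ^ 2 + b * y ^ 2 + c * z ^ 2 + 2 * f * y * z + 2 * g * x * z + 2 * h * x * y = 0) :
    (p : ℤ) ∣ x ∧ (p : ℤ) ∣ y ∧ (p : ℤ) ∣ z := by
  have hp : Prime (p : ℤ) := Nat.prime_iff_prime_int.1 Fact.out
  have hb : ¬ (p : ℤ) ∣ b := by
    intro hb
    apply hm
    rw [← ZMod.intCast_zmod_eq_zero_iff_dvd] at hb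
    exact ⟨f, by push_cast; rw [hb]; ring⟩
  have hmp : ¬ (p : ℤ) ∣ b * c - f ^ 2 := by
    intro hb
    apply hm
    rw [← ZMod.intCast_zmod_eq_zero_iff_dvd] at hb
    exact ⟨0, by rw [hb]; ring⟩
  set m := b * c - f ^ 2 with hmdef
  set D := a * b * c + 2 * f * g * h - a * f ^ 2 - b * g ^ 2 - c * h ^ 2 with hD
  have key : m * (h * x + b * y + f * z) ^ 2 + (m * z + (b * g - h * f) * x) ^ 2
      = -(b * D * x ^ 2) := by
    rw [hmdef, hD]
    linear_combination (b * c - f ^ 2) * b * h0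
  obtain ⟨hX, hY⟩ := dvd_of_mul_sq_add_sq hm (by
    rw [key, dvd_neg]
    exact Dvd.dvd.mul_right (hdet.mul_left _) _)
  have hx : (p : ℤ) ∣ x := by
    by_contra hx
    have h1 : (p : ℤ) ^ 2 ∣ b * D * x ^ 2 := by
      rw [← dvd_neg, ← key]
      exact dvd_add ((pow_dvd_pow_of_dvd hX 2).mul_left _) (pow_dvd_pow_of_dvd hY 2)
    obtain ⟨k, hk⟩ := hdet
    rw [hk, show b * (p * k) * x ^ 2 = p * (b * k * x ^ 2) by ring, sq] at h1
    have h2 := Int.dvd_of_mul_dvd_mul_left hp.ne_zero h1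
    rcases hp.dvd_or_dvd h2 with h2 | h2
    · rcases hp.dvd_or_dvd h2 with h2 | h2
      · exact hb h2
      · exact hdet' (by rw [hk, sq]; exact mul_dvd_mul_left _ h2)
    · exact hx (hp.dvd_of_dvd_pow h2)
  have hz : (p : ℤ) ∣ z := by
    have : (p : ℤ) ∣ m * z := (dvd_add_left (hx.mul_left _)).1 hY
    exact (hp.dvd_or_dvd this).resolve_left hmp
  refine ⟨hx, ?_, hz⟩
  have : (p : ℤ) ∣ b * y := by
    have := dvd_sub hX (dvd_add (hx.mul_left h) (hz.mul_left f))
    rwa [show h * x + b * y + f * z - (h * x + f * z) = b * y by ring] at this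
  exact (hp.dvd_or_dvd this).resolve_left hb

open Matrix

/-- The value at `x` of the quadratic form with matrix `A`. -/
def quadVal {R : Type*} [CommRing R] (A : Matrix (Fin 3) (Fin 3) R) (x : Fin 3 → R) : R :=
  x ⬝ᵥ (A *ᵥ x)

theorem quadVal_eq {R : Type*} [CommRing R] {A : Matrix (Fin 3) (Fin 3) R} (hA : A.IsSymm)
    (x : Fin 3 → R) : quadVal A x = A 0 0 * x 0 ^ 2 + A 1 1 * x 1 ^ 2 + A 2 2 * x 2 ^ 2 +
      2 * A 1 2 * x 1 * x 2 + 2 * A 0 2 * x 0 * x 2 + 2 * A 0 1 * x 0 * x 1 := by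
  simp only [quadVal, dotProduct, mulVec, Fin.sum_univ_three]
  rw [hA.apply 0 1, hA.apply 0 2, hA.apply 1 2]
  ring

theorem quadVal_smul {R : Type*} [CommRing R] (A : Matrix (Fin 3) (Fin 3) R) (r : R)
    (x : Fin 3 → R) : quadVal A (r • x) = r ^ 2 * quadVal A x := by
  simp only [quadVal, mulVec_smul, dotProduct_smul, smul_dotProduct, smul_eq_mul]
  ring

theorem dvd_of_quadVal_eq_zero_aux {p : ℕ} [Fact p.Prime] {M : Matrix (Fin 3) (Fin 3) ℤ}
    (hM : M.IsSymm) (hm : ¬ IsSquare (-(M.adjugate 0 0 : ℤ) : ZMod p)) (hdet : (p : ℤ) ∣ M.det)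
    (hdet' : ¬ (p : ℤ) ^ 2 ∣ M.det) {x : Fin 3 → ℤ} (h0 : quadVal M x = 0) (j : Fin 3) :
    (p : ℤ) ∣ x j := by
  rw [quadVal_eq hM] at h0
  have hD : M.det = M 0 0 * M 1 1 * M 2 2 + 2 * M 1 2 * M 0 2 * M 0 1 - M 0 0 * M 1 2 ^ 2
      - M 1 1 * M 0 2 ^ 2 - M 2 2 * M 0 1 ^ 2 := by
    rw [det_fin_three, ← hM.apply 0 1, ← hM.apply 0 2, ← hM.apply 1 2]
    ring
  rw [hD] at hdet hdet'
  have := dvd_of_ternary_eq_zero (p := p) (by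
    convert hm using 4
    rw [adjugate_fin_three]
    simp [← hM.apply 1 2, sq]) hdet hdet' h0
  fin_cases j
  exacts [this.1, this.2.1, this.2.2]

theorem dvd_of_quadVal_eq_zero {p : ℕ} [Fact p.Prime] {M : Matrix (Fin 3) (Fin 3) ℤ}
    (hM : M.IsSymm) (i : Fin 3) (hm : ¬ IsSquare (-(M.adjugate i i : ℤ) : ZMod p))
    (hdet : (p : ℤ) ∣ M.det) (hdet' : ¬ (p : ℤ) ^ 2 ∣ M.det) {x : Fin 3 → ℤ}
    (h0 : quadVal M x = 0) (j : Fin 3) : (p : ℤ) ∣ x j := by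
  let σ : Equiv.Perm (Fin 3) := Equiv.swap 0 i
  have h1 := dvd_of_quadVal_eq_zero_aux (p := p) (M := M.submatrix σ σ)
    (x := x ∘ σ) (hM.submatrix σ)
    (by rw [adjugate_submatrix_equiv_self]; simpa [σ] using hm)
    (by rwa [det_submatrix_equiv_self]) (by rwa [det_submatrix_equiv_self]) (by
      rw [← h0, quadVal, quadVal, submatrix_mulVec_equiv, Function.comp_assoc, Equiv.self_comp_symm,
        Function.comp_id, comp_equiv_dotProduct_comp_equiv]) (σ.symm j)
  simpa using h1

theorem eq_zero_of_quadVal_eq_zero {p : ℕ} [Fact p.Prime] {M : Matrix (Fin 3) (Fin 3) ℤ}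
    (hM : M.IsSymm) (i : Fin 3) (hm : ¬ IsSquare (-(M.adjugate i i : ℤ) : ZMod p))
    (hdet : (p : ℤ) ∣ M.det) (hdet' : ¬ (p : ℤ) ^ 2 ∣ M.det) (x : Fin 3 → ℤ)
    (h0 : quadVal M x = 0) : x = 0 := by
  have hp : (p : ℤ) ≠ 0 := by exact_mod_cast (Fact.out : p.Prime).ne_zero
  have key : ∀ n : ℕ, ∀ x : Fin 3 → ℤ, quadVal M x = 0 → ∀ j, (p : ℤ) ^ n ∣ x j := by
    intro n
    induction n with
    | zero => simp
    | succ n ih =>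
      intro x hx j
      choose y hy using dvd_of_quadVal_eq_zero hM i hm hdet hdet' hx
      have hxy : x = (p : ℤ) • y := funext hy
      rw [hxy, quadVal_smul] at hx
      rw [hy, pow_succ']
      exact mul_dvd_mul_left _ (ih y ((mul_eq_zero.1 hx).resolve_left (pow_ne_zero 2 hp)) j)
  funext j
  by_contra hj
  have hpp : Prime (p : ℤ) := Nat.prime_iff_prime_int.1 Fact.out
  have := FiniteMultiplicity.of_prime_left hpp hj
  obtain ⟨n, hn⟩ := this
  exact hn (key (n + 1) x h0 j)


theorem mulVec_dot_eq {R : Type*} [CommRing R] {A : Matrix (Fin 3) (Fin 3) R} (hA : A.IsSymm)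
    (x y : Fin 3 → R) : x ⬝ᵥ (A *ᵥ y) = y ⬝ᵥ (A *ᵥ x) := by
  rw [dotProduct_mulVec, ← mulVec_transpose, hA.eq, dotProduct_comm]

theorem quadVal_transpose_mul_mul {R : Type*} [CommRing R] (A P : Matrix (Fin 3) (Fin 3) R)
    (x : Fin 3 → R) : quadVal (Pᵀ * A * P) x = quadVal A (P *ᵥ x) := by
  rw [quadVal, quadVal, ← mulVec_mulVec, ← mulVec_mulVec, dotProduct_mulVec x, ← mulVec_transpose,
    transpose_transpose]

theorem quadVal_add {R : Type*} [CommRing R] {A : Matrix (Fin 3) (Fin 3) R} (hA : A.IsSymm)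
    (x y : Fin 3 → R) : quadVal A (x + y) = quadVal A x + 2 * (x ⬝ᵥ (A *ᵥ y)) + quadVal A y := by
  simp only [quadVal, mulVec_add, dotProduct_add, add_dotProduct]
  rw [mulVec_dot_eq hA y x]
  ring

section
variable {F : Type*} [Field F]

/-- A smooth ternary form with an isotropic vector becomes `2xy + cz²` in a suitable basis. -/
theorem exists_hyperbolic_basis (h2 : (2 : F) ≠ 0) {C : Matrix (Fin 3) (Fin 3) F} (hC : C.IsSymm)
    (hdet : C.det ≠ 0) {e : Fin 3 → F} (he : e ≠ 0) (he0 : quadVal C e = 0) :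
    ∃ P : Matrix (Fin 3) (Fin 3) F, IsUnit P.det ∧ ∃ c ≠ 0,
      Pᵀ * C * P = !![0, 1, 0; 1, 0, 0; 0, 0, c] := by
  have hCe : C *ᵥ e ≠ 0 := fun h => he (Matrix.eq_zero_of_mulVec_eq_zero hdet h)
  obtain ⟨i, hi⟩ := Function.ne_iff.1 hCe
  obtain ⟨k, hk⟩ : ∃ k : Fin 3 → F, k ⬝ᵥ (C *ᵥ e) = 1 := by
    refine ⟨Pi.single i ((C *ᵥ e) i)⁻¹, ?_⟩
    rw [single_dotProduct, inv_mul_cancel₀ hi]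
  set h : Fin 3 → F := k - (quadVal C k / 2) • e with hh
  have hhe : h ⬝ᵥ (C *ᵥ e) = 1 := by
    rw [hh, sub_dotProduct, hk, smul_dotProduct, show e ⬝ᵥ (C *ᵥ e) = 0 from he0]
    simp
  have heh : e ⬝ᵥ (C *ᵥ h) = 1 := by rw [mulVec_dot_eq hC, hhe]
  have hhh : h ⬝ᵥ (C *ᵥ h) = 0 := by
    have : quadVal C h = 0 := by
      rw [hh, sub_eq_add_neg, ← neg_smul, quadVal_add hC, quadVal_smul, he0, mulVec_smul,
        dotProduct_smul, hk, smul_eq_mul]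
      field_simp
      ring
    exact this
  set g : Fin 3 → F := crossProduct (C *ᵥ e) (C *ᵥ h) with hg
  have hge : g ⬝ᵥ (C *ᵥ e) = 0 := by rw [dotProduct_comm, hg, dot_self_cross]
  have hgh : g ⬝ᵥ (C *ᵥ h) = 0 := by rw [dotProduct_comm, hg, dot_cross_self]
  have heg : e ⬝ᵥ (C *ᵥ g) = 0 := by rw [mulVec_dot_eq hC, hge]
  have hhg : h ⬝ᵥ (C *ᵥ g) = 0 := by rw [mulVec_dot_eq hC, hgh]
  have hdetP : (of ![e, h, g]).det = -1 := by
    have := triple_product_eq_det e h g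
    rw [show (of ![e, h, g]).det = Matrix.det ![e, h, g] from rfl, ← this,
      triple_product_permutation, triple_product_permutation, hg, cross_dot_cross,
      dotProduct_comm _ e, dotProduct_comm _ h, dotProduct_comm _ e, dotProduct_comm _ h, heh,
      hhe, hhh]
    simp
  have hentry : (of ![e, h, g])ᵀᵀ * C * (of ![e, h, g])ᵀ =
      !![0, 1, 0; 1, 0, 0; 0, 0, g ⬝ᵥ (C *ᵥ g)] := by
    have : ∀ v : Fin 3 → Fin 3 → F, ∀ i j, ((of v)ᵀᵀ * C * (of v)ᵀ) i j = v i ⬝ᵥ (C *ᵥ v j) := by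
      intro v i j
      rw [Matrix.mul_assoc, transpose_transpose]
      simp only [Matrix.mul_apply, dotProduct, mulVec, of_apply, transpose_apply]
    clear_value g h
    clear hh hg
    ext i j
    rw [this]
    have hee : e ⬝ᵥ (C *ᵥ e) = 0 := he0
    fin_cases i <;> fin_cases j <;> simp [*]
  refine ⟨(of ![e, h, g])ᵀ, ?_, g ⬝ᵥ (C *ᵥ g), ?_, hentry⟩
  · rw [det_transpose, hdetP]; simp
  · intro h0
    have := congrArg det hentry
    rw [det_mul, det_mul, det_transpose, det_transpose, hdetP, h0,
      det_fin_three !![_, _, _; _, _, _; _, _, _]] at this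
    simp at this
    exact hdet this

theorem exists_eq_smul_of_isotropic (h2 : (2 : F) ≠ 0) (h3 : (3 : F) ≠ 0)
    {A C : Matrix (Fin 3) (Fin 3) F} (hA : A.IsSymm) (hC : C.IsSymm) (hdet : C.det ≠ 0)
    {e : Fin 3 → F} (he : e ≠ 0) (he0 : quadVal C e = 0)
    (h : ∀ x, quadVal C x = 0 → quadVal A x = 0) : ∃ κ : F, A = κ • C := by
  obtain ⟨P, hP, c, hc, hPC⟩ := exists_hyperbolic_basis h2 hC hdet he he0
  set A' := Pᵀ * A * P with hA'
  have hsymm : A'.IsSymm := by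
    rw [IsSymm, hA', transpose_mul, transpose_mul, hA.eq, transpose_transpose, Matrix.mul_assoc]
  have hsymm' : (!![0, 1, 0; 1, 0, 0; 0, 0, c] : Matrix (Fin 3) (Fin 3) F).IsSymm := by
    ext i j
    fin_cases i <;> fin_cases j <;> rfl
  have key : ∀ x y z : F, 2 * x * y + c * z ^ 2 = 0 → A' 0 0 * x ^ 2 + A' 1 1 * y ^ 2 +
      A' 2 2 * z ^ 2 + 2 * A' 1 2 * y * z + 2 * A' 0 2 * x * z + 2 * A' 0 1 * x * y = 0 := by
    intro x y z hxyz
    have := h (P *ᵥ ![x, y, z])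
    rw [← quadVal_transpose_mul_mul, ← quadVal_transpose_mul_mul, hPC, ← hA',
      quadVal_eq hsymm, quadVal_eq hsymm'] at this
    simp at this
    apply this
    linear_combination hxyz
  have k00 := key 1 0 0 (by ring)
  have k11 := key 0 1 0 (by ring)
  have k1 := key (-c) 2 2 (by ring)
  have k2 := key (-c) 2 (-2) (by ring)
  have k3 := key (-4 * c) 2 4 (by ring)
  have e00 : A' 0 0 = 0 := by linear_combination k00
  have e11 : A' 1 1 = 0 := by linear_combination k11
  rw [e00, e11] at k1 k2 k3
  have e22 : A' 2 2 = c * A' 0 1 := by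
    have : 2 * 2 * 2 * (A' 2 2 - c * A' 0 1) = 0 := by linear_combination k1 + k2
    simpa [h2, sub_eq_zero] using this
  have e02 : A' 0 2 = 0 := by
    have : 2 * 2 * 2 * 3 * c * A' 0 2 = 0 := by linear_combination 3 * k1 + k2 - k3
    simpa [h2, h3, hc] using this
  have e12 : A' 1 2 = 0 := by
    rw [e02, e22] at k1
    have : 2 * 2 * 2 * A' 1 2 = 0 := by linear_combination k1
    simpa [h2] using this
  refine ⟨A' 0 1, ?_⟩
  have h1 : Pᵀ * (A * P) = Pᵀ * ((A' 0 1 • C) * P) := by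
    rw [← Matrix.mul_assoc, ← Matrix.mul_assoc, Matrix.mul_smul, Matrix.smul_mul, hPC, ← hA']
    ext i j
    fin_cases i <;> fin_cases j <;>
      simp [e00, e11, e02, e12, e22, hsymm.apply 0 1, hsymm.apply 0 2, hsymm.apply 1 2, mul_comm]
  have hPu : IsUnit P := (isUnit_iff_isUnit_det _).2 hP
  have hPu' : IsUnit Pᵀ := (isUnit_iff_isUnit_det _).2 (by rwa [det_transpose])
  exact hPu.mul_right_cancel (hPu'.mul_left_cancel h1)
end


theorem det_smul_sub_smul {R : Type*} [CommRing R] (C A : Matrix (Fin 3) (Fin 3) R) (u w : R) :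
    (u • C - w • A).det = u ^ 3 * C.det - u ^ 2 * w * (C.adjugate * A).trace +
      u * w ^ 2 * (C * A.adjugate).trace - w ^ 3 * A.det := by
  simp only [det_fin_three, adjugate_fin_three, trace_fin_three, mul_apply, Fin.sum_univ_three]
  simp
  ring

theorem quadVal_map {R S : Type*} [CommRing R] [CommRing S] (f : R →+* S)
    (A : Matrix (Fin 3) (Fin 3) R) (x : Fin 3 → R) :
    quadVal (A.map f) (f ∘ x) = f (quadVal A x) := by
  simp [quadVal, dotProduct, mulVec]

theorem quadVal_smul_sub {R : Type*} [CommRing R] (A B : Matrix (Fin 3) (Fin 3) R) (u v : R)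
    (x : Fin 3 → R) : quadVal (u • A - v • B) x = u * quadVal A x - v * quadVal B x := by
  simp [quadVal, sub_mulVec, smul_mulVec, dotProduct_sub, dotProduct_smul]

theorem exists_isotropic_zmod {p : ℕ} [Fact p.Prime] (C : Matrix (Fin 3) (Fin 3) (ZMod p)) :
    ∃ e : Fin 3 → ZMod p, e ≠ 0 ∧ quadVal C e = 0 := by
  classical
  let f : MvPolynomial (Fin 3) (ZMod p) :=
    ∑ i, ∑ j, MvPolynomial.C (C i j) * (MvPolynomial.X i * MvPolynomial.X j)
  have hf : ∀ x, MvPolynomial.eval x f = quadVal C x := by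
    intro x
    simp only [f, quadVal, dotProduct, mulVec, map_sum, map_mul, MvPolynomial.eval_C,
      MvPolynomial.eval_X, Finset.mul_sum]
    refine Finset.sum_congr rfl fun i _ => Finset.sum_congr rfl fun j _ => ?_
    ring
  have hdeg : f.totalDegree < Fintype.card (Fin 3) := by
    refine lt_of_le_of_lt (b := 2) ?_ (by simp)
    refine MvPolynomial.totalDegree_finsetSum_le fun i _ =>
      MvPolynomial.totalDegree_finsetSum_le fun j _ => ?_
    refine (MvPolynomial.totalDegree_mul _ _).trans ?_
    rw [MvPolynomial.totalDegree_C, zero_add]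
    refine (MvPolynomial.totalDegree_mul _ _).trans ?_
    simp
  have h1 := char_dvd_card_solutions p hdeg
  have h0 : MvPolynomial.eval 0 f = 0 := by rw [hf]; simp [quadVal]
  have : 1 < Fintype.card {x // MvPolynomial.eval x f = 0} :=
    (Fact.out : p.Prime).one_lt.trans_le
      (Nat.le_of_dvd (Fintype.card_pos_iff.2 ⟨⟨0, h0⟩⟩) h1)
  obtain ⟨⟨e, he⟩, hne⟩ := Fintype.exists_ne_of_one_lt_card this ⟨0, h0⟩
  exact ⟨e, fun h => hne (Subtype.ext h), by rw [← hf, he]⟩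

section
variable {A₁ B₁ A₂ B₂ : Matrix (Fin 3) (Fin 3) ℤ} {p : ℕ} [Fact p.Prime]

theorem exists_int_vector (hA₂ : A₂.IsSymm) (hB₂ : B₂.IsSymm) (hp3 : 3 < p) (t : ℤ)
    (hd : (((t • A₂ - (1 : ℤ) • B₂).det : ℤ) : ZMod p) ≠ 0) {i j k l : Fin 3}
    (hmin : ((A₂ i j * B₂ k l - A₂ k l * B₂ i j : ℤ) : ZMod p) ≠ 0) :
    ∃ x : Fin 3 → ℤ, (p : ℤ) ∣ quadVal (t • A₂ - (1 : ℤ) • B₂) x ∧ ¬ (p : ℤ) ∣ quadVal A₂ x := by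
  by_contra! hcon
  set C₂ := t • A₂ - (1 : ℤ) • B₂ with hC₂
  let f := Int.castRingHom (ZMod p)
  have hCs : C₂.IsSymm := by
    rw [hC₂]; exact (hA₂.smul t).sub (hB₂.smul 1)
  have h2 : (2 : ZMod p) ≠ 0 := by
    have : ((2 : ℕ) : ZMod p) ≠ 0 := by
      rw [Ne, ZMod.natCast_eq_zero_iff]
      exact fun h => absurd (Nat.le_of_dvd two_pos h) (by omega)
    exact_mod_cast this
  have h3 : (3 : ZMod p) ≠ 0 := by
    have : ((3 : ℕ) : ZMod p) ≠ 0 := by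
      rw [Ne, ZMod.natCast_eq_zero_iff]
      exact fun h => absurd (Nat.le_of_dvd three_pos h) (by omega)
    exact_mod_cast this
  obtain ⟨e, he, he0⟩ := exists_isotropic_zmod (C₂.map f)
  obtain ⟨κ, hκ⟩ := exists_eq_smul_of_isotropic h2 h3 (A := A₂.map f) (C := C₂.map f)
    (hA₂.map f) (hCs.map f) (by
      have := RingHom.map_det f C₂
      rw [RingHom.mapMatrix_apply] at this
      rw [← this]
      exact hd) he he0 (by
      intro x hx
      choose y hy using fun i => ZMod.intCast_surjective (x i)
      have hxy : x = f ∘ y := funext fun i => (hy i).symm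
      rw [hxy, quadVal_map] at hx ⊢
      have := hcon y ((ZMod.intCast_zmod_eq_zero_iff_dvd _ _).1 hx)
      exact (ZMod.intCast_zmod_eq_zero_iff_dvd _ _).2 this)
  apply hmin
  have hent : ∀ i j, (A₂ i j : ZMod p) = κ * (t * A₂ i j - B₂ i j) := by
    intro i j
    have := congrFun (congrFun hκ i) j
    simpa [hC₂, f, -zsmul_eq_mul, Matrix.smul_apply] using this
  have e1 := hent i j
  have e2 := hent k l
  push_cast
  by_cases hκ0 : κ = 0
  · rw [e1, e2, hκ0]; ring
  · apply mul_left_cancel₀ hκ0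
    linear_combination (A₂ i j : ZMod p) * e2 - (A₂ k l : ZMod p) * e1

theorem false_of_place (hA₁ : A₁.IsSymm) (hB₁ : B₁.IsSymm) (hA₂ : A₂.IsSymm) (hB₂ : B₂.IsSymm)
    (hrep : ∀ x : Fin 3 → ℤ, x ≠ 0 → ∃ y : Fin 3 → ℤ, y ≠ 0 ∧
      quadVal B₂ x * quadVal A₁ y = quadVal A₂ x * quadVal B₁ y)
    (hp3 : 3 < p) (t : ℤ) (hd₁ : (((t • A₁ - (1 : ℤ) • B₁).det : ℤ) : ZMod p) = 0)
    (htr : ((((t • A₁ - (1 : ℤ) • B₁).adjugate * A₁).trace : ℤ) : ZMod p) ≠ 0) (m : Fin 3)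
    (hns : ¬ IsSquare (-((t • A₁ - (1 : ℤ) • B₁).adjugate m m : ℤ) : ZMod p))
    (hd : (((t • A₂ - (1 : ℤ) • B₂).det : ℤ) : ZMod p) ≠ 0) {i j k l : Fin 3}
    (hmin : ((A₂ i j * B₂ k l - A₂ k l * B₂ i j : ℤ) : ZMod p) ≠ 0) : False := by
  obtain ⟨x₀, hx₀, hx₀A⟩ := exists_int_vector hA₂ hB₂ hp3 t hd hmin
  set C₁ := t • A₁ - (1 : ℤ) • B₁ with hC₁
  set C₂ := t • A₂ - (1 : ℤ) • B₂ with hC₂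
  set T := (C₁.adjugate * A₁).trace with hT
  have hp : Prime (p : ℤ) := Nat.prime_iff_prime_int.1 Fact.out
  have hCs₁ : C₁.IsSymm := (hA₁.smul t).sub (hB₁.smul 1)
  have hCs₂ : C₂.IsSymm := (hA₂.smul t).sub (hB₂.smul 1)
  rw [ZMod.intCast_zmod_eq_zero_iff_dvd] at hd₁
  rw [Ne, ZMod.intCast_zmod_eq_zero_iff_dvd] at htr hd
  have key : ∀ x : Fin 3 → ℤ, (p : ℤ) ∣ quadVal C₂ x → ¬ (p : ℤ) ∣ quadVal A₂ x →
      (p : ℤ) ^ 2 ∣ quadVal A₂ x * C₁.det - quadVal C₂ x * T := by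
    intro x hx hxA
    set u := quadVal A₂ x
    set w := quadVal C₂ x with hw
    have hx0 : x ≠ 0 := by
      rintro rfl
      exact hxA (by simp [u, quadVal])
    have hv : quadVal B₂ x = t * u - w := by
      rw [hw, hC₂, quadVal_smul_sub]; ring
    obtain ⟨y, hy, hyeq⟩ := hrep x hx0
    have hMs : (u • C₁ - w • A₁).IsSymm := (hCs₁.smul u).sub (hA₁.smul w)
    have hMy : quadVal (u • C₁ - w • A₁) y = 0 := by
      rw [quadVal_smul_sub, hC₁, quadVal_smul_sub]
      rw [hv] at hyeq
      linear_combination hyeq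
    have hdet := det_smul_sub_smul C₁ A₁ u w
    have hcast : (u • C₁ - w • A₁).map (Int.castRingHom (ZMod p)) =
        (u : ZMod p) • C₁.map (Int.castRingHom (ZMod p)) := by
      ext i j
      have : (w : ZMod p) = 0 := (ZMod.intCast_zmod_eq_zero_iff_dvd _ _).2 hx
      simp [this, -zsmul_eq_mul, Matrix.smul_apply]
    have hadj : (((u • C₁ - w • A₁).adjugate m m : ℤ) : ZMod p) =
        (u : ZMod p) ^ 2 * (C₁.adjugate m m : ℤ) := by
      have h1 := RingHom.map_adjugate (Int.castRingHom (ZMod p)) (u • C₁ - w • A₁)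
      have h2 := RingHom.map_adjugate (Int.castRingHom (ZMod p)) C₁
      simp only [RingHom.mapMatrix_apply] at h1 h2
      rw [hcast, adjugate_smul, ← h2] at h1
      have := congrFun (congrFun h1 m) m
      simpa using this
    have hdvd : (p : ℤ) ∣ (u • C₁ - w • A₁).det := by
      rw [hdet]
      refine dvd_sub (dvd_add (dvd_sub ?_ ?_) ?_) ?_
      · exact hd₁.mul_left _
      · exact (hx.mul_left _).mul_right _
      · exact ((dvd_pow hx two_ne_zero).mul_left _).mul_right _
      · exact (dvd_pow hx three_ne_zero).mul_right _
    by_contra hcon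
    refine hy (eq_zero_of_quadVal_eq_zero hMs m ?_ hdvd ?_ y hMy)
    · rw [hadj]
      have hu0 : (u : ZMod p) ≠ 0 := by rwa [Ne, ZMod.intCast_zmod_eq_zero_iff_dvd]
      rintro ⟨r, hr⟩
      apply hns
      refine ⟨r / u, ?_⟩
      field_simp
      linear_combination hr
    · rw [hdet]
      intro h
      apply hcon
      have hw2 : (p : ℤ) ^ 2 ∣ w ^ 2 := pow_dvd_pow_of_dvd hx 2
      have h1 : (p : ℤ) ^ 2 ∣ u ^ 2 * (u * C₁.det - w * T) := by
        have h2 : (p : ℤ) ^ 2 ∣ w ^ 2 * (u * (C₁ * A₁.adjugate).trace - w * A₁.det) :=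
          hw2.mul_right _
        rw [show u ^ 2 * (u * C₁.det - w * T) = u ^ 3 * C₁.det - u ^ 2 * w *
          (C₁.adjugate * A₁).trace + u * w ^ 2 * (C₁ * A₁.adjugate).trace - w ^ 3 * A₁.det -
          w ^ 2 * (u * (C₁ * A₁.adjugate).trace - w * A₁.det) by rw [hT]; ring]
        exact dvd_sub h h2
      refine IsCoprime.dvd_of_dvd_mul_left ?_ h1
      exact ((Prime.coprime_iff_not_dvd hp).2 hxA).pow
  have hcol : ∃ i, ¬ (p : ℤ) ∣ (C₂ *ᵥ x₀) i := by
    by_contra! h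
    have h1 : ∀ i, (p : ℤ) ∣ C₂.det * x₀ i := by
      intro i
      have h2 := congrFun (congrArg (fun M => M *ᵥ x₀) (adjugate_mul C₂)) i
      simp only [← mulVec_mulVec, smul_mulVec, one_mulVec, Pi.smul_apply, smul_eq_mul] at h2
      rw [← h2]
      exact Finset.dvd_sum (s := Finset.univ) fun j _ => (h j).mul_left _
    apply hx₀A
    exact Finset.dvd_sum (s := Finset.univ) fun j _ =>
      ((hp.dvd_or_dvd (h1 j)).resolve_left hd).mul_right _
  obtain ⟨n, hn⟩ := hcol
  set x₁ := x₀ + (p : ℤ) • (Pi.single n 1 : Fin 3 → ℤ) with hx₁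
  have hC : quadVal C₂ x₁ = quadVal C₂ x₀ + 2 * p * (C₂ *ᵥ x₀) n + p ^ 2 * C₂ n n := by
    rw [hx₁, quadVal_add hCs₂, mulVec_dot_eq hCs₂, smul_dotProduct, single_one_dotProduct,
      quadVal_smul]
    simp [quadVal]
    ring
  have hA : quadVal A₂ x₁ = quadVal A₂ x₀ + 2 * p * (A₂ *ᵥ x₀) n + p ^ 2 * A₂ n n := by
    rw [hx₁, quadVal_add hA₂, mulVec_dot_eq hA₂, smul_dotProduct, single_one_dotProduct,
      quadVal_smul]
    simp [quadVal]
    ring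
  have hp1 : (p : ℤ) ∣ p := dvd_rfl
  have k0 := key x₀ hx₀ hx₀A
  have k1 := key x₁ (by
    rw [hC]
    exact dvd_add (dvd_add hx₀ ((hp1.mul_left _).mul_right _))
      ((dvd_pow hp1 two_ne_zero).mul_right _)) (by
    rw [hA]
    intro h
    apply hx₀A
    rw [add_assoc] at h
    refine (dvd_add_left ?_).1 h
    exact dvd_add ((hp1.mul_left _).mul_right _) ((dvd_pow hp1 two_ne_zero).mul_right _))
  obtain ⟨d, hd'⟩ := hd₁
  have h1 := dvd_sub k1 k0
  rw [hC, hA, hd'] at h1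
  have h2 : (p : ℤ) * p ∣ p * (2 * (C₂ *ᵥ x₀) n * T) := by
    rw [← sq]
    have h3 : (p : ℤ) ^ 2 ∣ p ^ 2 * (2 * (A₂ *ᵥ x₀) n * d + p * A₂ n n * d - C₂ n n * T) :=
      Dvd.intro _ rfl
    have h5 := dvd_sub h3 h1
    refine h5.trans (dvd_of_eq ?_)
    ring
  have h4 := Int.dvd_of_mul_dvd_mul_left hp.ne_zero h2
  rcases hp.dvd_or_dvd h4 with h4 | h4
  · rcases hp.dvd_or_dvd h4 with h4 | h4
    · have := Int.le_of_dvd two_pos h4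
      omega
    · exact hn h4
  · exact htr h4
end


theorem map_adjugate_apply {R S : Type*} [CommRing R] [CommRing S] (f : R →+* S)
    (M : Matrix (Fin 3) (Fin 3) R) (i j : Fin 3) :
    f (M.adjugate i j) = (f.mapMatrix M).adjugate i j := by
  rw [← RingHom.map_adjugate]
  rfl

theorem map_trace_adjugate_mul {R S : Type*} [CommRing R] [CommRing S] (f : R →+* S)
    (M N : Matrix (Fin 3) (Fin 3) R) :
    f (M.adjugate * N).trace = ((f.mapMatrix M).adjugate * f.mapMatrix N).trace := by
  rw [← RingHom.map_adjugate, ← map_mul]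
  simp [trace_fin_three, mul_apply]

theorem det_eq_zero_of_not_isSquare_int {A₁ B₁ A₂ B₂ : Matrix (Fin 3) (Fin 3) ℤ}
    (hA₁ : A₁.IsSymm) (hB₁ : B₁.IsSymm) (hA₂ : A₂.IsSymm) (hB₂ : B₂.IsSymm)
    (hrep : ∀ x : Fin 3 → ℤ, x ≠ 0 → ∃ y : Fin 3 → ℤ, y ≠ 0 ∧
      quadVal B₂ x * quadVal A₁ y = quadVal A₂ x * quadVal B₁ y)
    {i j k l : Fin 3} (hmin : A₂ i j * B₂ k l - A₂ k l * B₂ i j ≠ 0)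
    {K : Type} [Field K] [NumberField K] (θ : K) {f : ℤ →+* K}
    (hd₁ : (θ • A₁.map f - B₁.map f).det = 0)
    (htr : ((θ • A₁.map f - B₁.map f).adjugate * A₁.map f).trace ≠ 0) (m : Fin 3)
    (hns : ¬ IsSquare (-(θ • A₁.map f - B₁.map f).adjugate m m)) :
    (θ • A₂.map f - B₂.map f).det = 0 := by
  classical
  by_contra hd
  set T := ((θ • A₁.map f - B₁.map f).adjugate * A₁.map f).trace with hT
  set D := (θ • A₂.map f - B₂.map f).det with hD
  obtain ⟨p, hp, hpN, R, φ, hS, hδ, hφ⟩ := exists_subring_ringHom_not_isSquare _ hns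
    {θ, T⁻¹, D⁻¹} (max 3 (A₂ i j * B₂ k l - A₂ k l * B₂ i j).natAbs)
  have : Fact p.Prime := ⟨hp⟩
  let θR : R := ⟨θ, hS θ (by simp)⟩
  let TR : R := ⟨T⁻¹, hS _ (by simp)⟩
  let DR : R := ⟨D⁻¹, hS _ (by simp)⟩
  let g : ℤ →+* R := Int.castRingHom R
  have hgf : R.subtype.comp g = f := RingHom.ext_int _ _
  have hgp : φ.comp g = Int.castRingHom (ZMod p) := RingHom.ext_int _ _
  obtain ⟨t, ht⟩ := ZMod.intCast_surjective (φ θR)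
  have hmapK : ∀ A B : Matrix (Fin 3) (Fin 3) ℤ, R.subtype.mapMatrix (θR • A.map g - B.map g) =
      θ • A.map f - B.map f := by
    intro A B
    ext i j
    simp [← hgf, θR]
  have hmapp : ∀ A B : Matrix (Fin 3) (Fin 3) ℤ, φ.mapMatrix (θR • A.map g - B.map g) =
      (Int.castRingHom (ZMod p)).mapMatrix (t • A - (1 : ℤ) • B) := by
    intro A B
    ext i j
    simp [-zsmul_eq_mul, Matrix.smul_apply, ← ht, g]
  have hmapK' : ∀ A : Matrix (Fin 3) (Fin 3) ℤ, R.subtype.mapMatrix (A.map g) = A.map f := by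
    intro A; ext i j; simp [← hgf]
  have hmapp' : ∀ A : Matrix (Fin 3) (Fin 3) ℤ, φ.mapMatrix (A.map g) =
      (Int.castRingHom (ZMod p)).mapMatrix A := by
    intro A; ext i j; simp [← hgp]
  have hdet : ∀ A B : Matrix (Fin 3) (Fin 3) ℤ, R.subtype (θR • A.map g - B.map g).det =
      (θ • A.map f - B.map f).det ∧ φ (θR • A.map g - B.map g).det =
      (((t • A - (1 : ℤ) • B).det : ℤ) : ZMod p) := by
    intro A B
    rw [RingHom.map_det, RingHom.map_det, hmapK, hmapp, ← RingHom.map_det]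
    exact ⟨rfl, rfl⟩
  refine false_of_place (p := p) hA₁ hB₁ hA₂ hB₂ hrep ((le_max_left _ _).trans_lt hpN) t ?_ ?_ m ?_
    ?_ (i := i) (j := j) (k := k) (l := l) ?_
  · rw [← (hdet A₁ B₁).2]
    have : (θR • A₁.map g - B₁.map g).det = 0 := Subtype.ext ((hdet A₁ B₁).1.trans hd₁)
    rw [this, map_zero]
  · have h1 : R.subtype (((θR • A₁.map g - B₁.map g).adjugate * A₁.map g).trace) = T := by
      rw [map_trace_adjugate_mul, hmapK, hmapK']
    have h2 : φ (((θR • A₁.map g - B₁.map g).adjugate * A₁.map g).trace) =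
      ((((t • A₁ - (1 : ℤ) • B₁).adjugate * A₁).trace : ℤ) : ZMod p) := by
      rw [map_trace_adjugate_mul, hmapp, hmapp', ← map_trace_adjugate_mul]
      rfl
    rw [← h2]
    have h3 : ((θR • A₁.map g - B₁.map g).adjugate * A₁.map g).trace * TR = 1 := by
      apply R.subtype_injective
      rw [map_mul, h1, map_one]
      exact mul_inv_cancel₀ htr
    intro h0
    have := congrArg φ h3
    rw [map_mul, h0, zero_mul, map_one] at this
    exact zero_ne_one this
  · have h1 := map_adjugate_apply R.subtype (θR • A₁.map g - B₁.map g) m m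
    have h2 := map_adjugate_apply φ (θR • A₁.map g - B₁.map g) m m
    rw [hmapK] at h1
    rw [hmapp, ← map_adjugate_apply] at h2
    have h3 : (⟨_, hδ⟩ : R) = -(θR • A₁.map g - B₁.map g).adjugate m m := by
      apply R.subtype_injective
      rw [map_neg, h1]
      rfl
    rw [h3, map_neg, h2] at hφ
    exact hφ
  · rw [← (hdet A₂ B₂).2]
    have h3 : (θR • A₂.map g - B₂.map g).det * DR = 1 := by
      apply R.subtype_injective
      rw [map_mul, (hdet A₂ B₂).1, map_one]
      exact mul_inv_cancel₀ hd
    intro h0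
    have := congrArg φ h3
    rw [map_mul, h0, zero_mul, map_one] at this
    exact zero_ne_one this
  · rw [Ne, ZMod.intCast_zmod_eq_zero_iff_dvd]
    intro h
    have h1 := Nat.le_of_dvd (Int.natAbs_pos.2 hmin) (Int.natCast_dvd.1 h)
    exact absurd h1 ((le_max_right _ _).trans_lt hpN).not_ge


theorem exists_int_matrix_smul (M : Fin 4 → Matrix (Fin 3) (Fin 3) ℚ) :
    ∃ N : ℤ, N ≠ 0 ∧ ∃ M' : Fin 4 → Matrix (Fin 3) (Fin 3) ℤ, ∀ k,
      (M' k).map (Int.castRingHom ℚ) = (N : ℚ) • M k := by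
  obtain ⟨b, hb⟩ := IsLocalization.exist_integer_multiples_of_finite (nonZeroDivisors ℤ)
    (fun i : Fin 4 × Fin 3 × Fin 3 => M i.1 i.2.1 i.2.2)
  choose m hm using hb
  refine ⟨b, nonZeroDivisors.ne_zero b.2, fun k => .of fun i j => m (k, i, j), fun k => ?_⟩
  ext i j
  have := hm (k, i, j)
  simp only [algebraMap_int_eq, zsmul_eq_mul] at this
  simpa using this

theorem exists_minor_ne_zero {A B : Matrix (Fin 3) (Fin 3) ℚ}
    (hli : ∀ a b : ℚ, a • A + b • B = 0 → a = 0 ∧ b = 0) :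
    ∃ i j k l, A i j * B k l - A k l * B i j ≠ 0 := by
  by_contra! h
  have hB : B = 0 := by
    ext k l
    by_contra hkl
    have := hli (B k l) (-(A k l)) (by
      ext i j
      have := h i j k l
      simp only [Matrix.add_apply, Matrix.smul_apply, smul_eq_mul, Matrix.zero_apply]
      linear_combination this)
    exact hkl this.1
  exact one_ne_zero (hli 0 1 (by simp [hB])).2

theorem quadVal_smul_left {R : Type*} [CommRing R] (A : Matrix (Fin 3) (Fin 3) R) (r : R)
    (x : Fin 3 → R) : quadVal (r • A) x = r * quadVal A x := by
  simp [quadVal, smul_mulVec, dotProduct_smul]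

theorem det_eq_zero_of_not_isSquare {A₁ B₁ A₂ B₂ : Matrix (Fin 3) (Fin 3) ℚ}
    (hA₁ : A₁.IsSymm) (hB₁ : B₁.IsSymm) (hA₂ : A₂.IsSymm) (hB₂ : B₂.IsSymm)
    (hli : ∀ a b : ℚ, a • A₂ + b • B₂ = 0 → a = 0 ∧ b = 0)
    (hrep : ∀ x : Fin 3 → ℚ, x ≠ 0 → ∃ y : Fin 3 → ℚ, y ≠ 0 ∧
      quadVal A₁ y = quadVal A₂ x ∧ quadVal B₁ y = quadVal B₂ x)
    {K : Type} [Field K] [NumberField K] (θ : K) {f : ℚ →+* K}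
    (hd₁ : (θ • A₁.map f - B₁.map f).det = 0)
    (htr : ((θ • A₁.map f - B₁.map f).adjugate * A₁.map f).trace ≠ 0) (m : Fin 3)
    (hns : ¬ IsSquare (-(θ • A₁.map f - B₁.map f).adjugate m m)) :
    (θ • A₂.map f - B₂.map f).det = 0 := by
  obtain ⟨N, hN, M, hM⟩ := exists_int_matrix_smul ![A₁, B₁, A₂, B₂]
  have hNQ : (N : ℚ) ≠ 0 := by exact_mod_cast hN
  have hNK : (N : K) ≠ 0 := by exact_mod_cast hN
  obtain ⟨i, j, k, l, hijkl⟩ := exists_minor_ne_zero hli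
  let F : ℤ →+* K := f.comp (Int.castRingHom ℚ)
  have hMF : ∀ k, (M k).map F = (N : K) • (![A₁, B₁, A₂, B₂] k).map f := by
    intro k
    have := congrArg (fun X : Matrix _ _ ℚ => X.map f) (hM k)
    simp only [map_map] at this
    rw [show (M k).map F = (M k).map (f ∘ Int.castRingHom ℚ) from rfl, this]
    ext i j
    simp
  have hpen : ∀ k l, θ • (M k).map F - (M l).map F =
      (N : K) • (θ • (![A₁, B₁, A₂, B₂] k).map f - (![A₁, B₁, A₂, B₂] l).map f) := by
    intro k l
    rw [hMF, hMF, smul_sub, smul_comm]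
  have hMs : ∀ k, (M k).IsSymm := by
    intro k
    have h1 : (![A₁, B₁, A₂, B₂] k).IsSymm := by
      fin_cases k
      exacts [hA₁, hB₁, hA₂, hB₂]
    have h2 : ((M k).map (Int.castRingHom ℚ)).IsSymm := by rw [hM]; exact h1.smul _
    ext i j
    have := h2.apply i j
    simpa using this
  have hval : ∀ k (x : Fin 3 → ℤ), ((quadVal (M k) x : ℤ) : ℚ) =
      N * quadVal (![A₁, B₁, A₂, B₂] k) (Int.castRingHom ℚ ∘ x) := by
    intro k x
    have := quadVal_map (Int.castRingHom ℚ) (M k) x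
    rw [hM, quadVal_smul_left] at this
    exact this.symm
  have key := det_eq_zero_of_not_isSquare_int (f := F) (hMs 0) (hMs 1) (hMs 2) (hMs 3) (by
      intro x hx
      obtain ⟨y, hy, hy1, hy2⟩ := hrep (Int.castRingHom ℚ ∘ x) (by
        intro h
        apply hx
        funext i
        have := congrFun h i
        simpa using this)
      obtain ⟨b, hb⟩ := IsLocalization.exist_integer_multiples_of_finite (nonZeroDivisors ℤ) y
      choose z hz using hb
      have hzy : Int.castRingHom ℚ ∘ z = ((b : ℤ) : ℚ) • y := by
        funext i
        have := hz i
        simp only [algebraMap_int_eq, zsmul_eq_mul] at this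
        simpa using this
      have hb0 : ((b : ℤ) : ℚ) ≠ 0 := by exact_mod_cast nonZeroDivisors.ne_zero b.2
      refine ⟨z, ?_, ?_⟩
      · rintro rfl
        apply hy
        have : ((b : ℤ) : ℚ) • y = 0 := by rw [← hzy]; funext i; simp
        exact (smul_eq_zero.1 this).resolve_left hb0
      · have : ((quadVal (M 3) x * quadVal (M 0) z : ℤ) : ℚ) =
            ((quadVal (M 2) x * quadVal (M 1) z : ℤ) : ℚ) := by
          push_cast
          rw [hval, hval, hval, hval, hzy, quadVal_smul, quadVal_smul]
          simp only [Fin.isValue, cons_val]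
          rw [hy1, hy2]
          ring
        exact_mod_cast this) (i := i) (j := j) (k := k) (l := l) (by
      intro h
      apply hijkl
      have e : ∀ k i j, ((M k i j : ℤ) : ℚ) = N * ![A₁, B₁, A₂, B₂] k i j := by
        intro k i j
        have := congrFun (congrFun (hM k) i) j
        simpa using this
      have h1 : ((M 2 i j * M 3 k l - M 2 k l * M 3 i j : ℤ) : ℚ) = 0 := by exact_mod_cast h
      push_cast at h1
      rw [e, e, e, e] at h1
      simp only [Fin.isValue, cons_val] at h1
      apply mul_left_cancel₀ (pow_ne_zero 2 hNQ)
      linear_combination h1) θ (by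
      rw [hpen, det_smul]
      simp [hd₁]) (by
      rw [hpen, hMF, adjugate_smul, smul_mul_smul_comm, trace_smul]
      simpa [hN] using htr) m (by
      rw [hpen, adjugate_smul]
      rintro ⟨r, hr⟩
      apply hns
      refine ⟨r / N, ?_⟩
      field_simp
      simp at hr
      linear_combination hr)
  rw [hpen, det_smul] at key
  simpa [hN] using key


theorem exists_mul_of_coeff_ne_zero {F : Type*} [Field F] {a b c f g h r s : F}
    (ha : a ≠ 0) (hdet : a * b * c + 2 * f * g * h - a * f ^ 2 - b * g ^ 2 - c * h ^ 2 = 0)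
    (hr : -(a * b - h ^ 2) = r * r) (hs : -(a * c - g ^ 2) = s * s) :
    ∃ p q : Fin 3 → F, ∀ x y z : F,
      a * x ^ 2 + b * y ^ 2 + c * z ^ 2 + 2 * f * y * z + 2 * g * x * z + 2 * h * x * y =
        (p 0 * x + p 1 * y + p 2 * z) * (q 0 * x + q 1 * y + q 2 * z) := by
  have hrs : (a * f - g * h - r * s) * (a * f - g * h + r * s) = 0 := by
    linear_combination (-a) * hdet - (a * c - g ^ 2) * hr + r ^ 2 * hs
  rcases mul_eq_zero.1 hrs with h0 | h0
  · refine ⟨![a, h + r, g - s], ![1, (h - r) / a, (g + s) / a], fun x y z => ?_⟩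
    simp only [Fin.isValue, cons_val]
    field_simp
    linear_combination (-y ^ 2) * hr - z ^ 2 * hs + 2 * y * z * h0
  · refine ⟨![a, h + r, g + s], ![1, (h - r) / a, (g - s) / a], fun x y z => ?_⟩
    simp only [Fin.isValue, cons_val]
    field_simp
    linear_combination (-y ^ 2) * hr - z ^ 2 * hs + 2 * y * z * h0

/-- A degenerate ternary quadratic form is a product of two linear forms as soon as the negatives
of its principal `2 × 2` minors are squares. -/
theorem exists_mul_of_isSquare {F : Type*} [Field F] (h2 : (2 : F) ≠ 0)
    {C : Matrix (Fin 3) (Fin 3) F} (hC : C.IsSymm) (hdet : C.det = 0)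
    (hsq : ∀ m, IsSquare (-C.adjugate m m)) :
    ∃ a b : Fin 3 → F, ∀ x, quadVal C x = (a ⬝ᵥ x) * (b ⬝ᵥ x) := by
  rw [det_fin_three, hC.apply 0 1, hC.apply 0 2, hC.apply 1 2] at hdet
  obtain ⟨r0, hr0⟩ := hsq 0
  obtain ⟨r1, hr1⟩ := hsq 1
  obtain ⟨r2, hr2⟩ := hsq 2
  simp only [adjugate_fin_three, of_apply, cons_val, hC.apply 0 1, hC.apply 0 2, hC.apply 1 2]
    at hr0 hr1 hr2
  by_cases h0 : C 0 0 ≠ 0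
  · obtain ⟨p, q, hpq⟩ := exists_mul_of_coeff_ne_zero (b := C 1 1) (c := C 2 2) (f := C 1 2)
      (g := C 0 2) (h := C 0 1) (r := r2) (s := r1) h0 (by linear_combination hdet)
      (by linear_combination hr2) (by linear_combination hr1)
    refine ⟨p, q, fun x => ?_⟩
    rw [quadVal_eq hC]
    simp only [dotProduct, Fin.sum_univ_three]
    exact hpq _ _ _
  by_cases h1 : C 1 1 ≠ 0
  · obtain ⟨p, q, hpq⟩ := exists_mul_of_coeff_ne_zero (b := C 0 0) (c := C 2 2) (f := C 0 2)
      (g := C 1 2) (h := C 0 1) (r := r2) (s := r0) h1 (by linear_combination hdet)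
      (by linear_combination hr2) (by linear_combination hr0)
    refine ⟨![p 1, p 0, p 2], ![q 1, q 0, q 2], fun x => ?_⟩
    rw [quadVal_eq hC]
    simp only [dotProduct, Fin.sum_univ_three, cons_val]
    linear_combination hpq (x 1) (x 0) (x 2)
  by_cases h2 : C 2 2 ≠ 0
  · obtain ⟨p, q, hpq⟩ := exists_mul_of_coeff_ne_zero (b := C 0 0) (c := C 1 1) (f := C 0 1)
      (g := C 1 2) (h := C 0 2) (r := r1) (s := r0) h2 (by linear_combination hdet)
      (by linear_combination hr1) (by linear_combination hr0)
    refine ⟨![p 1, p 2, p 0], ![q 1, q 2, q 0], fun x => ?_⟩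
    rw [quadVal_eq hC]
    simp only [dotProduct, Fin.sum_univ_three, cons_val]
    linear_combination hpq (x 2) (x 0) (x 1)
  push Not at h0 h1 h2
  rw [h0, h1, h2] at hdet
  have h3 : C 0 1 * C 0 2 * C 1 2 = 0 := by
    apply mul_left_cancel₀ ‹(2 : F) ≠ 0›
    linear_combination hdet
  rcases mul_eq_zero.1 h3 with h3 | h3
  · rcases mul_eq_zero.1 h3 with h3 | h3
    · refine ⟨![0, 0, 1], ![2 * C 0 2, 2 * C 1 2, 0], fun x => ?_⟩
      rw [quadVal_eq hC, h0, h1, h2, h3]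
      simp only [dotProduct, Fin.sum_univ_three, cons_val]
      ring
    · refine ⟨![0, 1, 0], ![2 * C 0 1, 0, 2 * C 1 2], fun x => ?_⟩
      rw [quadVal_eq hC, h0, h1, h2, h3]
      simp only [dotProduct, Fin.sum_univ_three, cons_val]
      ring
  · refine ⟨![1, 0, 0], ![0, 2 * C 0 1, 2 * C 0 2], fun x => ?_⟩
    rw [quadVal_eq hC, h0, h1, h2, h3]
    simp only [dotProduct, Fin.sum_univ_three, cons_val]
    ring

theorem exists_ne_zero_dotProduct_pair_eq_zero {F : Type*} [Field F] (a b : Fin 3 → F) :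
    ∃ x : Fin 3 → F, x ≠ 0 ∧ a ⬝ᵥ x = 0 ∧ b ⬝ᵥ x = 0 := by
  obtain ⟨x, hx, h⟩ := exists_mulVec_eq_zero_iff.2 (show (of ![a, b, 0]).det = 0 from
    det_eq_zero_of_row_eq_zero 2 (by simp))
  exact ⟨x, hx, congrFun h 0, congrFun h 1⟩

/-- An irrational member of an anisotropic rational pencil does not split over the field it
generates. -/
theorem exists_not_isSquare_of_irrational {A B : Matrix (Fin 3) (Fin 3) ℚ} (hA : A.IsSymm)
    (hB : B.IsSymm) (han : ∀ x : Fin 3 → ℚ, quadVal A x = 0 → quadVal B x = 0 → x = 0)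
    {K : Type} [Field K] [NumberField K] (hfin : Module.finrank ℚ K ≤ 3) (θ : K)
    (hθ : ∀ r : ℚ, θ ≠ algebraMap ℚ K r)
    (hdet : (θ • A.map (algebraMap ℚ K) - B.map (algebraMap ℚ K)).det = 0) :
    ∃ m, ¬ IsSquare (-(θ • A.map (algebraMap ℚ K) - B.map (algebraMap ℚ K)).adjugate m m) := by
  by_contra! hsq
  set f := algebraMap ℚ K with hf
  obtain ⟨a, b, hab⟩ := exists_mul_of_isSquare two_ne_zero
    (((hA.map f).smul θ).sub (hB.map f)) hdet hsq
  have hval : ∀ x : Fin 3 → ℚ, (a ⬝ᵥ (f ∘ x)) * (b ⬝ᵥ (f ∘ x)) =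
      θ * f (quadVal A x) - f (quadVal B x) := by
    intro x
    rw [← hab, ← one_smul K (B.map f), quadVal_smul_sub, quadVal_map, quadVal_map, one_mul]
  have hker : ∀ x : Fin 3 → ℚ, θ * f (quadVal A x) - f (quadVal B x) = 0 → x = 0 := by
    intro x hx
    have h1 : quadVal A x = 0 := by
      by_contra h
      apply hθ (quadVal B x / quadVal A x)
      have : f (quadVal A x) ≠ 0 := by simpa using h
      rw [map_div₀, eq_div_iff this]
      linear_combination hx
    refine han x h1 ?_
    rw [h1, map_zero, mul_zero, zero_sub, neg_eq_zero] at hx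
    simpa using hx
  let L : (Fin 3 → K) → ((Fin 3 → ℚ) →ₗ[ℚ] K) := fun a =>
    { toFun := fun x => a ⬝ᵥ (f ∘ x)
      map_add' := by
        intro x y
        simp only [dotProduct, Fin.sum_univ_three, Function.comp, Pi.add_apply, map_add]
        ring
      map_smul' := by
        intro r x
        simp only [dotProduct, Fin.sum_univ_three, Function.comp, Pi.smul_apply, smul_eq_mul,
          map_mul, Algebra.smul_def, RingHom.id_apply]
        ring }
  have hLa : ∀ x, L a x * L b x = θ * f (quadVal A x) - f (quadVal B x) := hval
  have ha : Function.Injective (L a) := by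
    rw [← LinearMap.ker_eq_bot, LinearMap.ker_eq_bot']
    intro x hx
    exact hker x (by rw [← hLa, hx, zero_mul])
  have hb : Function.Injective (L b) := by
    rw [← LinearMap.ker_eq_bot, LinearMap.ker_eq_bot']
    intro x hx
    exact hker x (by rw [← hLa, hx, mul_zero])
  have hfin3 : Module.finrank ℚ K = 3 := by
    have := LinearMap.finrank_le_finrank_of_injective ha
    simp at this
    omega
  have hsurj : Function.Surjective (L a) :=
    (LinearMap.injective_iff_surjective_of_finrank_eq_finrank (by simp [hfin3])).1 ha
  obtain ⟨φ, hφ0, hφ⟩ := Submodule.exists_le_ker_of_lt_top (Submodule.span ℚ {(1 : K), θ}) (by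
    rw [lt_top_iff_ne_top]
    intro h
    have h1 := finrank_range_le_card (R := ℚ) ![(1 : K), θ]
    rw [Set.finrank, range_cons, range_cons, range_empty, Set.union_empty, Set.singleton_union, h,
      finrank_top, hfin3] at h1
    simp at h1)
  have hφ1 : φ 1 = 0 := hφ (Submodule.subset_span (by simp))
  have hφθ : φ θ = 0 := hφ (Submodule.subset_span (by simp))
  let S : Matrix (Fin 3) (Fin 3) ℚ := .of fun i j => φ (L a (Pi.single i 1) * L b (Pi.single j 1))
  have hS : ∀ x y, φ (L a x * L b y) = x ⬝ᵥ (S *ᵥ y) := by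
    intro x y
    have hx : L a x = ∑ i, x i • L a (Pi.single i 1) := by
      conv_lhs => rw [pi_eq_sum_univ' x]
      simp
    have hy : L b y = ∑ i, y i • L b (Pi.single i 1) := by
      conv_lhs => rw [pi_eq_sum_univ' y]
      simp
    rw [hx, hy]
    simp only [S, dotProduct, mulVec, Finset.sum_mul, Finset.mul_sum, map_sum, of_apply,
      smul_mul_assoc, mul_smul_comm, map_smul, smul_eq_mul]
    rw [Finset.sum_comm]
    exact Finset.sum_congr rfl fun i _ => Finset.sum_congr rfl fun j _ => by ring
  have hS0 : ∀ x, x ⬝ᵥ (S *ᵥ x) = 0 := by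
    intro x
    rw [← hS, hLa, map_sub, mul_comm, ← Algebra.smul_def, map_smul, hφθ,
      Algebra.algebraMap_eq_smul_one,
      map_smul, hφ1]
    simp
  have hSdet : S.det = 0 := by
    have e : ∀ x y z : ℚ, _ := fun x y z => hS0 ![x, y, z]
    simp only [dotProduct, mulVec, Fin.sum_univ_three, cons_val] at e
    have e0 := e 1 0 0
    have e1 := e 0 1 0
    have e2 := e 0 0 1
    have e01 := e 1 1 0
    have e02 := e 1 0 1
    have e12 := e 0 1 1
    ring_nf at e0 e1 e2 e01 e02 e12
    rw [det_fin_three, e0, e1, e2, show S 1 0 = -S 0 1 by linarith,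
      show S 2 0 = -S 0 2 by linarith, show S 2 1 = -S 1 2 by linarith]
    ring
  obtain ⟨y, hy, hy0⟩ := exists_mulVec_eq_zero_iff.2 hSdet
  have hLy : L b y ≠ 0 := fun h => hy (hb (by rw [h, map_zero]))
  apply hφ0
  ext k
  obtain ⟨x, hx⟩ := hsurj (k / L b y)
  have := hS x y
  rw [hy0, hx, div_mul_cancel₀ _ hLy] at this
  simpa using this


section
variable {A B C : Matrix (Fin 3) (Fin 3) ℚ}

theorem quadVal_adjugate_col {R : Type*} [CommRing R] {A C : Matrix (Fin 3) (Fin 3) R}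
    (hA : A.IsSymm) (hC : C.IsSymm) (hdet : C.det = 0) (m : Fin 3) :
    quadVal A (fun i => C.adjugate i m) = C.adjugate m m * (C.adjugate * A).trace := by
  rw [det_fin_three, hC.apply 0 1, hC.apply 0 2, hC.apply 1 2] at hdet
  rw [quadVal_eq hA, trace_fin_three]
  fin_cases m <;>
  simp only [adjugate_fin_three, mul_apply, Fin.sum_univ_three, of_apply, cons_val, hC.apply 0 1,
    hC.apply 0 2, hC.apply 1 2, hA.apply 0 1, hA.apply 0 2, hA.apply 1 2, Fin.zero_eta, Fin.mk_one,
    Fin.reduceFinMk]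
  · linear_combination (-(A 1 1 * C 2 2 + A 2 2 * C 1 1 - 2 * A 1 2 * C 1 2)) * hdet
  · linear_combination (-(A 0 0 * C 2 2 + A 2 2 * C 0 0 - 2 * A 0 2 * C 0 2)) * hdet
  · linear_combination (-(A 1 1 * C 0 0 + A 0 0 * C 1 1 - 2 * A 0 1 * C 0 1)) * hdet

theorem adjugate_diag_eq_zero_of_trace_eq_zero (hA : A.IsSymm) (hB : B.IsSymm)
    (han : ∀ x : Fin 3 → ℚ, quadVal A x = 0 → quadVal B x = 0 → x = 0) {a : ℚ}
    (hdet : (a • A - B).det = 0) (htr : ((a • A - B).adjugate * A).trace = 0) (m : Fin 3) :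
    (a • A - B).adjugate m m = 0 := by
  have hC : (a • A - B).IsSymm := (hA.smul a).sub hB
  have h1 := quadVal_adjugate_col hA hC hdet m
  rw [htr, mul_zero] at h1
  have h2 : quadVal (a • A - B) (fun i => (a • A - B).adjugate i m) = 0 := by
    have : (a • A - B) *ᵥ (fun i => (a • A - B).adjugate i m) = 0 := by
      have h3 := mul_adjugate (a • A - B)
      rw [hdet, zero_smul] at h3
      funext i
      exact congrFun (congrFun h3 i) m
    rw [quadVal, this, dotProduct_zero]
  have h3 := quadVal_smul_sub A B a 1 (fun i => (a • A - B).adjugate i m)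
  rw [one_smul, h2, h1] at h3
  have h4 := han _ h1 (by linear_combination h3)
  exact congrFun h4 m

theorem exists_eq_mul_sq_of_adjugate_diag (hC : C.IsSymm) (hdet : C.det = 0)
    (hadj : ∀ m, C.adjugate m m = 0) :
    ∃ c : ℚ, c ≠ 0 ∧ ∃ l : Fin 3 → ℚ, ∀ x, quadVal C x = c * (l ⬝ᵥ x) ^ 2 := by
  rw [det_fin_three, hC.apply 0 1, hC.apply 0 2, hC.apply 1 2] at hdet
  have h0 := hadj 0
  have h1 := hadj 1
  have h2 := hadj 2
  simp only [adjugate_fin_three, of_apply, cons_val, hC.apply 0 1, hC.apply 0 2, hC.apply 1 2]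
    at h0 h1 h2
  by_cases k0 : C 0 0 ≠ 0
  · have e : C 0 0 * C 1 2 - C 0 1 * C 0 2 = 0 := by
      rw [← sq_eq_zero_iff]
      linear_combination (-C 0 0) * hdet + (C 0 0 * C 2 2 - C 0 2 ^ 2) * h2
    refine ⟨(C 0 0)⁻¹, inv_ne_zero k0, ![C 0 0, C 0 1, C 0 2], fun x => ?_⟩
    rw [quadVal_eq hC]
    simp only [dotProduct, Fin.sum_univ_three, cons_val]
    field_simp
    linear_combination (x 1) ^ 2 * h2 + (x 2) ^ 2 * h1 + 2 * x 1 * x 2 * e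
  by_cases k1 : C 1 1 ≠ 0
  · have e : C 1 1 * C 0 2 - C 0 1 * C 1 2 = 0 := by
      rw [← sq_eq_zero_iff]
      linear_combination (-C 1 1) * hdet + (C 1 1 * C 2 2 - C 1 2 ^ 2) * h2
    refine ⟨(C 1 1)⁻¹, inv_ne_zero k1, ![C 0 1, C 1 1, C 1 2], fun x => ?_⟩
    rw [quadVal_eq hC]
    simp only [dotProduct, Fin.sum_univ_three, cons_val]
    field_simp
    linear_combination (x 0) ^ 2 * h2 + (x 2) ^ 2 * h0 + 2 * x 0 * x 2 * e
  push Not at k0 k1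
  rw [k0, k1] at h2
  rw [k0] at h1
  rw [k1] at h0
  have e2 : C 0 1 = 0 := by
    rw [← sq_eq_zero_iff]; linear_combination -h2
  have e1 : C 0 2 = 0 := by
    rw [← sq_eq_zero_iff]; linear_combination -h1
  have e0 : C 1 2 = 0 := by
    rw [← sq_eq_zero_iff]; linear_combination -h0
  by_cases k2 : C 2 2 = 0
  · refine ⟨1, one_ne_zero, 0, fun x => ?_⟩
    rw [quadVal_eq hC, k0, k1, k2, e0, e1, e2]
    simp
  · refine ⟨C 2 2, k2, ![0, 0, 1], fun x => ?_⟩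
    rw [quadVal_eq hC, k0, k1, e0, e1, e2]
    simp only [dotProduct, Fin.sum_univ_three, cons_val]
    ring

theorem eq_zero_of_isSquare_two_mul_sq {d : ℚ} (h : IsSquare (2 * d ^ 2)) : d = 0 := by
  by_contra hd
  obtain ⟨r, hr⟩ := h
  have h2 : IsSquare (2 : ℚ) := ⟨r / d, by field_simp; linear_combination hr⟩
  rw [← Nat.cast_ofNat, Rat.isSquare_natCast_iff] at h2
  obtain ⟨n, hn⟩ := h2
  have : n < 2 := by nlinarith
  interval_cases n <;> omega

theorem mul_quadVal_eq_sq (hC : C.IsSymm) (hsq : ∀ x, IsSquare (quadVal C x)) (x y : Fin 3 → ℚ) :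
    quadVal C x * quadVal C y = (x ⬝ᵥ (C *ᵥ y)) ^ 2 := by
  have key : ∀ s t : ℚ, quadVal C (s • x + t • y) =
      s ^ 2 * quadVal C x + 2 * s * t * (x ⬝ᵥ (C *ᵥ y)) + t ^ 2 * quadVal C y := by
    intro s t
    rw [quadVal_eq hC, quadVal_eq hC, quadVal_eq hC]
    simp only [dotProduct, mulVec, Fin.sum_univ_three, Pi.add_apply, Pi.smul_apply, smul_eq_mul,
      hC.apply 0 1, hC.apply 0 2, hC.apply 1 2]
    ring
  set b := x ⬝ᵥ (C *ᵥ y)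
  obtain ⟨r, hr⟩ := hsq x
  obtain ⟨q, hq⟩ := hsq y
  by_cases h0 : quadVal C x = 0
  · have hb : b = 0 := by
      by_contra hb
      obtain ⟨u, hu⟩ := hsq (((-1 - quadVal C y) / (2 * b)) • x + (1 : ℚ) • y)
      rw [key, h0] at hu
      have e : ((-1 - quadVal C y) / (2 * b)) ^ 2 * 0 + 2 * ((-1 - quadVal C y) / (2 * b)) * 1 * b +
          1 ^ 2 * quadVal C y = -1 := by
        field_simp
        ring
      nlinarith [mul_self_nonneg u]
    rw [h0, hb]; ring
  · have hr0 : r ≠ 0 := by rintro rfl; exact h0 (by rw [hr]; ring)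
    obtain ⟨d, hd⟩ := hsq ((-b / r) • x + r • y)
    rw [key] at hd
    have hd' : d ^ 2 = quadVal C x * quadVal C y - b ^ 2 := by
      rw [sq, ← hd, hr]; field_simp; ring
    have h3 := hsq (((d - b) / r) • x + r • y)
    rw [key] at h3
    have h4 : d = 0 := eq_zero_of_isSquare_two_mul_sq (by
      convert h3 using 1
      rw [hr] at hd' ⊢
      field_simp
      linear_combination hd')
    rw [h4] at hd'
    linear_combination -hd'

theorem adjugate_eq_zero_of_isSquare (hC : C.IsSymm) (hsq : ∀ x, IsSquare (quadVal C x)) :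
    C.adjugate = 0 := by
  have h : ∀ a b c x y z : ℚ, _ := fun a b c x y z => mul_quadVal_eq_sq hC hsq ![a, b, c] ![x, y, z]
  simp only [quadVal, dotProduct, mulVec, Fin.sum_univ_three, cons_val,
    hC.apply 0 1, hC.apply 0 2, hC.apply 1 2] at h
  have h01 := h 1 0 0 0 1 0
  have h02 := h 1 0 0 0 0 1
  have h12 := h 0 1 0 0 0 1
  have g0 := h 1 0 0 0 1 1
  have g1 := h 0 1 0 1 0 1
  have g2 := h 0 0 1 1 1 0
  rw [adjugate_fin_three, hC.apply 0 1, hC.apply 0 2, hC.apply 1 2]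
  ext i j
  fin_cases i <;> fin_cases j <;> simp <;> linarith

theorem isSquare_diag_of_trace_eq_zero (hA : A.IsSymm) (hB : B.IsSymm)
    (han : ∀ x : Fin 3 → ℚ, quadVal A x = 0 → quadVal B x = 0 → x = 0) {a : ℚ}
    (hdet : (a • A - B).det = 0) (htr : ((a • A - B).adjugate * A).trace = 0) (m : Fin 3) :
    IsSquare (-(a • A - B).adjugate m m) :=
  ⟨0, by rw [adjugate_diag_eq_zero_of_trace_eq_zero hA hB han hdet htr m]; ring⟩

/-- At most one rational member of an anisotropic pencil splits. -/
theorem eq_of_isSquare_diag (hA : A.IsSymm) (hB : B.IsSymm)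
    (han : ∀ x : Fin 3 → ℚ, quadVal A x = 0 → quadVal B x = 0 → x = 0) {a b : ℚ}
    (ha : (a • A - B).det = 0) (ha' : ∀ m, IsSquare (-(a • A - B).adjugate m m))
    (hb : (b • A - B).det = 0) (hb' : ∀ m, IsSquare (-(b • A - B).adjugate m m)) : a = b := by
  by_contra hab
  obtain ⟨l, _, hl⟩ := exists_mul_of_isSquare two_ne_zero ((hA.smul a).sub hB) ha ha'
  obtain ⟨n, _, hn⟩ := exists_mul_of_isSquare two_ne_zero ((hA.smul b).sub hB) hb hb'
  obtain ⟨x, hx, hlx, hnx⟩ := exists_ne_zero_dotProduct_pair_eq_zero l n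
  have h1 := hl x
  have h2 := hn x
  rw [hlx, zero_mul, ← one_smul ℚ B, quadVal_smul_sub] at h1
  rw [hnx, zero_mul, ← one_smul ℚ B, quadVal_smul_sub] at h2
  have h3 : quadVal A x = 0 := by
    apply mul_left_cancel₀ (sub_ne_zero.2 hab)
    linear_combination h1 - h2
  exact hx (han x h3 (by rw [h3] at h1; linear_combination -h1))
end

section
open Polynomial

/-- The monic cubic with the roots of `det (X • A - B)`. -/
noncomputable def pencilPoly (A B : Matrix (Fin 3) (Fin 3) ℚ) : ℚ[X] :=
  X ^ 3 - C ((A.adjugate * B).trace / A.det) * X ^ 2 + C ((A * B.adjugate).trace / A.det) * X -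
    C (B.det / A.det)

section
variable {A B : Matrix (Fin 3) (Fin 3) ℚ} {K : Type*} [Field K] [Algebra ℚ K]

theorem natDegree_pencilPoly : (pencilPoly A B).natDegree = 3 := by
  unfold pencilPoly
  compute_degree!

theorem monic_pencilPoly : (pencilPoly A B).Monic := by
  unfold pencilPoly
  monicity!

theorem det_smul_map_sub_map (hA : A.det ≠ 0) (θ : K) :
    (θ • A.map (algebraMap ℚ K) - B.map (algebraMap ℚ K)).det =
      algebraMap ℚ K A.det * aeval θ (pencilPoly A B) := by
  have h0 : algebraMap ℚ K A.det ≠ 0 := (_root_.map_ne_zero _).2 hA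
  have h1 := det_smul_sub_smul (A.map (algebraMap ℚ K)) (B.map (algebraMap ℚ K)) θ 1
  rw [one_smul] at h1
  rw [h1, pencilPoly]
  have e1 := map_trace_adjugate_mul (algebraMap ℚ K) A B
  have e2 := map_trace_adjugate_mul (algebraMap ℚ K) B A
  have e3 := RingHom.map_det (algebraMap ℚ K) A
  have e4 := RingHom.map_det (algebraMap ℚ K) B
  simp only [RingHom.mapMatrix_apply] at e1 e2 e3 e4
  rw [← e1, ← e3, ← e4, trace_mul_comm (A.map (algebraMap ℚ K)), ← e2, trace_mul_comm A]
  simp only [map_sub, map_add, map_mul, map_pow, aeval_X, aeval_C, map_div₀]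
  field_simp

theorem trace_adjugate_smul_map_sub_map (hA : A.det ≠ 0) (θ : K) :
    ((θ • A.map (algebraMap ℚ K) - B.map (algebraMap ℚ K)).adjugate *
      A.map (algebraMap ℚ K)).trace =
      algebraMap ℚ K A.det * aeval θ (derivative (pencilPoly A B)) := by
  have h0 : algebraMap ℚ K A.det ≠ 0 := (_root_.map_ne_zero _).2 hA
  have h1 : ∀ A B : Matrix (Fin 3) (Fin 3) K, ((θ • A - B).adjugate * A).trace =
      3 * θ ^ 2 * A.det - 2 * θ * (A.adjugate * B).trace + (B.adjugate * A).trace := by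
    intro A B
    simp only [det_fin_three, adjugate_fin_three, trace_fin_three, mul_apply, Fin.sum_univ_three]
    simp
    ring
  rw [h1, pencilPoly]
  have e1 := map_trace_adjugate_mul (algebraMap ℚ K) A B
  have e2 := map_trace_adjugate_mul (algebraMap ℚ K) B A
  have e3 := RingHom.map_det (algebraMap ℚ K) A
  simp only [RingHom.mapMatrix_apply] at e1 e2 e3
  rw [← e1, ← e3, ← e2, trace_mul_comm A]
  simp only [eq_ratCast] at h0
  simp
  field_simp
  ring

theorem det_smul_sub (hA : A.det ≠ 0) (θ : ℚ) :
    (θ • A - B).det = A.det * (pencilPoly A B).eval θ := by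
  have := det_smul_map_sub_map (B := B) hA θ
  simpa using this

theorem trace_adjugate_smul_sub (hA : A.det ≠ 0) (θ : ℚ) :
    ((θ • A - B).adjugate * A).trace = A.det * (derivative (pencilPoly A B)).eval θ := by
  have := trace_adjugate_smul_map_sub_map (B := B) hA θ
  simpa using this

end

/-- Two anisotropic rational pencils of ternary quadratic forms with the same simultaneous
representations. -/
structure RepPair (A₁ B₁ A₂ B₂ : Matrix (Fin 3) (Fin 3) ℚ) : Prop where
  symmA₁ : A₁.IsSymm
  symmB₁ : B₁.IsSymm
  symmA₂ : A₂.IsSymm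
  symmB₂ : B₂.IsSymm
  li₁ : ∀ a b : ℚ, a • A₁ + b • B₁ = 0 → a = 0 ∧ b = 0
  li₂ : ∀ a b : ℚ, a • A₂ + b • B₂ = 0 → a = 0 ∧ b = 0
  an₁ : ∀ x, quadVal A₁ x = 0 → quadVal B₁ x = 0 → x = 0
  an₂ : ∀ x, quadVal A₂ x = 0 → quadVal B₂ x = 0 → x = 0
  rep₁ : ∀ x : Fin 3 → ℚ, x ≠ 0 → ∃ y : Fin 3 → ℚ, y ≠ 0 ∧
      quadVal A₁ y = quadVal A₂ x ∧ quadVal B₁ y = quadVal B₂ x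
  rep₂ : ∀ x : Fin 3 → ℚ, x ≠ 0 → ∃ y : Fin 3 → ℚ, y ≠ 0 ∧
      quadVal A₂ y = quadVal A₁ x ∧ quadVal B₂ y = quadVal B₁ x
  det₁ : A₁.det ≠ 0
  det₂ : A₂.det ≠ 0

/-- The member of a pencil with parameter `a` is a product of two linear forms. -/
def IsSplitMember (A B : Matrix (Fin 3) (Fin 3) ℚ) (a : ℚ) : Prop :=
  (a • A - B).det = 0 ∧ ∀ m, IsSquare (-(a • A - B).adjugate m m)

namespace RepPair
variable {A₁ B₁ A₂ B₂ : Matrix (Fin 3) (Fin 3) ℚ}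

theorem symm (h : RepPair A₁ B₁ A₂ B₂) : RepPair A₂ B₂ A₁ B₁ :=
  ⟨h.symmA₂, h.symmB₂, h.symmA₁, h.symmB₁, h.li₂, h.li₁, h.an₂, h.an₁, h.rep₂, h.rep₁, h.det₂,
    h.det₁⟩

theorem eval_ne_zero_or (h : RepPair A₁ B₁ A₂ B₂) {a : ℚ} (ha : (pencilPoly A₁ B₁).eval a = 0)
    (hs : ¬ IsSplitMember A₁ B₁ a) :
    (derivative (pencilPoly A₁ B₁)).eval a ≠ 0 ∧ (pencilPoly A₂ B₂).eval a = 0 := by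
  have hdet : (a • A₁ - B₁).det = 0 := by rw [det_smul_sub h.det₁, ha, mul_zero]
  have hm : ∃ m, ¬ IsSquare (-(a • A₁ - B₁).adjugate m m) := by
    by_contra! hcon
    exact hs ⟨hdet, hcon⟩
  obtain ⟨m, hm⟩ := hm
  have hd : (derivative (pencilPoly A₁ B₁)).eval a ≠ 0 := by
    intro h0
    refine hm (isSquare_diag_of_trace_eq_zero h.symmA₁ h.symmB₁ h.an₁ hdet ?_ m)
    rw [trace_adjugate_smul_sub h.det₁, h0, mul_zero]
  refine ⟨hd, ?_⟩
  have := det_eq_zero_of_not_isSquare h.symmA₁ h.symmB₁ h.symmA₂ h.symmB₂ h.li₂ h.rep₁ a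
    (f := RingHom.id ℚ) (by simpa using hdet) (by
      simp only [RingHom.coe_id, map_id]
      rw [trace_adjugate_smul_sub h.det₁]
      exact mul_ne_zero h.det₁ hd) m (by simpa using hm)
  simp only [RingHom.coe_id, map_id] at this
  rw [det_smul_sub h.det₂] at this
  exact (mul_eq_zero.1 this).resolve_left h.det₂

/-- A double root of a rational cubic is rational. -/
theorem exists_rat_of_double_root {f : ℚ[X]} (hf : f.natDegree = 3) {K : Type*} [Field K]
    [Algebra ℚ K] {α : K} (h0 : aeval α f = 0) (h1 : aeval α (derivative f) = 0) :
    ∃ r : ℚ, α = algebraMap ℚ K r := by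
  by_contra! hα
  have hf0 : f ≠ 0 := by rintro rfl; simp at hf
  have hInt : IsIntegral ℚ α := by
    rw [← isAlgebraic_iff_isIntegral]
    exact ⟨f, hf0, h0⟩
  have hirr := minpoly.irreducible hInt
  obtain ⟨g, hg⟩ := minpoly.dvd ℚ α h0
  have hd : aeval α (derivative (minpoly ℚ α)) ≠ 0 :=
    hirr.separable.aeval_derivative_ne_zero (minpoly.aeval ℚ α)
  rw [hg, derivative_mul, map_add, map_mul, map_mul, minpoly.aeval, zero_mul, add_zero] at h1
  obtain ⟨k, hk⟩ := minpoly.dvd ℚ α ((mul_eq_zero.1 h1).resolve_left hd)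
  rw [hk] at hg
  have hdeg : 2 ≤ (minpoly ℚ α).natDegree := by
    rw [minpoly.two_le_natDegree_iff hInt]
    rintro ⟨r, hr⟩
    exact hα r hr.symm
  have hk0 : k ≠ 0 := by rintro rfl; simp [hg] at hf0
  rw [hg, natDegree_mul hirr.ne_zero (mul_ne_zero hirr.ne_zero hk0),
    natDegree_mul hirr.ne_zero hk0] at hf
  omega

theorem aeval_eq_zero_of_irrational (h : RepPair A₁ B₁ A₂ B₂) {α : ℂ}
    (hα : ∀ r : ℚ, α ≠ algebraMap ℚ ℂ r) (h0 : aeval α (pencilPoly A₁ B₁) = 0) :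
    aeval α (pencilPoly A₂ B₂) = 0 := by
  have hInt : IsIntegral ℚ α := ⟨_, monic_pencilPoly, h0⟩
  have : FiniteDimensional ℚ (IntermediateField.adjoin ℚ {α}) :=
    IntermediateField.adjoin.finiteDimensional hInt
  let θ : IntermediateField.adjoin ℚ {α} := IntermediateField.AdjoinSimple.gen ℚ α
  have hθα : algebraMap (IntermediateField.adjoin ℚ {α}) ℂ θ = α :=
    IntermediateField.AdjoinSimple.algebraMap_gen ℚ α
  have hinj : Function.Injective (algebraMap (IntermediateField.adjoin ℚ {α}) ℂ) :=
    (algebraMap (IntermediateField.adjoin ℚ {α}) ℂ).injective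
  have haev : ∀ f : ℚ[X], aeval α f =
      algebraMap (IntermediateField.adjoin ℚ {α}) ℂ (aeval θ f) := by
    intro f
    rw [← aeval_algebraMap_apply, hθα]
  have hθ : ∀ r : ℚ, θ ≠ algebraMap ℚ _ r := by
    intro r hr
    apply hα r
    rw [← hθα, hr, ← IsScalarTower.algebraMap_apply]
  have h0' : aeval θ (pencilPoly A₁ B₁) = 0 := by
    apply hinj
    rw [← haev, h0, map_zero]
  have hfin : Module.finrank ℚ (IntermediateField.adjoin ℚ {α}) ≤ 3 := by
    rw [IntermediateField.adjoin.finrank hInt, ← natDegree_pencilPoly (A := A₁) (B := B₁)]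
    exact natDegree_le_of_dvd (minpoly.dvd ℚ α h0) monic_pencilPoly.ne_zero
  have hdet := det_smul_map_sub_map (B := B₁) h.det₁ θ
  rw [h0', mul_zero] at hdet
  have : NumberField (IntermediateField.adjoin ℚ {α}) := {}
  obtain ⟨m, hm⟩ := exists_not_isSquare_of_irrational h.symmA₁ h.symmB₁ h.an₁ hfin θ hθ hdet
  have key := det_eq_zero_of_not_isSquare h.symmA₁ h.symmB₁ h.symmA₂ h.symmB₂ h.li₂ h.rep₁ θ
    hdet (by
      rw [trace_adjugate_smul_map_sub_map h.det₁]
      refine mul_ne_zero (by simpa using h.det₁) fun h1 => ?_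
      obtain ⟨r, hr⟩ := exists_rat_of_double_root natDegree_pencilPoly h0' h1
      exact hθ r hr) m hm
  rw [det_smul_map_sub_map h.det₂] at key
  rw [haev, (mul_eq_zero.1 key).resolve_left (by simpa using h.det₂), map_zero]

theorem double_root (h : RepPair A₁ B₁ A₂ B₂) {a : ℚ} (h0 : (pencilPoly A₁ B₁).eval a = 0)
    (h1 : (derivative (pencilPoly A₁ B₁)).eval a = 0) :
    IsSplitMember A₁ B₁ a ∧ (pencilPoly A₂ B₂).eval a = 0 ∧
      (derivative (pencilPoly A₂ B₂)).eval a = 0 := by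
  have hdet : (a • A₁ - B₁).det = 0 := by rw [det_smul_sub h.det₁, h0, mul_zero]
  have htr : ((a • A₁ - B₁).adjugate * A₁).trace = 0 := by
    rw [trace_adjugate_smul_sub h.det₁, h1, mul_zero]
  refine ⟨⟨hdet, isSquare_diag_of_trace_eq_zero h.symmA₁ h.symmB₁ h.an₁ hdet htr⟩, ?_⟩
  obtain ⟨c, hc, l, hl⟩ := exists_eq_mul_sq_of_adjugate_diag ((h.symmA₁.smul a).sub h.symmB₁) hdet
    (adjugate_diag_eq_zero_of_trace_eq_zero h.symmA₁ h.symmB₁ h.an₁ hdet htr)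
  have hadj : (c⁻¹ • (a • A₂ - B₂)).adjugate = 0 := by
    refine adjugate_eq_zero_of_isSquare (((h.symmA₂.smul a).sub h.symmB₂).smul _) fun x => ?_
    by_cases hx : x = 0
    · exact ⟨0, by simp [hx, quadVal]⟩
    obtain ⟨y, _, hyA, hyB⟩ := h.rep₁ x hx
    have h2 := hl y
    rw [← one_smul ℚ B₁, quadVal_smul_sub, hyA, hyB, ← quadVal_smul_sub, one_smul] at h2
    exact ⟨l ⬝ᵥ y, by rw [quadVal_smul_left, h2]; field_simp⟩
  rw [adjugate_smul] at hadj
  have hadj' : (a • A₂ - B₂).adjugate = 0 :=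
    (smul_eq_zero.1 hadj).resolve_left (pow_ne_zero _ (inv_ne_zero hc))
  have hdet₂ : (a • A₂ - B₂).det = 0 := by
    have h3 := mul_adjugate (a • A₂ - B₂)
    rw [hadj', mul_zero] at h3
    have := congrFun (congrFun h3 0) 0
    simpa using this.symm
  constructor
  · rw [det_smul_sub h.det₂] at hdet₂
    exact (mul_eq_zero.1 hdet₂).resolve_left h.det₂
  · have h4 := trace_adjugate_smul_sub (B := B₂) h.det₂ a
    rw [hadj', zero_mul, trace_zero] at h4
    exact (mul_eq_zero.1 h4.symm).resolve_left h.det₂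

end RepPair

end

section
open Polynomial

theorem separable_of_aeval_ne_zero {h : ℚ[X]}
    (hr : ∀ α : ℂ, aeval α h = 0 → aeval α (derivative h) ≠ 0) : h.Separable := by
  rw [Polynomial.separable_def, isCoprime_iff_aeval_ne_zero_of_isAlgClosed ℚ ℂ]
  intro α
  by_cases h0 : aeval α h = 0
  · exact .inr (hr α h0)
  · exact .inl h0

theorem dvd_of_separable_of_aeval {h f : ℚ[X]} (hs : h.Separable)
    (hr : ∀ α : ℂ, aeval α h = 0 → aeval α f = 0) : h ∣ f := by
  by_cases hf : f = 0
  · rw [hf]; exact dvd_zero _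
  rw [← map_dvd_map' (algebraMap ℚ ℂ)]
  have hh : h.map (algebraMap ℚ ℂ) ≠ 0 :=
    (Polynomial.map_ne_zero_iff (algebraMap ℚ ℂ).injective).2 hs.ne_zero
  refine (IsAlgClosed.splits (h.map (algebraMap ℚ ℂ))).dvd_of_roots_le_roots hh ?_
  rw [Multiset.le_iff_subset (nodup_roots hs.map)]
  intro α hα
  rw [mem_roots hh, IsRoot, eval_map_algebraMap] at hα
  rw [mem_roots ((Polynomial.map_ne_zero_iff (algebraMap ℚ ℂ).injective).2 hf), IsRoot,
    eval_map_algebraMap]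
  exact hr α hα

theorem eq_of_dvd_of_monic {h f : ℚ[X]} (hh : h.Monic) (hf : f.Monic)
    (hdeg : f.natDegree = h.natDegree) (hd : h ∣ f) : h = f :=
  (eq_of_monic_of_dvd_of_natDegree_le hh hf hd hdeg.le).symm

theorem exists_monic_factor {f : ℚ[X]} (hf : f.Monic) {n : ℕ} (hn : f.natDegree = n + 1) {a : ℚ}
    (ha : f.eval a = 0) : ∃ g : ℚ[X], g.Monic ∧ g.natDegree = n ∧ f = (X - C a) * g := by
  obtain ⟨g, hg⟩ := dvd_iff_isRoot.2 ha
  have hgm : g.Monic := (monic_X_sub_C a).of_mul_monic_left (hg ▸ hf)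
  refine ⟨g, hgm, ?_, hg⟩
  rw [hg, (monic_X_sub_C a).natDegree_mul hgm, natDegree_X_sub_C] at hn
  omega

namespace RepPair
variable {A₁ B₁ A₂ B₂ : Matrix (Fin 3) (Fin 3) ℚ}

theorem aeval_ne_zero_or (h : RepPair A₁ B₁ A₂ B₂) {α : ℂ} (h0 : aeval α (pencilPoly A₁ B₁) = 0)
    (hs : ∀ r : ℚ, α = algebraMap ℚ ℂ r → ¬ IsSplitMember A₁ B₁ r) :
    aeval α (derivative (pencilPoly A₁ B₁)) ≠ 0 ∧ aeval α (pencilPoly A₂ B₂) = 0 := by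
  by_cases hα : ∃ r : ℚ, α = algebraMap ℚ ℂ r
  · obtain ⟨r, rfl⟩ := hα
    have := h.eval_ne_zero_or (a := r) (by
      rw [aeval_algebraMap_apply] at h0
      simpa using h0) (hs r rfl)
    rw [aeval_algebraMap_apply, aeval_algebraMap_apply]
    simpa using this
  · push Not at hα
    refine ⟨fun h1 => ?_, h.aeval_eq_zero_of_irrational hα h0⟩
    obtain ⟨r, hr⟩ := exists_rat_of_double_root natDegree_pencilPoly h0 h1
    exact hα r hr

theorem isSplitMember_unique (h : RepPair A₁ B₁ A₂ B₂) {a b : ℚ} (ha : IsSplitMember A₁ B₁ a)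
    (hb : IsSplitMember A₁ B₁ b) : a = b :=
  eq_of_isSquare_diag h.symmA₁ h.symmB₁ h.an₁ ha.1 ha.2 hb.1 hb.2

theorem eq_of_double_root (h : RepPair A₁ B₁ A₂ B₂) {a : ℚ} (h0 : (pencilPoly A₁ B₁).eval a = 0)
    (h1 : (derivative (pencilPoly A₁ B₁)).eval a = 0) : pencilPoly A₁ B₁ = pencilPoly A₂ B₂ := by
  obtain ⟨hs₁, h0', h1'⟩ := h.double_root h0 h1
  obtain ⟨hs₂, -, -⟩ := h.symm.double_root h0' h1'
  have key : ∀ f : ℚ[X], f.Monic → f.natDegree = 3 → f.eval a = 0 → (derivative f).eval a = 0 →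
      ∃ c, f = (X - C a) * ((X - C a) * (X - C c)) := by
    intro f hf hf3 hf0 hf1
    obtain ⟨g, hg, hg2, hfg⟩ := exists_monic_factor hf hf3 hf0
    have hga : g.eval a = 0 := by
      rw [hfg, derivative_mul] at hf1
      simpa using hf1
    obtain ⟨k, hk, hk1, hgk⟩ := exists_monic_factor hg hg2 hga
    refine ⟨-k.coeff 0, ?_⟩
    rw [hfg, hgk, hk.eq_X_add_C hk1]
    simp
  obtain ⟨c, hc⟩ := key _ monic_pencilPoly natDegree_pencilPoly h0 h1
  obtain ⟨c', hc'⟩ := key _ monic_pencilPoly natDegree_pencilPoly h0' h1'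
  have hcc : c = c' := by
    by_cases hca : c = a
    · by_contra hne
      have := (h.symm.eval_ne_zero_or (a := c') (by rw [hc']; simp) (fun hs => by
        have := h.symm.isSplitMember_unique hs hs₂
        exact hne (hca.trans this.symm))).2
      rw [hc] at this
      simp [sub_eq_zero, hca] at this
      exact hne (hca.trans this.symm)
    · have := (h.eval_ne_zero_or (a := c) (by rw [hc]; simp) (fun hs => 
        hca (h.isSplitMember_unique hs hs₁))).2
      rw [hc'] at this
      simpa [sub_eq_zero, hca] using this
  rw [hc, hc', hcc]

theorem exists_split_factor (h : RepPair A₁ B₁ A₂ B₂)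
    (hne : pencilPoly A₁ B₁ ≠ pencilPoly A₂ B₂) :
    ∃ (a : ℚ) (g : ℚ[X]), g.Monic ∧ g.natDegree = 2 ∧ pencilPoly A₁ B₁ = (X - C a) * g ∧
      IsSplitMember A₁ B₁ a ∧ g.eval a ≠ 0 ∧ g.Separable ∧ g ∣ pencilPoly A₂ B₂ := by
  have hsp : ∃ a, IsSplitMember A₁ B₁ a := by
    by_contra! hcon
    apply hne
    have hs : (pencilPoly A₁ B₁).Separable :=
      separable_of_aeval_ne_zero fun α hα => (h.aeval_ne_zero_or hα fun r _ => hcon r).1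
    exact eq_of_dvd_of_monic monic_pencilPoly monic_pencilPoly
      (natDegree_pencilPoly.trans natDegree_pencilPoly.symm) (dvd_of_separable_of_aeval hs
        fun α hα => (h.aeval_ne_zero_or hα fun r _ => hcon r).2)
  obtain ⟨a, ha⟩ := hsp
  have h0 : (pencilPoly A₁ B₁).eval a = 0 := by
    have := ha.1
    rw [det_smul_sub h.det₁] at this
    exact (mul_eq_zero.1 this).resolve_left h.det₁
  obtain ⟨g, hg, hg2, hfg⟩ := exists_monic_factor monic_pencilPoly natDegree_pencilPoly h0
  have hga : g.eval a ≠ 0 := by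
    intro hga
    apply hne
    refine h.eq_of_double_root h0 ?_
    rw [hfg, derivative_mul]
    simpa using hga
  have key : ∀ α : ℂ, aeval α g = 0 → aeval α (derivative g) ≠ 0 ∧
      aeval α (pencilPoly A₂ B₂) = 0 := by
    intro α hα
    obtain ⟨h1, h2⟩ := h.aeval_ne_zero_or (α := α) (by rw [hfg, map_mul, hα, mul_zero]) (by
      rintro r rfl hs
      rw [h.isSplitMember_unique hs ha, aeval_algebraMap_apply] at hα
      apply hga
      simpa using hα)
    refine ⟨fun h3 => h1 ?_, h2⟩
    rw [hfg, derivative_mul, map_add, map_mul, map_mul, h3, hα, mul_zero, mul_zero, add_zero]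
  have hs := separable_of_aeval_ne_zero fun α hα => (key α hα).1
  exact ⟨a, g, hg, hg2, hfg, ha, hga, hs, dvd_of_separable_of_aeval hs fun α hα => (key α hα).2⟩

theorem isCoprime_X_sub_C_of_eval_ne_zero {g : ℚ[X]} {a : ℚ} (h : g.eval a ≠ 0) :
    IsCoprime (X - C a) g :=
  (irreducible_X_sub_C a).coprime_iff_not_dvd.2 (by rwa [dvd_iff_isRoot])

theorem exists_common_factor (h : RepPair A₁ B₁ A₂ B₂)
    (hne : pencilPoly A₁ B₁ ≠ pencilPoly A₂ B₂) :
    ∃ (a b : ℚ) (g : ℚ[X]), a ≠ b ∧ g.Monic ∧ g.natDegree = 2 ∧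
      pencilPoly A₁ B₁ = (X - C a) * g ∧ pencilPoly A₂ B₂ = (X - C b) * g ∧
      IsSplitMember A₁ B₁ a ∧ IsSplitMember A₂ B₂ b ∧ g.eval a ≠ 0 ∧ g.eval b ≠ 0 ∧
      g.Separable := by
  obtain ⟨a, g, hg, hg2, hfg, ha, hga, hs, hd⟩ := h.exists_split_factor hne
  obtain ⟨b, g', hg', hg2', hfg', hb, hgb, hs', hd'⟩ := h.symm.exists_split_factor hne.symm
  have h1 : (pencilPoly A₁ B₁).eval b ≠ 0 := by
    intro h0
    apply hne.symm
    refine eq_of_dvd_of_monic monic_pencilPoly monic_pencilPoly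
      (natDegree_pencilPoly.trans natDegree_pencilPoly.symm) ?_
    rw [hfg']
    exact (isCoprime_X_sub_C_of_eval_ne_zero hgb).mul_dvd (dvd_iff_isRoot.2 h0) hd'
  have hgb' : g.eval b ≠ 0 := by
    intro h0
    apply h1
    rw [hfg, eval_mul, h0, mul_zero]
  have hgg : g = g' := by
    refine eq_of_dvd_of_monic hg hg' (hg2'.trans hg2.symm) ?_
    rw [hfg'] at hd
    exact (isCoprime_X_sub_C_of_eval_ne_zero hgb').symm.dvd_of_dvd_mul_left hd
  refine ⟨a, b, g, ?_, hg, hg2, hfg, by rw [hfg', hgg], ha, hb, hga, hgb', hs⟩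
  rintro rfl
  apply h1
  rw [hfg]
  simp

end RepPair

end


section
variable {A B C D : Matrix (Fin 3) (Fin 3) ℚ}

theorem eq_of_quadVal_eq (hC : C.IsSymm) (hD : D.IsSymm) (h : ∀ x, quadVal C x = quadVal D x) :
    C = D := by
  have e : ∀ x y z : ℚ, _ := fun x y z => h ![x, y, z]
  simp only [quadVal, dotProduct, mulVec, Fin.sum_univ_three, cons_val, hC.apply 0 1,
    hC.apply 0 2, hC.apply 1 2, hD.apply 0 1, hD.apply 0 2, hD.apply 1 2] at e
  have e0 := e 1 0 0
  have e1 := e 0 1 0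
  have e2 := e 0 0 1
  have e01 := e 1 1 0
  have e02 := e 1 0 1
  have e12 := e 0 1 1
  have s1 := hC.apply 0 1
  have s2 := hC.apply 0 2
  have s3 := hC.apply 1 2
  have t1 := hD.apply 0 1
  have t2 := hD.apply 0 2
  have t3 := hD.apply 1 2
  ext i j
  fin_cases i <;> fin_cases j <;> simp <;> linarith

theorem not_quadVal_eq_mul_sq (hC : C.IsSymm)
    (htr : (C.adjugate * A).trace ≠ 0) (k : ℚ) (l : Fin 3 → ℚ) :
    ¬ ∀ x, quadVal C x = k * (l ⬝ᵥ x) ^ 2 := by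
  intro h
  apply htr
  suffices hadj : C.adjugate = 0 by rw [hadj, zero_mul, trace_zero]
  by_cases hk : k = 0
  · exact adjugate_eq_zero_of_isSquare hC fun x => ⟨0, by rw [h, hk]; ring⟩
  · have := adjugate_eq_zero_of_isSquare (hC.smul k⁻¹) fun x => ⟨l ⬝ᵥ x, by
      rw [quadVal_smul_left, h]; field_simp⟩
    rw [adjugate_smul] at this
    exact (smul_eq_zero.1 this).resolve_left (pow_ne_zero _ (inv_ne_zero hk))

theorem exists_kernel_vector (hA : A.IsSymm) (hB : B.IsSymm)
    (han : ∀ x, quadVal A x = 0 → quadVal B x = 0 → x = 0) {a : ℚ}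
    (hdet : (a • A - B).det = 0) (htr : ((a • A - B).adjugate * A).trace ≠ 0) :
    ∃ e, (a • A - B) *ᵥ e = 0 ∧ quadVal A e ≠ 0 := by
  have hC : (a • A - B).IsSymm := (hA.smul a).sub hB
  have hker : ∀ m, (a • A - B) *ᵥ (fun i => (a • A - B).adjugate i m) = 0 := by
    intro m
    have h3 := mul_adjugate (a • A - B)
    rw [hdet, zero_smul] at h3
    funext i
    exact congrFun (congrFun h3 i) m
  by_contra! hcon
  apply htr
  have hadj : (a • A - B).adjugate = 0 := by
    ext i m
    have h1 := hcon _ (hker m)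
    have h2 := quadVal_smul_sub A B a 1 (fun i => (a • A - B).adjugate i m)
    rw [one_smul, h1, quadVal, hker m, dotProduct_zero] at h2
    exact congrFun (han _ h1 (by linear_combination h2)) i
  rw [hadj, zero_mul, trace_zero]

/-- The normal form of a rational pencil with a split member. -/
theorem exists_split_normal_form (hA : A.IsSymm) (hB : B.IsSymm)
    (han : ∀ x, quadVal A x = 0 → quadVal B x = 0 → x = 0) {a : ℚ}
    (hs : IsSplitMember A B a) (htr : ((a • A - B).adjugate * A).trace ≠ 0) :
    ∃ (P : Matrix (Fin 3) (Fin 3) ℚ) (w u v c : ℚ), IsUnit P.det ∧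
      Pᵀ * A * P = !![u, c, 0; c, v, 0; 0, 0, w] ∧
      Pᵀ * (a • A - B) * P = !![0, 1 / 2, 0; 1 / 2, 0, 0; 0, 0, 0] := by
  obtain ⟨e, he, hAe⟩ := exists_kernel_vector hA hB han hs.1 htr
  set C := a • A - B with hCdef
  have hC : C.IsSymm := (hA.smul a).sub hB
  obtain ⟨l, n, hln⟩ := exists_mul_of_isSquare two_ne_zero hC hs.1 hs.2
  have hadd : ∀ x, quadVal C (x + e) = quadVal C x := by
    intro x
    rw [quadVal_add hC, he]
    simp [quadVal, he]
  have hle : (l ⬝ᵥ e) * (n ⬝ᵥ e) = 0 := by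
    rw [← hln, quadVal, he, dotProduct_zero]
  have hlin : ∀ x, (l ⬝ᵥ x) * (n ⬝ᵥ e) + (l ⬝ᵥ e) * (n ⬝ᵥ x) = 0 := by
    intro x
    have := hadd x
    rw [hln, hln, dotProduct_add, dotProduct_add] at this
    linear_combination this - hle
  have hl0 : l ⬝ᵥ e = 0 := by
    by_contra h0
    refine not_quadVal_eq_mul_sq hC htr 0 0 fun x => ?_
    have h1 := hlin x
    rw [(mul_eq_zero.1 hle).resolve_left h0, mul_zero, zero_add] at h1
    rw [hln, (mul_eq_zero.1 h1).resolve_left h0]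
    ring
  have hn0 : n ⬝ᵥ e = 0 := by
    by_contra h0
    refine not_quadVal_eq_mul_sq hC htr 0 0 fun x => ?_
    have h1 := hlin x
    rw [hl0, zero_mul, add_zero] at h1
    rw [hln, (mul_eq_zero.1 h1).resolve_right h0]
    ring
  set w := quadVal A e with hw
  let r : Fin 3 → ℚ := w⁻¹ • (A *ᵥ e)
  have hre : r ⬝ᵥ e = 1 := by
    simp only [r, smul_dotProduct, smul_eq_mul]
    rw [dotProduct_comm, ← quadVal, ← hw, inv_mul_cancel₀ hAe]
  let R : Matrix (Fin 3) (Fin 3) ℚ := of ![l, n, r]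
  have hR : IsUnit R.det := by
    rw [isUnit_iff_ne_zero]
    intro h0
    obtain ⟨y, hy, hy0⟩ := exists_vecMul_eq_zero_iff.2 h0
    have h1 : ∀ x, y 0 * (l ⬝ᵥ x) + y 1 * (n ⬝ᵥ x) + y 2 * (r ⬝ᵥ x) = 0 := by
      intro x
      have : (y ᵥ* R) ⬝ᵥ x = 0 := by rw [hy0, zero_dotProduct]
      rw [← dotProduct_mulVec] at this
      simp only [dotProduct, mulVec, R, of_apply, Fin.sum_univ_three, cons_val] at this ⊢
      linear_combination this
    have h2 : y 2 = 0 := by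
      have := h1 e
      rw [hl0, hn0, hre] at this
      linear_combination this
    by_cases hy1 : y 1 = 0
    · have hy0' : y 0 ≠ 0 := by
        intro h
        apply hy
        funext i
        fin_cases i <;> assumption
      refine not_quadVal_eq_mul_sq hC htr 0 0 fun x => ?_
      have := h1 x
      rw [hy1, h2, zero_mul, zero_mul, add_zero, add_zero] at this
      rw [hln, (mul_eq_zero.1 this).resolve_left hy0']
      ring
    · refine not_quadVal_eq_mul_sq hC htr (-(y 0) / y 1) l fun x => ?_
      have := h1 x
      rw [h2] at this
      rw [hln]
      field_simp
      linear_combination (l ⬝ᵥ x) * this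
  have hRP : R * R⁻¹ = 1 := mul_nonsing_inv R hR
  have hRPx : ∀ x i, (R *ᵥ (R⁻¹ *ᵥ x)) i = x i := by
    intro x i
    rw [mulVec_mulVec, hRP, one_mulVec]
  have hPe : R⁻¹ *ᵥ ![0, 0, 1] = e := by
    have : R *ᵥ e = ![0, 0, 1] := by
      funext i
      fin_cases i
      exacts [hl0, hn0, hre]
    rw [← this, mulVec_mulVec, nonsing_inv_mul R hR, one_mulVec]
  set P := R⁻¹ with hP
  have hPs : (Pᵀ * A * P).IsSymm := by
    unfold IsSymm
    rw [transpose_mul, transpose_mul, transpose_transpose, hA.eq, Matrix.mul_assoc]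
  have hPCs : (Pᵀ * C * P).IsSymm := by
    unfold IsSymm
    rw [transpose_mul, transpose_mul, transpose_transpose, hC.eq, Matrix.mul_assoc]
  have hcol : ∀ i, (Pᵀ * A * P) i 2 = w * (![0, 0, 1] : Fin 3 → ℚ) i := by
    intro i
    have h1 : (Pᵀ * A * P) *ᵥ ![0, 0, 1] = w • (![0, 0, 1] : Fin 3 → ℚ) := by
      rw [← mulVec_mulVec, hPe, ← mulVec_mulVec,
        show A *ᵥ e = w • r by simp [r, smul_smul, mul_inv_cancel₀ hAe], mulVec_smul]
      congr 1
      have h2 : r = Rᵀ *ᵥ ![0, 0, 1] := by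
        funext i
        simp [mulVec, dotProduct, Fin.sum_univ_three, R]
      rw [h2, mulVec_mulVec, ← transpose_mul, hRP, transpose_one, one_mulVec]
    have := congrFun h1 i
    simpa [mulVec, dotProduct, Fin.sum_univ_three] using this
  refine ⟨P, w, (Pᵀ * A * P) 0 0, (Pᵀ * A * P) 1 1, (Pᵀ * A * P) 0 1, ?_, ?_, ?_⟩
  · rw [hP]
    exact isUnit_nonsing_inv_det R hR
  · have h0 := hcol 0
    have h1 := hcol 1
    have h2 := hcol 2
    simp at h0 h1 h2
    have s1 := hPs.apply 0 1
    have s2 := hPs.apply 0 2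
    have s3 := hPs.apply 1 2
    ext i j
    fin_cases i <;> fin_cases j <;> simp <;> linarith
  · refine eq_of_quadVal_eq hPCs ?_ fun x => ?_
    · ext i j
      fin_cases i <;> fin_cases j <;> simp
    · rw [quadVal_transpose_mul_mul, hln]
      have e0 : l ⬝ᵥ (P *ᵥ x) = x 0 := hRPx x 0
      have e1 : n ⬝ᵥ (P *ᵥ x) = x 1 := hRPx x 1
      rw [e0, e1]
      simp [quadVal, dotProduct, mulVec, Fin.sum_univ_three]
      ring
end

section
open Polynomial

/-- The coefficients of a split normal form of the pencil of `A` and `B`, whose other two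
degenerate members are given by the roots of `g`. -/
structure IsNormalForm (A B : Matrix (Fin 3) (Fin 3) ℚ) (a : ℚ) (g : ℚ[X])
    (w u v c : ℚ) : Prop where
  w_ne : w ≠ 0
  disc_ne : u * v - c ^ 2 ≠ 0
  u_nsq : ¬ IsSquare (-u / w)
  v_nsq : ¬ IsSquare (-v / w)
  eval_g : ∀ t, g.eval t * (u * v - c ^ 2) =
    (t - a) ^ 2 * (u * v - c ^ 2) - (t - a) * c - 1 / 4
  exists_coords : ∀ V : Fin 3 → ℚ, V ≠ 0 → ∃ x y z : ℚ, ¬ (x = 0 ∧ y = 0 ∧ z = 0) ∧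
    quadVal A V = w * z ^ 2 + u * x ^ 2 + v * y ^ 2 + 2 * c * x * y ∧
    a * quadVal A V - quadVal B V = x * y
  exists_vector : ∀ x y z : ℚ, ¬ (x = 0 ∧ y = 0 ∧ z = 0) → ∃ V : Fin 3 → ℚ, V ≠ 0 ∧
    quadVal A V = w * z ^ 2 + u * x ^ 2 + v * y ^ 2 + 2 * c * x * y ∧
    a * quadVal A V - quadVal B V = x * y

theorem exists_isNormalForm {A B : Matrix (Fin 3) (Fin 3) ℚ} (hA : A.IsSymm) (hB : B.IsSymm)
    (han : ∀ x, quadVal A x = 0 → quadVal B x = 0 → x = 0) (hdA : A.det ≠ 0) {a : ℚ}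
    (hs : IsSplitMember A B a) {g : ℚ[X]} (hg : g.Monic) (hg2 : g.natDegree = 2)
    (hfg : pencilPoly A B = (X - C a) * g) (hga : g.eval a ≠ 0) :
    ∃ w u v c, IsNormalForm A B a g w u v c := by
  obtain ⟨P, w, u, v, c, hP, hPA, hPC⟩ := exists_split_normal_form hA hB han hs (by
    rw [trace_adjugate_smul_sub hdA, hfg, derivative_mul]
    simpa using ⟨hdA, hga⟩)
  have hP0 : P.det ≠ 0 := hP.ne_zero
  have hvalA : ∀ x, quadVal A (P *ᵥ x) =
      w * x 2 ^ 2 + u * x 0 ^ 2 + v * x 1 ^ 2 + 2 * c * x 0 * x 1 := by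
    intro x
    rw [← quadVal_transpose_mul_mul, hPA]
    simp [quadVal, dotProduct, mulVec, Fin.sum_univ_three]
    ring
  have hvalC : ∀ x, a * quadVal A (P *ᵥ x) - quadVal B (P *ᵥ x) = x 0 * x 1 := by
    intro x
    have h1 := quadVal_transpose_mul_mul (a • A - B) P x
    have h2 := quadVal_smul_sub A B a 1 (P *ᵥ x)
    rw [one_smul, one_mul] at h2
    rw [hPC, h2] at h1
    rw [← h1]
    simp [quadVal, dotProduct, mulVec, Fin.sum_univ_three]
    ring
  have hdet : P.det ^ 2 * A.det = w * (u * v - c ^ 2) := by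
    have h1 : (!![u, c, 0; c, v, 0; 0, 0, w]).det = w * (u * v - c ^ 2) := by
      rw [det_fin_three]
      simp
      ring
    rw [← h1, ← hPA, det_mul, det_mul, det_transpose]
    ring
  have hw : w * (u * v - c ^ 2) ≠ 0 := by
    rw [← hdet]
    exact mul_ne_zero (pow_ne_zero _ hP0) hdA
  have hw0 := left_ne_zero_of_mul hw
  have hvec : ∀ x y z : ℚ, ¬ (x = 0 ∧ y = 0 ∧ z = 0) → ∃ V : Fin 3 → ℚ, V ≠ 0 ∧
      quadVal A V = w * z ^ 2 + u * x ^ 2 + v * y ^ 2 + 2 * c * x * y ∧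
      a * quadVal A V - quadVal B V = x * y := by
    intro x y z hxyz
    refine ⟨P *ᵥ ![x, y, z], fun h => ?_, hvalA _, hvalC _⟩
    have h1 := congrArg (P⁻¹ *ᵥ ·) h
    simp only [mulVec_mulVec, nonsing_inv_mul P hP, one_mulVec, mulVec_zero] at h1
    exact hxyz ⟨congrFun h1 0, congrFun h1 1, congrFun h1 2⟩
  have hgt : ∀ t, (t - a) * (g.eval t * (u * v - c ^ 2)) =
      (t - a) * ((t - a) ^ 2 * (u * v - c ^ 2) - (t - a) * c - 1 / 4) := by
    intro t
    have h1 : Pᵀ * (t • A - B) * P = (t - a) • !![u, c, 0; c, v, 0; 0, 0, w] +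
        !![0, 1 / 2, 0; 1 / 2, 0, 0; 0, 0, 0] := by
      rw [← hPA, ← hPC]
      rw [show t • A - B = (t - a) • A + (a • A - B) by rw [sub_smul]; abel, Matrix.mul_add,
        Matrix.add_mul, mul_smul_comm, smul_mul_assoc]
    have h2 := congrArg det h1
    have h3 : ((t - a) • !![u, c, 0; c, v, 0; 0, 0, w] +
        !![0, 1 / 2, 0; 1 / 2, 0, 0; 0, 0, 0]).det =
        w * (t - a) * ((t - a) ^ 2 * (u * v - c ^ 2) - (t - a) * c - 1 / 4) := by
      rw [det_fin_three]
      simp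
      ring
    rw [h3, det_mul, det_mul, det_transpose, det_smul_sub hdA, hfg, eval_mul, eval_sub, eval_X,
      eval_C] at h2
    apply mul_left_cancel₀ hw0
    linear_combination h2 - (t - a) * g.eval t * hdet
  have hgeq : g = X ^ 2 + C (g.coeff 1) * X + C (g.coeff 0) := by
    conv_lhs => rw [g.as_sum_range_C_mul_X_pow, hg2]
    have : g.coeff 2 = 1 := by rw [← hg2]; exact hg
    simp [Finset.sum_range_succ, this]
    ring
  have hev : ∀ t, g.eval t = t ^ 2 + g.coeff 1 * t + g.coeff 0 := by
    intro t
    conv_lhs => rw [hgeq]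
    simp
  refine ⟨w, u, v, c, hw0, right_ne_zero_of_mul hw, ?_, ?_, fun t => ?_, fun V hV => ?_, hvec⟩
  · rintro ⟨r, hr⟩
    obtain ⟨V, hV, h1, h2⟩ := hvec 1 0 r (by simp)
    have h3 : quadVal A V = 0 := by
      rw [h1]; field_simp at hr; linear_combination -hr
    exact hV (han V h3 (by rw [h3] at h2; linear_combination -h2))
  · rintro ⟨r, hr⟩
    obtain ⟨V, hV, h1, h2⟩ := hvec 0 1 r (by simp)
    have h3 : quadVal A V = 0 := by
      rw [h1]; field_simp at hr; linear_combination -hr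
    exact hV (han V h3 (by rw [h3] at h2; linear_combination -h2))
  · have h1 := hgt (a + 1)
    have h2 := hgt (a - 1)
    rw [hev] at h1 h2 ⊢
    linear_combination ((t - a + 1) / 2) * h1 - ((1 - (t - a)) / 2) * h2
  · have hPV : P *ᵥ (P⁻¹ *ᵥ V) = V := by rw [mulVec_mulVec, mul_nonsing_inv P hP, one_mulVec]
    refine ⟨(P⁻¹ *ᵥ V) 0, (P⁻¹ *ᵥ V) 1, (P⁻¹ *ᵥ V) 2, ?_, ?_, ?_⟩
    · rintro ⟨h0, h1, h2⟩
      apply hV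
      rw [← hPV, show P⁻¹ *ᵥ V = 0 from by funext i; fin_cases i <;> assumption, mulVec_zero]
    · rw [← hvalA, hPV]
    · rw [← hvalC, hPV]

/-- Simultaneous representations of two pencils in split normal form. -/
theorem RepPair.exists_of_normalForm {A₁ B₁ A₂ B₂ : Matrix (Fin 3) (Fin 3) ℚ}
    (h : RepPair A₁ B₁ A₂ B₂) {a b w u v c w' u' v' c' : ℚ} {g g' : ℚ[X]}
    (h₁ : IsNormalForm A₁ B₁ a g w u v c) (h₂ : IsNormalForm A₂ B₂ b g' w' u' v' c')
    (x' y' z' : ℚ) (h0 : ¬ (x' = 0 ∧ y' = 0 ∧ z' = 0)) :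
    ∃ x y z : ℚ, ¬ (x = 0 ∧ y = 0 ∧ z = 0) ∧
      w * z ^ 2 + u * x ^ 2 + v * y ^ 2 + 2 * c * x * y =
        w' * z' ^ 2 + u' * x' ^ 2 + v' * y' ^ 2 + 2 * c' * x' * y' ∧
      x * y = x' * y' + (a - b) * (w' * z' ^ 2 + u' * x' ^ 2 + v' * y' ^ 2 + 2 * c' * x' * y') := by
  obtain ⟨V', hV', e1, e2⟩ := h₂.exists_vector x' y' z' h0
  obtain ⟨V, hV, hVA, hVB⟩ := h.rep₁ V' hV'
  obtain ⟨x, y, z, hxyz, e3, e4⟩ := h₁.exists_coords V hV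
  refine ⟨x, y, z, hxyz, ?_, ?_⟩
  · rw [← e3, ← e1, hVA]
  · rw [← e4, ← e2, ← e1, hVA, hVB]
    ring

end

theorem even_padicValRat_sq_sub {p : ℕ} [Fact p.Prime] {d : ℤ} (hd : ¬ IsSquare (d : ZMod p))
    {Y X : ℚ} (h0 : Y ^ 2 - d * X ^ 2 ≠ 0) : Even (padicValRat p (Y ^ 2 - d * X ^ 2)) := by
  obtain ⟨r, y, x, hr, hy, hx, hyx⟩ : ∃ (r : ℚ) (y x : ℤ), r ≠ 0 ∧ Y = r * y ∧ X = r * x ∧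
      IsCoprime y x := by
    have hYX : ¬ (Y.num * X.den = 0 ∧ X.num * Y.den = 0) := by
      rintro ⟨h1, h2⟩
      have h1 : Y = 0 := by simpa using h1
      have h2 : X = 0 := by simpa using h2
      simp [h1, h2] at h0
    have hg : (Int.gcd (Y.num * X.den) (X.num * Y.den) : ℚ) ≠ 0 := by
      rwa [Nat.cast_ne_zero, Ne, Int.gcd_eq_zero_iff]
    obtain ⟨y, x, hyx, h1, h2⟩ := Int.exists_gcd_one (m := Y.num * X.den) (n := X.num * Y.den)
      (Int.gcd_pos_iff.2 (by tauto))
    refine ⟨Int.gcd (Y.num * X.den) (X.num * Y.den) / (Y.den * X.den), y, x, ?_, ?_, ?_,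
      Int.isCoprime_iff_gcd_eq_one.2 hyx⟩
    · have := Y.den_ne_zero
      have := X.den_ne_zero
      positivity
    · have h1 := congrArg (Int.cast : ℤ → ℚ) h1
      push_cast at h1
      have := Y.den_ne_zero
      have := X.den_ne_zero
      conv_lhs => rw [← Y.num_div_den]
      field_simp
      linear_combination h1
    · have h1 := congrArg (Int.cast : ℤ → ℚ) h2
      push_cast at h1
      have := Y.den_ne_zero
      have := X.den_ne_zero
      conv_lhs => rw [← X.num_div_den]
      field_simp
      linear_combination h1
  have hp : Prime (p : ℤ) := Nat.prime_iff_prime_int.1 Fact.out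
  have hndvd : ¬ (p : ℤ) ∣ y ^ 2 - d * x ^ 2 := by
    intro h
    obtain ⟨h1, h2⟩ := dvd_of_mul_sq_add_sq (m := -d) (X := x) (Y := y) (by simpa using hd) (by
      rwa [show -d * x ^ 2 + y ^ 2 = y ^ 2 - d * x ^ 2 by ring])
    exact hp.not_isUnit (hyx.isUnit_of_dvd' h2 h1)
  have he : Y ^ 2 - d * X ^ 2 = r ^ 2 * ((y ^ 2 - d * x ^ 2 : ℤ) : ℚ) := by
    rw [hy, hx]; push_cast; ring
  have hne : ((y ^ 2 - d * x ^ 2 : ℤ) : ℚ) ≠ 0 := by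
    rw [Int.cast_ne_zero]
    rintro h
    exact hndvd (h ▸ dvd_zero _)
  rw [he, padicValRat.mul (pow_ne_zero _ hr) hne, padicValRat.pow, padicValRat.of_int,
    padicValInt.eq_zero_of_not_dvd hndvd]
  simp

/-- A binary form that is anisotropic modulo `p` does not represent numbers of odd valuation. -/
theorem false_of_binary_eq {p : ℕ} [Fact p.Prime] {w u k n : ℤ} (hw : ¬ (p : ℤ) ∣ w)
    (hk : ¬ (p : ℤ) ∣ k) (hd : ¬ IsSquare ((-u * w : ℤ) : ZMod p)) (hn : (p : ℤ) ∣ n)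
    (hn2 : ¬ (p : ℤ) ^ 2 ∣ n) {Z X : ℚ} (h : w * Z ^ 2 + u * X ^ 2 = k * n) : False := by
  have hn0 : n ≠ 0 := by rintro rfl; simp at hn2
  have hk0 : k ≠ 0 := by rintro rfl; simp at hk
  have hw0 : w ≠ 0 := by rintro rfl; simp at hw
  have e : (w * Z) ^ 2 - ((-u * w : ℤ) : ℚ) * X ^ 2 = w * k * n := by
    push_cast; linear_combination w * h
  have h1 := even_padicValRat_sq_sub hd (Y := w * Z) (X := X) (by rw [e]; positivity)
  obtain ⟨m, rfl⟩ := hn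
  have hm : ¬ (p : ℤ) ∣ m := fun ⟨t, ht⟩ => hn2 ⟨t, by rw [ht]; ring⟩
  have hm0 : m ≠ 0 := by rintro rfl; simp at hm
  have hp0 : p ≠ 0 := (Fact.out : p.Prime).ne_zero
  have hp1 : 1 < p := (Fact.out : p.Prime).one_lt
  rw [e, padicValRat.mul (by positivity) (by positivity), padicValRat.mul (by positivity)
    (by positivity), Int.cast_mul, padicValRat.mul (by positivity) (by positivity),
    padicValRat.of_int, padicValRat.of_int, padicValRat.of_int, padicValRat.of_int,
    padicValInt.eq_zero_of_not_dvd hm, padicValInt.eq_zero_of_not_dvd hk,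
    padicValInt.eq_zero_of_not_dvd hw] at h1
  simp [padicValInt.self hp1] at h1

theorem exists_lift_sq {p : ℕ} [Fact p.Prime] (hp2 : p ≠ 2) {w a : ℤ} (b : ℤ) (hw : ¬ (p : ℤ) ∣ w)
    (ha : ¬ (p : ℤ) ∣ a) (hs : IsSquare ((-a * w : ℤ) : ZMod p)) :
    ∃ z : ℤ, (p : ℤ) ^ 2 ∣ w * z ^ 2 + a + p * b ∧ ¬ (p : ℤ) ∣ z := by
  have hp : Prime (p : ℤ) := Nat.prime_iff_prime_int.1 Fact.out
  have h2 : ¬ (p : ℤ) ∣ 2 := by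
    intro h
    have := (Nat.prime_dvd_prime_iff_eq (Fact.out : p.Prime) Nat.prime_two).1 (by exact_mod_cast h)
    exact hp2 this
  have hw' : (w : ZMod p) ≠ 0 := by rwa [Ne, ZMod.intCast_zmod_eq_zero_iff_dvd]
  obtain ⟨r, hr⟩ := hs
  obtain ⟨z, hz⟩ := ZMod.intCast_surjective (r / (w : ZMod p))
  have h1 : (p : ℤ) ∣ w * z ^ 2 + a := by
    rw [← ZMod.intCast_zmod_eq_zero_iff_dvd]
    push_cast at hr ⊢
    rw [hz]
    field_simp
    linear_combination -hr
  have hz0 : ¬ (p : ℤ) ∣ z := by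
    intro h
    apply ha
    have := (dvd_add_right (Dvd.dvd.mul_left (dvd_pow h two_ne_zero) w)).1 h1
    exact this
  obtain ⟨m, hm⟩ := h1
  have hcop : IsCoprime (2 * w * z) (p : ℤ) := by
    rw [isCoprime_comm, Prime.coprime_iff_not_dvd hp]
    intro h
    rcases hp.dvd_or_dvd h with h | h
    · exact (hp.dvd_or_dvd h).elim h2 hw
    · exact hz0 h
  obtain ⟨s, t, hst⟩ := hcop
  refine ⟨z - p * (s * (m + b)), ⟨w * (s * (m + b)) ^ 2 + t * (m + b), ?_⟩, fun h => hz0 ?_⟩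
  · linear_combination hm - p * (m + b) * hst
  · have := dvd_add h (Dvd.intro (s * (m + b)) rfl : (p : ℤ) ∣ p * (s * (m + b)))
    simpa using this

/-- A point of a conic modulo `p ^ 2`, close to a point on a coordinate axis and not in the tangent
plane of a given point. -/
theorem exists_point_mod_sq {p : ℕ} [Fact p.Prime] (hp2 : p ≠ 2) {w u v l x₀ y₀ z₀ : ℤ}
    (hw : ¬ (p : ℤ) ∣ w) (hu : ¬ (p : ℤ) ∣ u) (hl : ¬ (p : ℤ) ∣ l ^ 2 - 4 * u * v)
    (hy : ¬ (p : ℤ) ∣ y₀) (hs : IsSquare ((-u * w : ℤ) : ZMod p))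
    (h0 : w * z₀ ^ 2 + u * x₀ ^ 2 + v * y₀ ^ 2 + l * x₀ * y₀ = 0) :
    ∃ z : ℤ, (p : ℤ) ^ 2 ∣ w * z ^ 2 + u + v * p ^ 2 + l * p ∧
      ¬ (p : ℤ) ∣ 2 * w * z₀ * z + 2 * u * x₀ + 2 * v * y₀ * p + l * (x₀ * p + y₀) := by
  have hp : Prime (p : ℤ) := Nat.prime_iff_prime_int.1 Fact.out
  obtain ⟨z, h1, h2⟩ := exists_lift_sq hp2 (v * p + l) hw hu hs
  by_contra! hcon
  have e1 := hcon z (by convert h1 using 1; ring)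
  have e2 := hcon (-z) (by convert h1 using 1; ring)
  obtain ⟨k1, hk1⟩ := e1
  obtain ⟨k2, hk2⟩ := e2
  obtain ⟨k3, hk3⟩ := h1
  have hprod : (p : ℤ) ∣ (l ^ 2 - 4 * u * v) * y₀ ^ 2 := by
    have e : (2 * w * z₀ * z + (2 * u * x₀ + l * y₀)) * (-(2 * w * z₀ * z) + (2 * u * x₀ + l * y₀))
      = (l ^ 2 - 4 * u * v) * y₀ ^ 2 - 4 * w * z₀ ^ 2 * (w * z ^ 2 + u) := by
      linear_combination 4 * u * h0
    have e1 : (p : ℤ) ∣ 2 * w * z₀ * z + (2 * u * x₀ + l * y₀) :=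
      ⟨k1 - (2 * v * y₀ + l * x₀), by linear_combination hk1⟩
    have e3 : (p : ℤ) ∣ w * z ^ 2 + u := ⟨p * k3 - (v * p + l), by linear_combination hk3⟩
    have := dvd_add (Dvd.dvd.mul_right e1 (-(2 * w * z₀ * z) + (2 * u * x₀ + l * y₀)))
      (Dvd.dvd.mul_left e3 (4 * w * z₀ ^ 2))
    rw [e] at this
    simpa using this
  rcases hp.dvd_or_dvd hprod with h | h
  · exact hl h
  · exact hy (hp.dvd_of_dvd_pow h)

theorem exists_local_point {p : ℕ} [Fact p.Prime] (hp2 : p ≠ 2) {w u v l x₀ y₀ z₀ : ℤ}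
    (hw : ¬ (p : ℤ) ∣ w) (hu : ¬ (p : ℤ) ∣ u) (hv : ¬ (p : ℤ) ∣ v)
    (hl : ¬ (p : ℤ) ∣ l ^ 2 - 4 * u * v) (hx : ¬ (p : ℤ) ∣ x₀) (hy : ¬ (p : ℤ) ∣ y₀)
    (hs : IsSquare ((-u * w : ℤ) : ZMod p) ∨ IsSquare ((-v * w : ℤ) : ZMod p))
    (h0 : w * z₀ ^ 2 + u * x₀ ^ 2 + v * y₀ ^ 2 + l * x₀ * y₀ = 0) :
    ∃ x y z : ℤ, (p : ℤ) ^ 2 ∣ x * y - p ∧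
      (p : ℤ) ^ 2 ∣ w * z ^ 2 + u * x ^ 2 + v * y ^ 2 + l * x * y ∧
      ¬ (p : ℤ) ∣ 2 * w * z₀ * z + 2 * u * x₀ * x + 2 * v * y₀ * y + l * (x₀ * y + y₀ * x) := by
  rcases hs with hs | hs
  · obtain ⟨z, h1, h2⟩ := exists_point_mod_sq hp2 hw hu hl hy hs h0
    refine ⟨1, p, z, by simp, by convert h1 using 1; ring, ?_⟩
    convert h2 using 2
    ring
  · obtain ⟨z, h1, h2⟩ := exists_point_mod_sq (v := u) (l := l) (x₀ := y₀) (y₀ := x₀) (z₀ := z₀)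
      hp2 hw hv (by convert hl using 2; ring) hx hs (by rw [← h0]; ring)
    refine ⟨p, 1, z, by simp, by convert h1 using 1; ring, ?_⟩
    convert h2 using 2
    ring

theorem exists_modEq_and_modEq {m n : ℤ} (h : IsCoprime m n) (a b : ℤ) :
    ∃ x : ℤ, x ≡ a [ZMOD m] ∧ x ≡ b [ZMOD n] := by
  obtain ⟨s, t, hst⟩ := h
  refine ⟨a * (t * n) + b * (s * m), ?_, ?_⟩
  · exact (Int.modEq_iff_dvd.2 ⟨s * (a - b), by linear_combination -a * hst⟩)
  · exact (Int.modEq_iff_dvd.2 ⟨t * (b - a), by linear_combination -b * hst⟩)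

theorem dvd_mul_of_local_point {p : ℤ} (hp : Prime p) {w u v l x₀ y₀ z₀ x₁ y₁ z₁ x y z : ℤ}
    (hxy : p ^ 2 ∣ x₁ * y₁ - p)
    (hq : p ^ 2 ∣ w * z₁ ^ 2 + u * x₁ ^ 2 + v * y₁ ^ 2 + l * x₁ * y₁)
    (hL : ¬ p ∣ 2 * w * z₀ * z₁ + 2 * u * x₀ * x₁ + 2 * v * y₀ * y₁ + l * (x₀ * y₁ + y₀ * x₁))
    (hx : x ≡ x₁ [ZMOD p ^ 2]) (hy : y ≡ y₁ [ZMOD p ^ 2]) (hz : z ≡ z₁ [ZMOD p ^ 2]) {L Q : ℤ}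
    (hQ : Q = w * z ^ 2 + u * x ^ 2 + v * y ^ 2 + l * x * y)
    (hLe : L = 2 * w * z₀ * z + 2 * u * x₀ * x + 2 * v * y₀ * y + l * (x₀ * y + y₀ * x)) :
    p ∣ (Q * x₀ - L * x) * (Q * y₀ - L * y) ∧ ¬ p ^ 2 ∣ (Q * x₀ - L * x) * (Q * y₀ - L * y) := by
  have h1 : x * y - p ≡ 0 [ZMOD p ^ 2] :=
    (by gcongr : x * y - p ≡ x₁ * y₁ - p [ZMOD p ^ 2]).trans (Int.modEq_zero_iff_dvd.2 hxy)
  have h2 : Q ≡ 0 [ZMOD p ^ 2] := by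
    rw [hQ]
    exact (by gcongr : _ ≡ w * z₁ ^ 2 + u * x₁ ^ 2 + v * y₁ ^ 2 + l * x₁ * y₁ [ZMOD p ^ 2]).trans
      (Int.modEq_zero_iff_dvd.2 hq)
  have h3 : L ≡ 2 * w * z₀ * z₁ + 2 * u * x₀ * x₁ + 2 * v * y₀ * y₁ + l * (x₀ * y₁ + y₀ * x₁)
      [ZMOD p ^ 2] := by rw [hLe]; gcongr
  have h4 : ¬ p ∣ L := by
    intro h
    apply hL
    exact (Int.ModEq.dvd_iff (h3.of_dvd (dvd_pow_self p two_ne_zero))).1 h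
  obtain ⟨m, hm⟩ := Int.modEq_zero_iff_dvd.1 h1
  obtain ⟨n, hn⟩ := Int.modEq_zero_iff_dvd.1 h2
  have e : (Q * x₀ - L * x) * (Q * y₀ - L * y) =
      p ^ 2 * (n * (x₀ * (Q * y₀ - L * y) - L * x * y₀) + L ^ 2 * m) + L ^ 2 * p := by
    rw [hn]
    linear_combination L ^ 2 * hm
  rw [e]
  refine ⟨⟨p * (n * (x₀ * (Q * y₀ - L * y) - L * x * y₀) + L ^ 2 * m) + L ^ 2, by ring⟩, ?_⟩
  rw [dvd_add_right (Dvd.intro _ rfl)]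
  rintro ⟨k, hk⟩
  refine h4 (hp.dvd_of_dvd_pow (n := 2) ⟨k, mul_right_cancel₀ hp.ne_zero ?_⟩)
  linear_combination hk

theorem isSquare_mul_of_isSquare_mul {p : ℕ} [Fact p.Prime] {d e d' e' : ℤ}
    (hd : ¬ IsSquare (d : ZMod p)) (he : IsSquare (e : ZMod p)) (he0 : ¬ (p : ℤ) ∣ e)
    (hs : IsSquare (d * e * (d' * e'))) :
    IsSquare (d' : ZMod p) ∨ IsSquare (e' : ZMod p) := by
  by_contra! hcon
  rw [← ZMod.intCast_zmod_eq_zero_iff_dvd] at he0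
  have hd0 : (d : ZMod p) ≠ 0 := by
    intro h
    exact hd ⟨0, by simp [h]⟩
  have h1 := legendreSym.eq_neg_one_iff p |>.2 hd
  have h2 := (legendreSym.eq_one_iff p he0).2 he
  have h3 := legendreSym.eq_neg_one_iff p |>.2 hcon.1
  have h4 := legendreSym.eq_neg_one_iff p |>.2 hcon.2
  obtain ⟨r, hr⟩ := hs
  have h5 := congrArg (legendreSym p) hr
  rw [legendreSym.mul, legendreSym.mul, legendreSym.mul, legendreSym.mul, h1, h2, h3, h4] at h5
  have h6 := mul_self_nonneg (legendreSym p r)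
  linarith

theorem false_of_not_isSquare_int {w u v k w' u' v' l x₀ y₀ z₀ : ℤ} (hw : w ≠ 0) (hu : u ≠ 0)
    (hv : v ≠ 0) (hk : k ≠ 0) (hw' : w' ≠ 0) (hu' : u' ≠ 0) (hv' : v' ≠ 0)
    (hd : ¬ IsSquare ((-u * w : ℤ) : ℚ)) (he : ¬ IsSquare ((-v * w : ℤ) : ℚ))
    (huv : ¬ IsSquare ((u * v : ℤ) : ℚ)) (hs : IsSquare (u * v * (u' * v')))
    (hl : l ^ 2 - 4 * u' * v' ≠ 0) (hx : x₀ ≠ 0) (hy : y₀ ≠ 0)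
    (h0 : w' * z₀ ^ 2 + u' * x₀ ^ 2 + v' * y₀ ^ 2 + l * x₀ * y₀ = 0)
    (H : ∀ x y z : ℤ, w' * z ^ 2 + u' * x ^ 2 + v' * y ^ 2 + l * x * y = 0 → x * y ≠ 0 →
      ∃ X Y Z : ℚ, X * Y = 0 ∧ w * Z ^ 2 + u * X ^ 2 + v * Y ^ 2 = k * (x * y)) : False := by
  have hde : ¬ IsSquare (((-u * w : ℤ) : ℚ) * ((-v * w : ℤ) : ℚ)) := by
    rintro ⟨r, hr⟩
    refine huv ⟨r / w, ?_⟩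
    have : (w : ℚ) ≠ 0 := by exact_mod_cast hw
    field_simp
    push_cast at hr ⊢
    linear_combination hr
  set N : ℤ := 2 * w * u * v * k * w' * u' * v' * (l ^ 2 - 4 * u' * v') * x₀ * y₀ with hN
  have hN0 : N ≠ 0 := by positivity
  have hgen : ∀ p : ℕ, N.natAbs < p → ∀ m : ℤ, m ∣ N → ¬ (p : ℤ) ∣ m := by
    intro p hlt m hm h
    have := Nat.le_of_dvd (Int.natAbs_pos.2 hN0) (Int.natCast_dvd.1 (h.trans hm))
    omega
  have hsq : IsSquare (-u * w * (-v * w) * (-u' * w' * (-v' * w'))) := by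
    obtain ⟨r, hr⟩ := hs
    exact ⟨r * w * w', by linear_combination w ^ 2 * w' ^ 2 * hr⟩
  have hloc : ∀ p : ℕ, p.Prime → N.natAbs < p →
      IsSquare ((-u' * w' : ℤ) : ZMod p) ∨ IsSquare ((-v' * w' : ℤ) : ZMod p) →
      ∃ x y z : ℤ, (p : ℤ) ^ 2 ∣ x * y - p ∧
        (p : ℤ) ^ 2 ∣ w' * z ^ 2 + u' * x ^ 2 + v' * y ^ 2 + l * x * y ∧
        ¬ (p : ℤ) ∣ 2 * w' * z₀ * z + 2 * u' * x₀ * x + 2 * v' * y₀ * y +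
          l * (x₀ * y + y₀ * x) := by
    intro p hp hlt hor
    have : Fact p.Prime := ⟨hp⟩
    refine exists_local_point ?_ (hgen p hlt _ ?_) (hgen p hlt _ ?_) (hgen p hlt _ ?_)
      (hgen p hlt _ ?_) (hgen p hlt _ ?_) (hgen p hlt _ ?_) hor h0
    · rintro rfl
      exact hgen 2 hlt 2 (by rw [hN]; simp only [mul_assoc]; exact Dvd.intro _ rfl) dvd_rfl
    all_goals rw [hN]
    · exact ⟨2 * w * u * v * k * u' * v' * (l ^ 2 - 4 * u' * v') * x₀ * y₀, by ring⟩
    · exact ⟨2 * w * u * v * k * w' * v' * (l ^ 2 - 4 * u' * v') * x₀ * y₀, by ring⟩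
    · exact ⟨2 * w * u * v * k * w' * u' * (l ^ 2 - 4 * u' * v') * x₀ * y₀, by ring⟩
    · exact ⟨2 * w * u * v * k * w' * u' * v' * x₀ * y₀, by ring⟩
    · exact ⟨2 * w * u * v * k * w' * u' * v' * (l ^ 2 - 4 * u' * v') * y₀, by ring⟩
    · exact ⟨2 * w * u * v * k * w' * u' * v' * (l ^ 2 - 4 * u' * v') * x₀, by ring⟩
  have hwN : w ∣ N := ⟨2 * u * v * k * w' * u' * v' * (l ^ 2 - 4 * u' * v') * x₀ * y₀, by
    rw [hN]; ring⟩
  have huN : u ∣ N := ⟨2 * w * v * k * w' * u' * v' * (l ^ 2 - 4 * u' * v') * x₀ * y₀, by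
    rw [hN]; ring⟩
  have hvN : v ∣ N := ⟨2 * w * u * k * w' * u' * v' * (l ^ 2 - 4 * u' * v') * x₀ * y₀, by
    rw [hN]; ring⟩
  have hkN : k ∣ N := ⟨2 * w * u * v * w' * u' * v' * (l ^ 2 - 4 * u' * v') * x₀ * y₀, by
    rw [hN]; ring⟩
  obtain ⟨p, hp, hNp, hpd, hpe⟩ := exists_prime_not_isSquare_isSquare _ _ hd hde N.natAbs
  obtain ⟨q, hq, hNq, hqe, hqd⟩ := exists_prime_not_isSquare_isSquare _ _ he
    (by rwa [mul_comm]) (max N.natAbs p)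
  have hpq : p ≠ q := by
    have := le_max_right N.natAbs p
    omega
  replace hNq := (le_max_left _ _).trans_lt hNq
  have : Fact p.Prime := ⟨hp⟩
  have : Fact q.Prime := ⟨hq⟩
  have hp' := Nat.prime_iff_prime_int.1 hp
  have hq' := Nat.prime_iff_prime_int.1 hq
  have hndvd : ∀ r : ℤ, Prime r → ¬ r ∣ w → ∀ a : ℤ, ¬ r ∣ a → ¬ r ∣ -a * w := by
    intro r hr h1 a h2 h
    rcases hr.dvd_or_dvd h with h | h
    · exact h2 (dvd_neg.1 h)
    · exact h1 h
  obtain ⟨x₁, y₁, z₁, a1, a2, a3⟩ := hloc p hp hNp (isSquare_mul_of_isSquare_mul hpd hpe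
    (hndvd p hp' (hgen p hNp _ hwN) v (hgen p hNp _ hvN)) hsq)
  obtain ⟨x₂, y₂, z₂, b1, b2, b3⟩ := hloc q hq hNq (isSquare_mul_of_isSquare_mul hqe hqd
    (hndvd q hq' (hgen q hNq _ hwN) u (hgen q hNq _ huN)) (by rwa [mul_comm (-v * w)]))
  have hcop : IsCoprime ((p : ℤ) ^ 2) ((q : ℤ) ^ 2) :=
    (Nat.isCoprime_iff_coprime.2 ((Nat.coprime_primes hp hq).2 hpq)).pow
  obtain ⟨x, hx1, hx2⟩ := exists_modEq_and_modEq hcop x₁ x₂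
  obtain ⟨y, hy1, hy2⟩ := exists_modEq_and_modEq hcop y₁ y₂
  obtain ⟨z, hz1, hz2⟩ := exists_modEq_and_modEq hcop z₁ z₂
  obtain ⟨Q, hQ⟩ : ∃ Q, Q = w' * z ^ 2 + u' * x ^ 2 + v' * y ^ 2 + l * x * y := ⟨_, rfl⟩
  obtain ⟨L, hL⟩ : ∃ L, L = 2 * w' * z₀ * z + 2 * u' * x₀ * x + 2 * v' * y₀ * y +
    l * (x₀ * y + y₀ * x) := ⟨_, rfl⟩
  obtain ⟨c1, c2⟩ := dvd_mul_of_local_point hp' a1 a2 a3 hx1 hy1 hz1 hQ hL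
  obtain ⟨d1, d2⟩ := dvd_mul_of_local_point hq' b1 b2 b3 hx2 hy2 hz2 hQ hL
  obtain ⟨X, Y, Z, hXY, hval⟩ := H (Q * x₀ - L * x) (Q * y₀ - L * y) (Q * z₀ - L * z)
    (by rw [hL]; linear_combination Q ^ 2 * h0 - (2 * w' * z₀ * z + 2 * u' * x₀ * x +
      2 * v' * y₀ * y + l * (x₀ * y + y₀ * x)) ^ 2 * hQ)
    (fun h => c2 (by rw [h]; exact dvd_zero _))
  norm_cast at hval
  rcases mul_eq_zero.1 hXY with rfl | rfl
  · exact false_of_binary_eq (p := q) (Z := Z) (X := Y) (hgen q hNq _ hwN) (hgen q hNq _ hkN)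
      hqe d1 d2
      (by push_cast at hval ⊢; linear_combination hval)
  · exact false_of_binary_eq (p := p) (Z := Z) (X := X) (hgen p hNp _ hwN) (hgen p hNp _ hkN)
      hpd c1 c2
      (by push_cast at hval ⊢; linear_combination hval)

theorem exists_int_mul_eq (a b c d : ℚ) : ∃ m A B C D : ℤ, m ≠ 0 ∧ m * a = A ∧ m * b = B ∧
    m * c = C ∧ m * d = D := by
  have ha := a.den_ne_zero
  have hb := b.den_ne_zero
  have hc := c.den_ne_zero
  have hd := d.den_ne_zero
  refine ⟨a.den * b.den * c.den * d.den, a.num * b.den * c.den * d.den,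
    b.num * a.den * c.den * d.den, c.num * a.den * b.den * d.den, d.num * a.den * b.den * c.den,
    by positivity, ?_, ?_, ?_, ?_⟩
  · push_cast
    linear_combination (b.den * c.den * d.den : ℚ) * a.mul_den_eq_num
  · push_cast
    linear_combination (a.den * c.den * d.den : ℚ) * b.mul_den_eq_num
  · push_cast
    linear_combination (a.den * b.den * d.den : ℚ) * c.mul_den_eq_num
  · push_cast
    linear_combination (a.den * b.den * c.den : ℚ) * d.mul_den_eq_num

theorem isSquare_neg_div {w u m : ℚ} (hw : w ≠ 0) (hm : m ≠ 0)
    (h : IsSquare (-(m * u) * (m * w))) : IsSquare (-u / w) := by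
  obtain ⟨r, hr⟩ := h
  refine ⟨r / (m * w), ?_⟩
  field_simp
  linear_combination hr

theorem false_of_not_isSquare {w u v k w' u' v' l x₀ y₀ z₀ : ℚ} (hw : w ≠ 0) (hk : k ≠ 0)
    (hw' : w' ≠ 0) (hu : ¬ IsSquare (-u / w)) (hv : ¬ IsSquare (-v / w))
    (hu' : ¬ IsSquare (-u' / w')) (hv' : ¬ IsSquare (-v' / w')) (huv : ¬ IsSquare (u * v))
    (hs : IsSquare (u * v * (u' * v'))) (hl : l ^ 2 - 4 * u' * v' ≠ 0)
    (hxyz : ¬ (x₀ = 0 ∧ y₀ = 0 ∧ z₀ = 0))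
    (h0 : w' * z₀ ^ 2 + u' * x₀ ^ 2 + v' * y₀ ^ 2 + l * x₀ * y₀ = 0)
    (H : ∀ x y z : ℚ, w' * z ^ 2 + u' * x ^ 2 + v' * y ^ 2 + l * x * y = 0 → x * y ≠ 0 →
      ∃ X Y Z : ℚ, X * Y = 0 ∧ w * Z ^ 2 + u * X ^ 2 + v * Y ^ 2 = k * (x * y)) : False := by
  have hn0 : ∀ {s t : ℚ}, ¬ IsSquare (-s / t) → s ≠ 0 := by
    rintro s t h rfl
    exact h ⟨0, by simp⟩
  have hz : ∀ s t x : ℚ, s ≠ 0 → ¬ IsSquare (-t / s) → s * z₀ ^ 2 + t * x ^ 2 = 0 →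
      x = 0 ∧ z₀ = 0 := by
    intro s t x h1 h2 h3
    have hx : x = 0 := by
      by_contra hx
      exact h2 ⟨z₀ / x, by field_simp; linear_combination -h3⟩
    rw [hx] at h3
    exact ⟨hx, by simpa [h1] using h3⟩
  have hy0 : y₀ ≠ 0 := by
    rintro rfl
    have := hz w' u' x₀ hw' hu' (by linear_combination h0)
    exact hxyz ⟨this.1, rfl, this.2⟩
  have hx0 : x₀ ≠ 0 := by
    rintro rfl
    have := hz w' v' y₀ hw' hv' (by linear_combination h0)
    exact hxyz ⟨rfl, this.1, this.2⟩
  have hu0 := hn0 hu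
  have hv0 := hn0 hv
  have hu0' := hn0 hu'
  have hv0' := hn0 hv'
  obtain ⟨m, W, U, V, K, hm, eW, eU, eV, eK⟩ := exists_int_mul_eq w u v k
  obtain ⟨n, W', U', V', M, hn, eW', eU', eV', eM⟩ := exists_int_mul_eq w' u' v' l
  obtain ⟨r, X₀, Y₀, Z₀, -, hr, eX, eY, eZ, -⟩ := exists_int_mul_eq x₀ y₀ z₀ 0
  have hm' : (m : ℚ) ≠ 0 := by exact_mod_cast hm
  have hn' : (n : ℚ) ≠ 0 := by exact_mod_cast hn
  have hr' : (r : ℚ) ≠ 0 := by exact_mod_cast hr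
  have hInt : ∀ {s t : ℚ} {S : ℤ}, t ≠ 0 → s ≠ 0 → t * s = S → S ≠ 0 := by
    rintro s t S h1 h2 h3 rfl
    rw [Int.cast_zero] at h3
    exact (mul_ne_zero h1 h2) h3
  refine false_of_not_isSquare_int (w := W) (u := U) (v := V) (k := K) (w' := W') (u' := U')
    (v' := V') (l := M) (x₀ := X₀) (y₀ := Y₀) (z₀ := Z₀) (hInt hm' hw eW) (hInt hm' hu0 eU)
    (hInt hm' hv0 eV) (hInt hm' hk eK) (hInt hn' hw' eW') (hInt hn' hu0' eU') (hInt hn' hv0' eV')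
    ?_ ?_ ?_ ?_ ?_ (hInt hr' hx0 eX) (hInt hr' hy0 eY) ?_ ?_
  · push_cast
    rw [← eU, ← eW]
    exact fun h => hu (isSquare_neg_div hw hm' h)
  · push_cast
    rw [← eV, ← eW]
    exact fun h => hv (isSquare_neg_div hw hm' h)
  · push_cast
    rw [← eU, ← eV]
    rintro ⟨s, hs⟩
    refine huv ⟨s / m, ?_⟩
    field_simp
    linear_combination hs
  · rw [← Rat.isSquare_intCast_iff]
    push_cast
    rw [← eU, ← eV, ← eU', ← eV']
    obtain ⟨s, hs⟩ := hs
    exact ⟨m * n * s, by linear_combination (m * n : ℚ) ^ 2 * hs⟩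
  · rw [← Int.cast_ne_zero (α := ℚ)]
    push_cast
    rw [← eU', ← eV', ← eM, show (n * l) ^ 2 - 4 * (n * u') * (n * v') =
      n ^ 2 * (l ^ 2 - 4 * u' * v') by ring]
    positivity
  · rw [← Int.cast_inj (α := ℚ)]
    push_cast
    rw [← eU', ← eV', ← eM, ← eW', ← eX, ← eY, ← eZ]
    linear_combination n * r ^ 2 * h0
  · intro x y z h1 h2
    obtain ⟨X, Y, Z, hXY, h3⟩ := H x y z (by
      have h1 := congrArg (Int.cast : ℤ → ℚ) h1
      push_cast at h1
      rw [← eU', ← eV', ← eM, ← eW'] at h1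
      apply mul_left_cancel₀ hn'
      linear_combination h1) (by exact_mod_cast h2)
    exact ⟨X, Y, Z, hXY, by rw [← eU, ← eV, ← eK, ← eW]; linear_combination m * h3⟩

section
open Polynomial

section
variable {A₁ B₁ A₂ B₂ : Matrix (Fin 3) (Fin 3) ℚ} {a b w u v c w' u' v' c' : ℚ} {g : ℚ[X]}

theorem IsNormalForm.discrim_eq (h₁ : IsNormalForm A₁ B₁ a g w u v c)
    (h₂ : IsNormalForm A₂ B₂ b g w' u' v' c') :
    u * v * (u' * v' - c' ^ 2) ^ 2 = u' * v' * (u * v - c ^ 2) ^ 2 := by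
  have hD : ∀ {A B : Matrix (Fin 3) (Fin 3) ℚ} {a w u v c : ℚ}, IsNormalForm A B a g w u v c →
      u * v = (u * v - c ^ 2) ^ 2 * (((g.eval 1 - g.eval (-1)) / 2) ^ 2 - 4 * g.eval 0) := by
    intro A B a w u v c h
    have hd := h.disc_ne
    have e := fun t => eq_div_of_mul_eq hd (h.eval_g t)
    rw [e, e, e]
    field_simp
    ring
  linear_combination (u' * v' - c' ^ 2) ^ 2 * hD h₁ - (u * v - c ^ 2) ^ 2 * hD h₂

theorem RepPair.isSquare_of_normalForm (h : RepPair A₁ B₁ A₂ B₂) (hab : a ≠ b)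
    (h₁ : IsNormalForm A₁ B₁ a g w u v c) (h₂ : IsNormalForm A₂ B₂ b g w' u' v' c')
    (hga : g.eval a ≠ 0) : IsSquare (u * v) := by
  by_contra huv
  have hs : a - b ≠ 0 := sub_ne_zero.2 hab
  obtain ⟨x₀, y₀, z₀, hxyz, e1, e2⟩ := h.symm.exists_of_normalForm h₂ h₁ 1 0 0 (by simp)
  have hd := h₁.disc_ne
  have hd' := h₂.disc_ne
  refine false_of_not_isSquare (l := 2 * c' + 1 / (a - b)) (k := -1 / (a - b)) h₁.w_ne ?_ h₂.w_ne
    h₁.u_nsq h₁.v_nsq h₂.u_nsq h₂.v_nsq huv ?_ ?_ hxyz ?_ ?_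
  · exact div_ne_zero (by norm_num) hs
  · refine ⟨u * v * (u' * v' - c' ^ 2) / (u * v - c ^ 2), ?_⟩
    have := h₁.discrim_eq h₂
    field_simp
    linear_combination - u * v * this
  · have e := h₂.eval_g a
    rw [show (2 * c' + 1 / (a - b)) ^ 2 - 4 * u' * v' =
      -4 / (a - b) ^ 2 * (g.eval a * (u' * v' - c' ^ 2)) by rw [e]; field_simp; ring]
    exact mul_ne_zero (div_ne_zero (by norm_num) (pow_ne_zero _ hs)) (mul_ne_zero hga hd')
  · rw [← e1] at e2
    field_simp
    linear_combination e2
  · intro x y z e3 e4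
    obtain ⟨X, Y, Z, -, e5, e6⟩ := h.exists_of_normalForm h₁ h₂ x y z (by
      rintro ⟨rfl, rfl, rfl⟩
      simp at e4)
    have e7 : w' * z ^ 2 + u' * x ^ 2 + v' * y ^ 2 + 2 * c' * x * y = -1 / (a - b) * (x * y) := by
      linear_combination e3
    have e8 : X * Y = 0 := by
      rw [e6, e7]
      field_simp
      ring
    refine ⟨X, Y, Z, e8, ?_⟩
    rw [← e7, ← e5]
    linear_combination -2 * c * e8

end

end

theorem isSquare_zmod_of_forall_prime {q : ℕ} [Fact q.Prime] (h1 : IsSquare (-1 : ZMod q)) {u : ℤ}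
    (hu : u ≠ 0) (h : ∀ r : ℕ, r.Prime → (r : ℤ) ∣ u →
      IsSquare (r : ZMod q) ∨ Even (padicValInt r u)) : IsSquare (u : ZMod q) := by
  have hnat : IsSquare (u.natAbs : ZMod q) := by
    rw [← Nat.prod_factorization_pow_eq_self (Int.natAbs_ne_zero.2 hu), Finsupp.prod, Nat.cast_prod]
    refine Finset.isSquare_prod _ fun r hr => ?_
    have hr' := Nat.prime_of_mem_primeFactors hr
    rw [Nat.cast_pow]
    rcases h r hr' (Int.natCast_dvd.2 (Nat.dvd_of_mem_primeFactors hr)) with h | h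
    · exact h.pow _
    · rw [padicValInt, ← Nat.factorization_def _ hr'] at h
      exact h.isSquare_pow _
  rcases Int.natAbs_eq u with h | h
  · rw [h, Int.cast_natCast]
    exact hnat
  · rw [h, Int.cast_neg, Int.cast_natCast, ← neg_one_mul]
    exact h1.mul hnat

theorem even_padicValInt_of_mul_eq {r : ℕ} [Fact r.Prime] {x s t y : ℤ} (hx : x ≠ 0)
    (hs : ¬ (r : ℤ) ∣ s) (ht : ¬ (r : ℤ) ∣ t) (h : x * s = t * y ^ 2) :
    Even (padicValInt r x) := by
  have hs0 : s ≠ 0 := by rintro rfl; simp at hs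
  have ht0 : t ≠ 0 := by rintro rfl; simp at ht
  have hy0 : y ≠ 0 := by
    rintro rfl
    simp [hx, hs0] at h
  have h1 := congrArg (padicValInt r) h
  rw [padicValInt.mul hx hs0, padicValInt.mul ht0 (pow_ne_zero _ hy0), sq,
    padicValInt.mul hy0 hy0, padicValInt.eq_zero_of_not_dvd hs,
    padicValInt.eq_zero_of_not_dvd ht] at h1
  exact ⟨padicValInt r y, by omega⟩

theorem exists_primitive_integers (a b c : ℚ) : ∃ A B C h : ℤ, h ≠ 0 ∧ h * a = A ∧ h * b = B ∧
    h * c = C ∧ ∀ r : ℕ, r.Prime → (r : ℤ) ∣ A → (r : ℤ) ∣ B → (r : ℤ) ∣ C → ¬ (r : ℤ) ∣ h := by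
  obtain ⟨m, A, B, C, -, hm, hA, hB, hC, -⟩ := exists_int_mul_eq a b c 0
  have hex : ∃ n : ℕ, ∃ A B C h : ℤ, h ≠ 0 ∧ h * a = A ∧ h * b = B ∧ h * c = C ∧ h.natAbs = n :=
    ⟨_, A, B, C, m, hm, hA, hB, hC, rfl⟩
  classical
  obtain ⟨A, B, C, h, hh, hA, hB, hC, hn⟩ := Nat.find_spec hex
  refine ⟨A, B, C, h, hh, hA, hB, hC, ?_⟩
  rintro r hr ⟨A', rfl⟩ ⟨B', rfl⟩ ⟨C', rfl⟩ ⟨h', rfl⟩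
  have hr0 : (r : ℚ) ≠ 0 := by exact_mod_cast hr.ne_zero
  have hh' : h' ≠ 0 := right_ne_zero_of_mul hh
  refine Nat.find_min hex (m := h'.natAbs) ?_ ⟨A', B', C', h', hh', ?_, ?_, ?_, rfl⟩
  · rw [← hn, Int.natAbs_mul, Int.natAbs_natCast]
    exact lt_mul_of_one_lt_left (Int.natAbs_pos.2 hh') hr.one_lt
  · apply mul_left_cancel₀ hr0; push_cast at hA; linear_combination hA
  · apply mul_left_cancel₀ hr0; push_cast at hB; linear_combination hB
  · apply mul_left_cancel₀ hr0; push_cast at hC; linear_combination hC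

/-- All the prime factors of `n` are nonzero squares modulo `q`. -/
def IsSmooth (q : ℕ) (n : ℤ) : Prop :=
  n ≠ 0 ∧ ∀ r : ℕ, r.Prime → (r : ℤ) ∣ n → r ≠ q ∧ IsSquare (r : ZMod q)

namespace IsSmooth
variable {q : ℕ} [Fact q.Prime] {n : ℤ}

theorem not_dvd (h : IsSmooth q n) : ¬ (q : ℤ) ∣ n := fun h' => (h.2 q Fact.out h').1 rfl

theorem cast_ne_zero (h : IsSmooth q n) : (n : ZMod q) ≠ 0 := by
  rw [Ne, ZMod.intCast_zmod_eq_zero_iff_dvd]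
  exact h.not_dvd

theorem isSquare (h1 : IsSquare (-1 : ZMod q)) (h : IsSmooth q n) : IsSquare (n : ZMod q) :=
  isSquare_zmod_of_forall_prime h1 h.1 fun r hr hn => Or.inl (h.2 r hr hn).2

end IsSmooth

theorem exists_sign {q : ℕ} [Fact q.Prime] {x y : ℤ} (h : (q : ℤ) ∣ x ^ 2 - y ^ 2) :
    ∃ e : ℤ, e ^ 2 = 1 ∧ (q : ℤ) ∣ x + e * y := by
  have hq : Prime (q : ℤ) := Nat.prime_iff_prime_int.1 Fact.out
  rcases hq.dvd_or_dvd (show (q : ℤ) ∣ (x + y) * (x - y) by convert h using 1; ring) with h | h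
  · exact ⟨1, by simp, by simpa using h⟩
  · exact ⟨-1, by simp, by simpa [sub_eq_add_neg] using h⟩

theorem isSquare_of_smooth_aux {q : ℕ} [Fact q.Prime] (h1 : IsSquare (-1 : ZMod q))
    {d α β ν p₀ p₁ p₂ z w₁ w₂ h : ℤ} (h2 : IsSmooth q 2) (hd : IsSmooth q d) (hα : IsSmooth q α)
    (hαβ : IsSmooth q (α - β)) (hp₀ : IsSmooth q p₀) (hν : IsSmooth q ν)
    (hp₁ : ¬ (q : ℤ) ∣ p₁) (hp₂ : ¬ (q : ℤ) ∣ p₂)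
    (hP : p₁ ^ 2 - d * p₂ ^ 2 = α * q * ν * p₀ ^ 2)
    (e₁ : z ^ 2 - d * w₁ ^ 2 = α * q * ν * h ^ 2) (e₂ : z ^ 2 - d * w₂ ^ 2 = β * q * ν * h ^ 2)
    (hprim : ∀ r : ℕ, r.Prime → (r : ℤ) ∣ z → (r : ℤ) ∣ w₁ → (r : ℤ) ∣ w₂ → ¬ (r : ℤ) ∣ h)
    (hw₁ : ¬ (q : ℤ) ∣ w₁) (hz : (q : ℤ) ∣ z * p₂ + p₁ * w₁) (hw : (q : ℤ) ∣ w₁ + w₂) :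
    IsSquare (p₂ : ZMod q) := by
  have hq' : Prime (q : ℤ) := Nat.prime_iff_prime_int.1 Fact.out
  obtain ⟨T, hT⟩ : ∃ T, T = z * p₁ - d * w₁ * p₂ - α * q * ν * h * p₀ := ⟨_, rfl⟩
  have q0 : (q : ZMod q) = 0 := ZMod.natCast_self q
  have a1 : (p₁ : ZMod q) ^ 2 = d * p₂ ^ 2 := by
    have := congrArg (Int.cast : ℤ → ZMod q) hP
    push_cast at this
    rw [q0] at this
    linear_combination this
  have a2 : (z : ZMod q) * p₂ = - (p₁ * w₁) := by
    have := (ZMod.intCast_zmod_eq_zero_iff_dvd _ _).2 hz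
    push_cast at this
    linear_combination this
  have a3 : (w₂ : ZMod q) = -w₁ := by
    have := (ZMod.intCast_zmod_eq_zero_iff_dvd _ _).2 hw
    push_cast at this
    linear_combination this
  have u1 : (p₁ : ZMod q) ≠ 0 := by rwa [Ne, ZMod.intCast_zmod_eq_zero_iff_dvd]
  have u2 : (p₂ : ZMod q) ≠ 0 := by rwa [Ne, ZMod.intCast_zmod_eq_zero_iff_dvd]
  have u3 : (w₁ : ZMod q) ≠ 0 := by rwa [Ne, ZMod.intCast_zmod_eq_zero_iff_dvd]
  have u4 : (2 : ZMod q) ≠ 0 := by exact_mod_cast h2.cast_ne_zero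
  have u5 := hd.cast_ne_zero
  have hTq : (T : ZMod q) = -(d * (w₁ - w₂ : ℤ) * p₂) := by
    rw [hT]
    push_cast
    rw [q0, a3]
    apply mul_left_cancel₀ u2
    linear_combination p₁ * a2 - w₁ * a1
  have hWq : ((w₁ - w₂ : ℤ) : ZMod q) ≠ 0 := by
    push_cast
    rw [a3, sub_neg_eq_add, ← two_mul]
    exact mul_ne_zero u4 u3
  have hTq0 : (T : ZMod q) ≠ 0 := by
    rw [hTq]
    exact neg_ne_zero.2 (mul_ne_zero (mul_ne_zero u5 hWq) u2)
  have hT0 : T ≠ 0 := by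
    rintro h
    rw [h, Int.cast_zero] at hTq0
    exact hTq0 rfl
  have hW0 : w₁ - w₂ ≠ 0 := by
    rintro h
    rw [h, Int.cast_zero] at hWq
    exact hWq rfl
  have hgen : ∀ r : ℕ, r.Prime → r ≠ q → ¬ IsSquare (r : ZMod q) → ∀ n, IsSmooth q n →
      ¬ (r : ℤ) ∣ n := fun r hr hrq hrs n hn h => hrs (hn.2 r hr h).2
  have hsqT : IsSquare (T : ZMod q) := by
    refine isSquare_zmod_of_forall_prime h1 hT0 fun r hr hrT => ?_
    by_contra! hcon
    obtain ⟨hrs, hev⟩ := hcon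
    have : Fact r.Prime := ⟨hr⟩
    have hr' := Nat.prime_iff_prime_int.1 hr
    have hrq : r ≠ q := by
      rintro rfl
      exact hrs ⟨0, by simp⟩
    have hrq' : ¬ (r : ℤ) ∣ q := by
      intro h
      exact hrq ((Nat.prime_dvd_prime_iff_eq hr Fact.out).1 (by exact_mod_cast h))
    have hg := hgen r hr hrq hrs
    refine hev (even_padicValInt_of_mul_eq (s := z * p₁ - d * w₁ * p₂ + α * q * ν * h * p₀)
      (t := d) (y := z * p₂ - w₁ * p₁) hT0 (fun hr2 => ?_) (hg d hd) ?_)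
    · have b1 : (r : ℤ) ∣ 2 * (α * q * ν * p₀) * h := by
        refine (congrArg _ ?_).mp (dvd_sub hr2 hrT)
        rw [hT]
        ring
      have hc : ¬ (r : ℤ) ∣ α * q * ν * p₀ :=
        hr'.not_dvd_mul (hr'.not_dvd_mul (hr'.not_dvd_mul (hg _ hα) hrq') (hg _ hν)) (hg _ hp₀)
      have b2 : (r : ℤ) ∣ h :=
        (hr'.dvd_or_dvd b1).resolve_left (hr'.not_dvd_mul (hg 2 h2) hc)
      have b3 : (r : ℤ) ∣ d * (z * p₂ - w₁ * p₁) ^ 2 := by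
        refine (congrArg _ ?_).mp (Dvd.dvd.mul_left hr2 T)
        rw [hT]
        linear_combination (z ^ 2 - d * w₁ ^ 2) * hP + α * q * ν * p₀ ^ 2 * e₁
      have b4 : (r : ℤ) ∣ z * p₂ - w₁ * p₁ :=
        hr'.dvd_of_dvd_pow ((hr'.dvd_or_dvd b3).resolve_left (hg _ hd))
      have b5 : (r : ℤ) ∣ z * (α * q * ν * p₀ ^ 2) := by
        have b6 : (r : ℤ) ∣ z * p₁ - d * w₁ * p₂ := by
          refine (congrArg _ ?_).mp (dvd_add hrT (Dvd.dvd.mul_left b2 (α * q * ν * p₀)))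
          rw [hT]
          ring
        rw [← hP]
        refine (congrArg _ ?_).mp (dvd_sub (Dvd.dvd.mul_left b6 p₁) (Dvd.dvd.mul_left b4 (d * p₂)))
        ring
      have b6 : (r : ℤ) ∣ z := by
        refine (hr'.dvd_or_dvd b5).resolve_right ?_
        rw [sq, ← mul_assoc]
        exact hr'.not_dvd_mul hc (hg _ hp₀)
      have b7 : ∀ γ w : ℤ, z ^ 2 - d * w ^ 2 = γ * h ^ 2 → (r : ℤ) ∣ w := by
        intro γ w e
        refine hr'.dvd_of_dvd_pow (n := 2) ((hr'.dvd_or_dvd (a := d) ?_).resolve_left (hg _ hd))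
        rw [show d * w ^ 2 = z * z - γ * h * h by linear_combination -e]
        exact dvd_sub (Dvd.dvd.mul_left b6 _) (Dvd.dvd.mul_left b2 _)
      exact hprim r hr b6 (b7 _ _ e₁) (b7 _ _ e₂) b2
    · rw [hT]
      linear_combination (z ^ 2 - d * w₁ ^ 2) * hP + α * q * ν * p₀ ^ 2 * e₁
  have hsqW : IsSquare ((w₁ - w₂ : ℤ) : ZMod q) := by
    refine isSquare_zmod_of_forall_prime h1 hW0 fun r hr hrT => ?_
    by_contra! hcon
    obtain ⟨hrs, hev⟩ := hcon
    have : Fact r.Prime := ⟨hr⟩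
    have hr' := Nat.prime_iff_prime_int.1 hr
    have hrq : r ≠ q := by
      rintro rfl
      exact hrs ⟨0, by simp⟩
    have hrq' : ¬ (r : ℤ) ∣ q := by
      intro h
      exact hrq ((Nat.prime_dvd_prime_iff_eq hr Fact.out).1 (by exact_mod_cast h))
    have hg := hgen r hr hrq hrs
    have e3 : (w₁ - w₂) * (-d * (w₁ + w₂)) = (α - β) * q * ν * h ^ 2 := by
      linear_combination e₁ - e₂
    have hc : ¬ (r : ℤ) ∣ (α - β) * q * ν :=
      hr'.not_dvd_mul (hr'.not_dvd_mul (hg _ hαβ) hrq') (hg _ hν)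
    refine hev (even_padicValInt_of_mul_eq hW0 (hr'.not_dvd_mul
      (by rw [dvd_neg]; exact hg _ hd) fun hr2 => ?_) hc e3)
    have b1 : (r : ℤ) ∣ w₁ := by
      refine (hr'.dvd_or_dvd (a := 2) ?_).resolve_left (hg 2 h2)
      refine (congrArg _ ?_).mp (dvd_add hrT hr2)
      ring
    have b2 : (r : ℤ) ∣ w₂ := by
      refine (congrArg _ ?_).mp (dvd_sub hr2 b1)
      ring
    have b3 : (r : ℤ) ∣ h := by
      refine hr'.dvd_of_dvd_pow (n := 2) ((hr'.dvd_or_dvd (a := (α - β) * q * ν)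
        ?_).resolve_left hc)
      rw [← e3]
      exact Dvd.dvd.mul_right hrT _
    refine hprim r hr (hr'.dvd_of_dvd_pow (n := 2) ?_) b1 b2 b3
    rw [show z ^ 2 = d * w₁ * w₁ + α * q * ν * h * h by linear_combination e₁]
    exact dvd_add (Dvd.dvd.mul_left b1 _) (Dvd.dvd.mul_left b3 _)
  have e : (p₂ : ZMod q) = -1 * T / (d * (w₁ - w₂ : ℤ)) := by
    rw [hTq]
    field_simp
  rw [e]
  exact (h1.mul hsqT).div ((hd.isSquare h1).mul hsqW)

theorem isSquare_of_smooth {q : ℕ} [Fact q.Prime] (h1 : IsSquare (-1 : ZMod q))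
    {d α β ν p₀ p₁ p₂ : ℤ} (h2 : IsSmooth q 2) (hd : IsSmooth q d) (hα : IsSmooth q α)
    (hαβ : IsSmooth q (α - β)) (hp₀ : IsSmooth q p₀) (hν : IsSmooth q ν)
    (hP : p₁ ^ 2 - d * p₂ ^ 2 = α * q * ν * p₀ ^ 2) {Z W₁ W₂ : ℚ}
    (e₁ : Z ^ 2 - d * W₁ ^ 2 = α * q * ν) (e₂ : Z ^ 2 - d * W₂ ^ 2 = β * q * ν) :
    IsSquare (p₂ : ZMod q) ∧ (p₂ : ZMod q) ≠ 0 := by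
  have hq : Prime (q : ℤ) := Nat.prime_iff_prime_int.1 Fact.out
  have hval : ∀ x y m : ℤ, ¬ (q : ℤ) ∣ m → x ^ 2 - d * y ^ 2 = q * m → ¬ (q : ℤ) ∣ y := by
    intro x y m hm e h
    obtain ⟨y, rfl⟩ := h
    have hx : (q : ℤ) ∣ x := hq.dvd_of_dvd_pow (n := 2) ⟨m + d * q * y ^ 2, by linear_combination e⟩
    obtain ⟨x, rfl⟩ := hx
    exact hm ⟨x ^ 2 - d * y ^ 2, mul_left_cancel₀ hq.ne_zero (by linear_combination -e)⟩
  have hp₂ : ¬ (q : ℤ) ∣ p₂ := hval p₁ p₂ (α * ν * (p₀ * p₀)) (hq.not_dvd_mul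
    (hq.not_dvd_mul hα.not_dvd hν.not_dvd) (hq.not_dvd_mul hp₀.not_dvd hp₀.not_dvd))
    (by linear_combination hP)
  have hp₁ : ¬ (q : ℤ) ∣ p₁ := by
    intro h
    refine hq.not_dvd_mul hd.not_dvd (hq.not_dvd_mul hp₂ hp₂) ?_
    rw [show d * (p₂ * p₂) = p₁ * p₁ - q * (α * ν * p₀ ^ 2) by linear_combination -hP]
    exact dvd_sub (Dvd.dvd.mul_left h _) (Dvd.intro _ rfl)
  refine ⟨?_, by rwa [Ne, ZMod.intCast_zmod_eq_zero_iff_dvd]⟩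
  obtain ⟨z, w₁, w₂, h, hh, ez, ew₁, ew₂, hprim⟩ := exists_primitive_integers Z W₁ W₂
  have f₁ : z ^ 2 - d * w₁ ^ 2 = α * q * ν * h ^ 2 := by
    have : (z : ℚ) ^ 2 - d * w₁ ^ 2 = α * q * ν * h ^ 2 := by
      rw [← ez, ← ew₁]; linear_combination h ^ 2 * e₁
    exact_mod_cast this
  have f₂ : z ^ 2 - d * w₂ ^ 2 = β * q * ν * h ^ 2 := by
    have : (z : ℚ) ^ 2 - d * w₂ ^ 2 = β * q * ν * h ^ 2 := by
      rw [← ez, ← ew₂]; linear_combination h ^ 2 * e₂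
    exact_mod_cast this
  have hw₁ : ¬ (q : ℤ) ∣ w₁ := by
    intro hw
    have hzq : (q : ℤ) ∣ z := by
      refine hq.dvd_of_dvd_pow (n := 2) ?_
      rw [show z ^ 2 = d * w₁ * w₁ + q * (α * ν * h ^ 2) by linear_combination f₁]
      exact dvd_add (Dvd.dvd.mul_left hw _) (Dvd.intro _ rfl)
    have hw₂ : (q : ℤ) ∣ w₂ := by
      refine hq.dvd_of_dvd_pow (n := 2) ((hq.dvd_or_dvd (a := d) ?_).resolve_left hd.not_dvd)
      rw [show d * w₂ ^ 2 = z * z - q * (β * ν * h ^ 2) by linear_combination -f₂]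
      exact dvd_sub (Dvd.dvd.mul_left hzq _) (Dvd.intro _ rfl)
    have hqh := hprim q Fact.out hzq hw hw₂
    exact hval z w₁ (α * ν * (h * h)) (hq.not_dvd_mul
      (hq.not_dvd_mul hα.not_dvd hν.not_dvd) (hq.not_dvd_mul hqh hqh))
      (by linear_combination f₁) hw
  obtain ⟨e, he, hez⟩ := exists_sign (q := q) (x := z * p₂) (y := p₁ * w₁)
    ⟨α * ν * h ^ 2 * p₂ ^ 2 - α * ν * p₀ ^ 2 * w₁ ^ 2, by
      linear_combination p₂ ^ 2 * f₁ - w₁ ^ 2 * hP⟩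
  obtain ⟨f, hf, hfw⟩ := exists_sign (q := q) (x := e * w₁) (y := w₂) (by
    refine (hq.dvd_or_dvd (a := d) ?_).resolve_left hd.not_dvd
    exact ⟨(β - α) * ν * h ^ 2, by linear_combination f₂ - f₁ + d * w₁ ^ 2 * he⟩)
  have hdvd : ∀ e r w : ℤ, e ^ 2 = 1 → r ∣ e * w → r ∣ w := by
    intro e r w he h
    rw [show w = e * (e * w) by linear_combination -w * he]
    exact Dvd.dvd.mul_left h e
  refine isSquare_of_smooth_aux h1 (z := z) (w₁ := e * w₁) (w₂ := f * w₂) (h := h) h2 hd hα hαβ hp₀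
    hν hp₁ hp₂ hP (by linear_combination f₁ - d * w₁ ^ 2 * he)
    (by linear_combination f₂ - d * w₂ ^ 2 * hf)
    (fun r hr i1 i2 i3 => hprim r hr i1 (hdvd e _ _ he i2) (hdvd f _ _ hf i3))
    (fun h => hw₁ (hdvd e _ _ he h)) ?_ hfw
  rwa [show z * p₂ + p₁ * (e * w₁) = z * p₂ + e * (p₁ * w₁) by ring]

/-- Small solutions of a pair of linear congruences. -/
theorem exists_small_of_congr {q n : ℕ} (hq : q ≠ 0) (hn : n ≠ 0) (σ : ℤ) :
    ∃ x y z : ℤ, ¬ (x = 0 ∧ y = 0 ∧ z = 0) ∧ (n : ℤ) ∣ x - z ∧ (q : ℤ) ∣ x - σ * y ∧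
      x ^ 2 ≤ n * q ∧ y ^ 2 ≤ q ∧ z ^ 2 < n := by
  have : NeZero q := ⟨hq⟩
  have : NeZero n := ⟨hn⟩
  set A := Nat.sqrt (n * q)
  set B := Nat.sqrt q
  set D := Nat.sqrt (n - 1)
  have hA : n * q < (A + 1) ^ 2 := Nat.lt_succ_sqrt' _
  have hB : q < (B + 1) ^ 2 := Nat.lt_succ_sqrt' _
  have hD : n ≤ (D + 1) ^ 2 := by
    have : n - 1 < (D + 1) ^ 2 := Nat.lt_succ_sqrt' _
    omega
  have hcard : n * q < (A + 1) * ((B + 1) * (D + 1)) := by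
    by_contra! hcon
    have h1 := Nat.pow_le_pow_left hcon 2
    have h2 : (n * q) * (q * n) < (A + 1) ^ 2 * ((B + 1) ^ 2 * (D + 1) ^ 2) :=
      Nat.mul_lt_mul_of_lt_of_le hA (Nat.mul_le_mul hB.le hD) (by positivity)
    nlinarith
  obtain ⟨⟨x, y, z⟩, hs, ⟨x', y', z'⟩, hs', hne, heq⟩ :=
    Finset.exists_ne_map_eq_of_card_lt_of_maps_to
    (s := Finset.range (A + 1) ×ˢ Finset.range (B + 1) ×ˢ Finset.range (D + 1))
    (t := (Finset.univ : Finset (ZMod n × ZMod q)))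
    (by simpa [ZMod.card] using hcard)
    (f := fun v => ((v.1 : ZMod n) - v.2.2, (v.1 : ZMod q) - σ * v.2.1)) (fun _ _ => by simp)
  simp only [Finset.mem_product, Finset.mem_range, Prod.mk.injEq] at hs hs' heq
  have hle : ∀ {k a b : ℕ}, a < Nat.sqrt k + 1 → b < Nat.sqrt k + 1 → ((a : ℤ) - b) ^ 2 ≤ k := by
    intro k a b ha hb
    have h1 : ((Nat.sqrt k : ℕ) : ℤ) ^ 2 ≤ k := by exact_mod_cast Nat.sqrt_le' k
    refine le_trans (sq_le_sq' ?_ ?_) h1 <;> omega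
  refine ⟨x - x', y - y', z - z', ?_, ?_, ?_, ?_, hle hs.2.1 hs'.2.1, ?_⟩
  · rintro ⟨h1, h2, h3⟩
    exact hne (by ext <;> simp <;> omega)
  · rw [← ZMod.intCast_zmod_eq_zero_iff_dvd]
    push_cast
    linear_combination heq.1
  · rw [← ZMod.intCast_zmod_eq_zero_iff_dvd]
    push_cast
    linear_combination heq.2
  · exact_mod_cast hle hs.1 hs'.1
  · have := hle hs.2.2 hs'.2.2
    omega

/-- A prime `q` that is congruent to `1` modulo `d` and for which `d` is a square is, up to a small
square, the norm of an integer of `ℚ(√d)`. -/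
theorem exists_norm_eq_mul_sq {q : ℕ} [Fact q.Prime] {d : ℤ} (hd : ¬ IsSquare d)
    (hq : (q : ℤ) ≡ 1 [ZMOD d]) (hqd : ¬ (q : ℤ) ∣ d) (hs : IsSquare (d : ZMod q)) :
    ∃ s t g : ℤ, g ≠ 0 ∧ g.natAbs ≤ 2 * d.natAbs ∧ s ^ 2 - d * t ^ 2 = q * g ^ 2 := by
  have hq' : Prime (q : ℤ) := Nat.prime_iff_prime_int.1 Fact.out
  have hd0 : d ≠ 0 := by rintro rfl; exact hd ⟨0, by simp⟩
  have hq0 : (0 : ℤ) < q := by exact_mod_cast (Fact.out : q.Prime).pos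
  obtain ⟨σ, hσ⟩ := hs
  obtain ⟨σ, rfl⟩ := ZMod.intCast_surjective σ
  have hσd : (q : ℤ) ∣ σ ^ 2 - d := by
    rw [← ZMod.intCast_zmod_eq_zero_iff_dvd]
    push_cast
    linear_combination -hσ
  obtain ⟨x, y, z, h0, h1, h2, hx, hy, hz⟩ := exists_small_of_congr
    (Fact.out : q.Prime).ne_zero (Int.natAbs_ne_zero.2 hd0) σ
  have hzd : z.natAbs ≤ d.natAbs := by
    have h3 : z.natAbs ^ 2 < d.natAbs := by
      zify
      rw [sq_abs]
      simpa using hz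
    nlinarith
  rw [Int.natAbs_dvd] at h1
  have hx' : x ^ 2 ≠ d.natAbs * q := by
    intro h
    obtain ⟨k, rfl⟩ := hq'.dvd_of_dvd_pow (h ▸ Dvd.intro_left _ rfl : (q : ℤ) ∣ x ^ 2)
    apply hqd
    rw [← Int.dvd_natAbs]
    exact ⟨k ^ 2, mul_right_cancel₀ hq0.ne' (by linear_combination -h)⟩
  have hy' : y ^ 2 ≠ q := by
    intro h
    obtain ⟨k, rfl⟩ := hq'.dvd_of_dvd_pow (h ▸ dvd_rfl : (q : ℤ) ∣ y ^ 2)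
    refine hq'.not_isUnit (isUnit_of_dvd_one ⟨k ^ 2, mul_right_cancel₀ hq0.ne' ?_⟩)
    linear_combination -h
  replace hx := lt_of_le_of_ne hx hx'
  replace hy := lt_of_le_of_ne hy hy'
  obtain ⟨m, hm⟩ : ∃ m, x ^ 2 - d * y ^ 2 - q * z ^ 2 = d * q * m := by
    have e1 : d ∣ x ^ 2 - d * y ^ 2 - q * z ^ 2 := by
      obtain ⟨i, hi⟩ := h1
      obtain ⟨j, hj⟩ := hq.dvd
      exact ⟨i * (x + z) + j * z ^ 2 - y ^ 2, by linear_combination (x + z) * hi + z ^ 2 * hj⟩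
    have e2 : (q : ℤ) ∣ x ^ 2 - d * y ^ 2 - q * z ^ 2 := by
      obtain ⟨i, hi⟩ := h2
      obtain ⟨j, hj⟩ := hσd
      exact ⟨i * (x + σ * y) + j * y ^ 2 - z ^ 2, by
        linear_combination (x + σ * y) * hi + y ^ 2 * hj⟩
    exact ((Prime.coprime_iff_not_dvd hq').2 hqd).symm.mul_dvd e1 e2
  have hm01 : m = 0 ∨ m = -1 := by
    have hy0 := sq_nonneg y
    have hx0 := sq_nonneg x
    have hz0 := sq_nonneg z
    rcases lt_or_gt_of_ne hd0 with hneg | hpos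
    · have e : (d.natAbs : ℤ) = -d := by omega
      rw [e] at hx hz
      have k1 : m < 1 := by
        by_contra! hcon
        nlinarith [mul_pos (neg_pos.2 hneg) hq0, mul_nonneg (neg_nonneg.2 hneg.le) hy0]
      have k2 : -2 < m := by
        by_contra! hcon
        nlinarith [mul_pos (neg_pos.2 hneg) hq0, mul_nonneg hq0.le hz0]
      omega
    · have e : (d.natAbs : ℤ) = d := by omega
      rw [e] at hx hz
      have k1 : m < 1 := by
        by_contra! hcon
        nlinarith [mul_pos hpos hq0, mul_nonneg hpos.le hy0, mul_nonneg hq0.le hz0]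
      have k2 : -2 < m := by
        by_contra! hcon
        nlinarith [mul_pos hpos hq0]
      omega
  have hsq : ∀ r y : ℤ, r ^ 2 = d * y ^ 2 → y = 0 := by
    intro r y h
    by_contra hy
    apply hd
    rw [← Rat.isSquare_intCast_iff]
    have h' : (r : ℚ) ^ 2 = d * y ^ 2 := by exact_mod_cast h
    have hy' : (y : ℚ) ≠ 0 := by exact_mod_cast hy
    exact ⟨r / y, by field_simp; linear_combination -h'⟩
  rcases hm01 with rfl | rfl
  · refine ⟨x, y, z, ?_, by omega, by linear_combination hm⟩
    rintro rfl
    have hy0 := hsq x y (by linear_combination hm)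
    subst hy0
    exact h0 ⟨by simpa using hm, rfl, rfl⟩
  · refine ⟨x * z + d * y, x + y * z, z ^ 2 - d, ?_, ?_, by linear_combination (z ^ 2 - d) * hm⟩
    · intro h
      exact one_ne_zero (hsq z 1 (by linear_combination h))
    · have := sq_nonneg z
      omega

open Nat in
theorem exists_prime_reciprocity {d : ℤ} (hd : ¬ IsSquare d) (N : ℕ) :
    ∃ k q : ℕ, q.Prime ∧ N < q ∧ (q : ℤ) ≡ d [ZMOD k] ∧ k ^ 2 + d.natAbs < q ∧
      ¬ IsSquare (k : ZMod q) ∧ (8 * N ! : ℤ) ∣ q - 1 := by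
  have hd' : ¬ IsSquare (d : ℚ) := by rwa [Rat.isSquare_intCast_iff]
  have hd0 : d ≠ 0 := by rintro rfl; exact hd ⟨0, by simp⟩
  obtain ⟨k, hk, hkN, hkd, -⟩ := exists_prime_not_isSquare_isSquare d 1 hd' (by simpa using hd')
    (N + 2 + d.natAbs)
  have : Fact k.Prime := ⟨hk⟩
  have hk' := Nat.prime_iff_prime_int.1 hk
  have hcop : IsCoprime (8 * N ! : ℤ) (k : ℤ) := by
    rw [isCoprime_comm, Prime.coprime_iff_not_dvd hk']
    intro h
    have h : k ∣ 2 ^ 3 * N ! := by exact_mod_cast h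
    rcases hk.dvd_mul.1 h with h | h
    · have := Nat.le_of_dvd two_pos (hk.dvd_of_dvd_pow h)
      omega
    · have := hk.dvd_factorial.1 h
      omega
  obtain ⟨a, ha1, ha2⟩ := exists_modEq_and_modEq hcop 1 d
  have hc1 : IsCoprime a (8 * N ! : ℤ) := by
    obtain ⟨m, hm⟩ := ha1.dvd
    exact ⟨1, m, by linear_combination -hm⟩
  have hc2 : IsCoprime a (k : ℤ) := by
    rw [isCoprime_comm, Prime.coprime_iff_not_dvd hk']
    intro h
    have h2 : (k : ℤ) ∣ d := (Int.ModEq.dvd_iff ha2).1 h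
    have := Nat.le_of_dvd (Int.natAbs_pos.2 hd0) (Int.natCast_dvd.1 h2)
    omega
  obtain ⟨q, hqn, hq, hqa⟩ := Nat.forall_exists_prime_gt_and_zmodEq (N + k ^ 2 + d.natAbs)
    (q := 8 * N ! * k) (a := a)
    (mul_ne_zero (by positivity) hk.ne_zero) (by push_cast; exact hc1.mul_right hc2)
  have : Fact q.Prime := ⟨hq⟩
  push_cast at hqa
  have hq1 : (8 * N ! : ℤ) ∣ q - 1 := by
    have := ((hqa.of_dvd (Dvd.intro _ rfl)).trans ha1).symm.dvd
    exact this
  have hqd : (q : ℤ) ≡ d [ZMOD k] := (hqa.of_dvd (Dvd.intro_left _ rfl)).trans ha2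
  refine ⟨k, q, hq, by omega, hqd, by omega, ?_, hq1⟩
  have hq4 : q % 4 = 1 := by
    obtain ⟨m, hm⟩ := hq1
    rw [mul_assoc] at hm
    omega
  rw [ZMod.exists_sq_eq_prime_iff_of_mod_four_eq_one hq4 (by omega)]
  have := (ZMod.intCast_eq_intCast_iff _ _ _).2 hqd
  push_cast at this
  rwa [this]

theorem IsSmooth.mul {q : ℕ} {m n : ℤ} (hm : IsSmooth q m) (hn : IsSmooth q n) :
    IsSmooth q (m * n) :=
  ⟨mul_ne_zero hm.1 hn.1, fun r hr h =>
    ((Nat.prime_iff_prime_int.1 hr).dvd_or_dvd h).elim (hm.2 r hr) (hn.2 r hr)⟩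

theorem isSmooth_one (q : ℕ) : IsSmooth q 1 :=
  ⟨one_ne_zero, fun r hr h => (hr.one_lt.not_ge (Nat.le_of_dvd one_pos (by exact_mod_cast h))).elim⟩

open Nat in
theorem isSmooth_of_natAbs_le {q N : ℕ} [Fact q.Prime] (hN : N < q) (hq : (8 * N ! : ℤ) ∣ q - 1)
    {n : ℤ} (hn : n ≠ 0) (h : n.natAbs ≤ N) : IsSmooth q n := by
  refine ⟨hn, fun r hr hrn => ?_⟩
  have hrN := (Nat.le_of_dvd (Int.natAbs_pos.2 hn) (Int.natCast_dvd.1 hrn)).trans h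
  have : Fact r.Prime := ⟨hr⟩
  obtain ⟨m, hm⟩ := hq
  have hq2 := (Fact.out : q.Prime).two_le
  have h8 : q % 8 = 1 := by
    have : (q : ℤ) = 8 * (N ! * m) + 1 := by linear_combination hm
    omega
  refine ⟨by omega, ?_⟩
  by_cases hr2 : r = 2
  · subst hr2
    exact (ZMod.exists_sq_eq_two_iff (by rintro rfl; simp at h8)).2 (Or.inl h8)
  · rw [ZMod.exists_sq_eq_prime_iff_of_mod_four_eq_one (by omega) hr2]
    obtain ⟨j, hj⟩ := (Nat.dvd_factorial hr.pos hrN)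
    have : ((q : ℤ) : ZMod r) = 1 := by
      rw [show (q : ℤ) = 8 * (N ! * m) + 1 by linear_combination hm, hj]
      simp
    rw [Int.cast_natCast] at this
    rw [this]
    exact ⟨1, by simp⟩

theorem isSmooth_of_eq_sq_sub {q : ℕ} [Fact q.Prime] (h8 : q % 8 = 1) {ν u : ℤ} (hν : ν ≠ 0)
    (h : ν = u ^ 2 - 4 * q) (hu : ¬ (q : ℤ) ∣ u) : IsSmooth q ν := by
  refine ⟨hν, fun r hr hrν => ?_⟩
  have : Fact r.Prime := ⟨hr⟩
  have hq : Prime (q : ℤ) := Nat.prime_iff_prime_int.1 Fact.out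
  refine ⟨?_, ?_⟩
  · rintro rfl
    refine hu (hq.dvd_of_dvd_pow (n := 2) ?_)
    rw [show u ^ 2 = ν + 4 * r by rw [h]; ring]
    exact dvd_add hrν (Dvd.intro_left _ rfl)
  · by_cases hr2 : r = 2
    · subst hr2
      exact (ZMod.exists_sq_eq_two_iff (by rintro rfl; simp at h8)).2 (Or.inl h8)
    · rw [ZMod.exists_sq_eq_prime_iff_of_mod_four_eq_one (by omega) hr2]
      rw [← ZMod.intCast_zmod_eq_zero_iff_dvd, h] at hrν
      push_cast at hrν
      have h2 : (2 : ZMod r) ≠ 0 := by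
        intro h
        have : (2 : ℕ) = (0 : ZMod r) := by exact_mod_cast h
        rw [ZMod.natCast_eq_zero_iff] at this
        exact hr2 ((Nat.prime_dvd_prime_iff_eq hr Nat.prime_two).1 this)
      exact ⟨u / 2, by field_simp; linear_combination -hrν⟩

theorem false_of_forall_norm_int {d α β : ℤ} (hd : ¬ IsSquare d) (hα : α ≠ 0) (hαβ : α ≠ β)
    (H : ∀ x y : ℚ, x ^ 2 - d * y ^ 2 ≠ 0 → ∃ z w₁ w₂ : ℚ,
      z ^ 2 - d * w₁ ^ 2 = α * (x ^ 2 - d * y ^ 2) ∧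
      z ^ 2 - d * w₂ ^ 2 = β * (x ^ 2 - d * y ^ 2)) : False := by
  have hd0 : d ≠ 0 := by rintro rfl; exact hd ⟨0, by simp⟩
  obtain ⟨Z, W, -, e, -⟩ := H 1 0 (by simp)
  obtain ⟨a₀, a₁, a₂, -, -, h0, h1, h2, -, -⟩ : ∃ (a₀ a₁ a₂ a₃ a₄ : ℤ), a₀ ≠ 0 ∧ a₀ * Z = a₁ ∧
      a₀ * W = a₂ ∧ a₀ * 0 = a₃ ∧ a₀ * 0 = a₄ := by
    obtain ⟨m, A, B, C, D, h⟩ := exists_int_mul_eq Z W 0 0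
    exact ⟨m, A, B, C, D, by exact_mod_cast h⟩
  have ha : a₁ ^ 2 - d * a₂ ^ 2 = α * a₀ ^ 2 := by
    have : (a₁ : ℚ) ^ 2 - d * a₂ ^ 2 = α * a₀ ^ 2 := by
      rw [← h1, ← h2]; linear_combination a₀ ^ 2 * e
    exact_mod_cast this
  obtain ⟨N, hN⟩ : ∃ N, N = 2 + 2 * d.natAbs + α.natAbs + (α - β).natAbs + a₀.natAbs := ⟨_, rfl⟩
  obtain ⟨k, q, hq, hNq, hqk, hkq, hks, h8⟩ := exists_prime_reciprocity hd N
  have : Fact q.Prime := ⟨hq⟩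
  have hq' := Nat.prime_iff_prime_int.1 hq
  have hq8 : q % 8 = 1 := by
    obtain ⟨m, hm⟩ := h8
    have := hq.two_le
    rw [mul_assoc] at hm
    omega
  have hsm : ∀ n : ℤ, n ≠ 0 → n.natAbs ≤ N → IsSmooth q n :=
    fun n h1 h2 => isSmooth_of_natAbs_le hNq h8 h1 h2
  have hneg : IsSquare (-1 : ZMod q) := ZMod.exists_sq_eq_neg_one_iff.2 (by omega)
  have s2 := hsm 2 two_ne_zero (by simp; omega)
  have sd := hsm d hd0 (by omega)
  have sα := hsm α hα (by omega)
  have sαβ := hsm (α - β) (sub_ne_zero.2 hαβ) (by omega)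
  have hq1d : (q : ℤ) ≡ 1 [ZMOD d] := by
    refine (Int.modEq_iff_dvd.2 ?_).symm
    refine dvd_trans ?_ h8
    refine Dvd.dvd.mul_left ?_ _
    rw [← Int.natAbs_dvd]
    exact_mod_cast Nat.dvd_factorial (Int.natAbs_pos.2 hd0) (by omega)
  obtain ⟨s, t, g, hg, hgd, hst⟩ := exists_norm_eq_mul_sq hd hq1d sd.not_dvd (sd.isSquare hneg)
  have sp := (hsm g hg (by omega)).mul (hsm a₀ h0 (by omega))
  have hg' : (g : ℚ) ≠ 0 := by exact_mod_cast hg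
  have hst' : (s : ℚ) ^ 2 - d * t ^ 2 = q * g ^ 2 := by exact_mod_cast hst
  have hqQ : (q : ℚ) ≠ 0 := by exact_mod_cast hq.ne_zero
  obtain ⟨p₁, hp₁⟩ : ∃ p₁, p₁ = s * a₁ + d * t * a₂ := ⟨_, rfl⟩
  obtain ⟨p₂, hp₂⟩ : ∃ p₂, p₂ = s * a₂ + t * a₁ := ⟨_, rfl⟩
  have hP : p₁ ^ 2 - d * p₂ ^ 2 = α * q * (g * a₀) ^ 2 := by
    rw [hp₁, hp₂]
    linear_combination (a₁ ^ 2 - d * a₂ ^ 2) * hst + q * g ^ 2 * ha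
  have sq₁ : IsSquare (p₂ : ZMod q) ∧ (p₂ : ZMod q) ≠ 0 := by
    have eL : (s / g : ℚ) ^ 2 - d * (t / g) ^ 2 = q := by
      field_simp
      linear_combination hst'
    obtain ⟨Z, W₁, W₂, e₁, e₂⟩ := H (s / g) (t / g) (by rw [eL]; exact hqQ)
    rw [eL] at e₁ e₂
    exact isSquare_of_smooth hneg s2 sd sα sαβ sp (isSmooth_one q) (p₁ := p₁) (Z := Z)
      (W₁ := W₁) (W₂ := W₂)
      (by linear_combination hP) (by push_cast; linear_combination e₁)
      (by push_cast; linear_combination e₂)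
  obtain ⟨j, hj⟩ := hqk.dvd
  have hν0 : (j + k) ^ 2 - 4 * d ≠ 0 := by
    intro h
    apply hd
    rw [← Rat.isSquare_intCast_iff]
    have : ((j : ℚ) + k) ^ 2 - 4 * d = 0 := by exact_mod_cast h
    exact ⟨(j + k) / 2, by field_simp; linear_combination -this⟩
  have sν : IsSmooth q ((j + k) ^ 2 - 4 * d) := by
    refine isSmooth_of_eq_sq_sub hq8 (u := j - k) hν0 (by linear_combination -4 * hj) fun h => ?_
    have h3 : (q : ℤ) ∣ d - k ^ 2 := by
      rw [show d - (k : ℤ) ^ 2 = k * (j - k) + q by linear_combination hj]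
      exact dvd_add (Dvd.dvd.mul_left h _) dvd_rfl
    have h4 : d - (k : ℤ) ^ 2 = 0 := by
      refine Int.eq_zero_of_abs_lt_dvd h3 ?_
      zify at hkq
      rw [abs_lt]
      have := abs_le.1 (le_refl |d|)
      constructor <;> nlinarith
    exact hd ⟨k, by linear_combination h4⟩
  have sq₂ : IsSquare ((2 * p₁ + (j + k) * p₂ : ℤ) : ZMod q) ∧
      ((2 * p₁ + (j + k) * p₂ : ℤ) : ZMod q) ≠ 0 := by
    have eL : ((s * (j + k) + 2 * d * t) / g : ℚ) ^ 2 - d * ((2 * s + (j + k) * t) / g) ^ 2 =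
        q * ((j + k) ^ 2 - 4 * d) := by
      field_simp
      linear_combination ((j + k : ℚ) ^ 2 - 4 * d) * hst'
    obtain ⟨Z, W₁, W₂, e₁, e₂⟩ := H ((s * (j + k) + 2 * d * t) / g) ((2 * s + (j + k) * t) / g)
      (by rw [eL]; exact mul_ne_zero hqQ (by exact_mod_cast hν0))
    rw [eL] at e₁ e₂
    exact isSquare_of_smooth hneg s2 sd sα sαβ sp sν (p₁ := (j + k) * p₁ + 2 * d * p₂)
      (Z := Z) (W₁ := W₁) (W₂ := W₂)
      (by linear_combination ((j + k) ^ 2 - 4 * d) * hP) (by push_cast; linear_combination e₁)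
      (by push_cast; linear_combination e₂)
  apply hks
  have e1 : (p₁ : ZMod q) ^ 2 = d * p₂ ^ 2 := by
    have := congrArg (Int.cast : ℤ → ZMod q) hP
    push_cast at this
    rw [ZMod.natCast_self q] at this
    linear_combination this
  have e2 : (d : ZMod q) = k * j := by
    have := congrArg (Int.cast : ℤ → ZMod q) hj
    push_cast at this
    rw [ZMod.natCast_self q] at this
    linear_combination this
  have e3 : (k : ZMod q) = (p₁ + k * p₂) * (p₁ + k * p₂) /
      (p₂ * (2 * p₁ + (j + k) * p₂ : ℤ)) := by
    rw [eq_div_iff (mul_ne_zero sq₁.2 sq₂.2)]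
    push_cast
    linear_combination -e1 - p₂ ^ 2 * e2
  rw [e3]
  exact IsSquare.div ⟨_, rfl⟩ (sq₁.1.mul sq₂.1)

theorem false_of_forall_norm {d α β : ℚ} (hd : ¬ IsSquare d) (hα : α ≠ 0) (hαβ : α ≠ β)
    (H : ∀ x y : ℚ, x ^ 2 - d * y ^ 2 ≠ 0 → ∃ z w₁ w₂ : ℚ,
      z ^ 2 - d * w₁ ^ 2 = α * (x ^ 2 - d * y ^ 2) ∧
      z ^ 2 - d * w₂ ^ 2 = β * (x ^ 2 - d * y ^ 2)) : False := by
  obtain ⟨m, D, A, B, -, hm, eD, eA, eB, -⟩ := exists_int_mul_eq d α β 0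
  have hm' : (m : ℚ) ≠ 0 := by exact_mod_cast hm
  refine false_of_forall_norm_int (d := m * D) (α := m * A) (β := m * B) ?_ ?_ ?_ ?_
  · rw [← Rat.isSquare_intCast_iff]
    push_cast
    rw [← eD]
    rintro ⟨r, hr⟩
    exact hd ⟨r / m, by field_simp; linear_combination hr⟩
  · rw [← Int.cast_ne_zero (α := ℚ)]
    push_cast
    rw [← eA]
    positivity
  · rw [Ne, ← Int.cast_inj (α := ℚ)]
    push_cast
    rw [← eA, ← eB]
    intro h
    exact hαβ (mul_left_cancel₀ hm' (mul_left_cancel₀ hm' h))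
  · push_cast
    rw [← eD, ← eA, ← eB]
    intro x y hxy
    obtain ⟨z, w₁, w₂, e₁, e₂⟩ := H x (m * y) (by
      rwa [show x ^ 2 - d * (m * y) ^ 2 = x ^ 2 - m * (m * d) * y ^ 2 by ring])
    exact ⟨m * z, w₁, w₂, by linear_combination m ^ 2 * e₁, by linear_combination m ^ 2 * e₂⟩

theorem isSquare_mul_of_forall {c d e : ℚ} (hc : c ≠ 0) (hd : ¬ IsSquare d) (he : e ≠ 0)
    (H : ∀ z : ℚ, ∃ Z X : ℚ, c * (Z ^ 2 - d * X ^ 2) = z ^ 2 - e) : IsSquare (d * e) := by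
  by_contra hde
  obtain ⟨m, D, E, -, -, hm, eD, eE, -, -⟩ := exists_int_mul_eq d e 0 0
  have hm' : (m : ℚ) ≠ 0 := by exact_mod_cast hm
  have hE : m * E ≠ 0 := by
    rw [← Int.cast_ne_zero (α := ℚ)]
    push_cast
    rw [← eE]
    positivity
  have hcn : c.num ≠ 0 := Rat.num_ne_zero.2 hc
  obtain ⟨p, hp, hN, h1, h2⟩ := exists_prime_not_isSquare_isSquare (m * D) (m * E)
    (by
      push_cast
      rw [← eD]
      rintro ⟨r, hr⟩
      exact hd ⟨r / m, by field_simp; linear_combination hr⟩)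
    (by
      push_cast
      rw [← eD, ← eE]
      rintro ⟨r, hr⟩
      exact hde ⟨r / m ^ 2, by field_simp; linear_combination hr⟩)
    (2 + (m * E).natAbs + (c.num * c.den).natAbs)
  have : Fact p.Prime := ⟨hp⟩
  have hlt : ∀ n : ℤ, n ≠ 0 → n.natAbs < p → ¬ (p : ℤ) ∣ n := fun n h3 h4 h5 =>
    h4.not_ge (Nat.le_of_dvd (Int.natAbs_pos.2 h3) (Int.natCast_dvd.1 h5))
  have hp' : Prime (p : ℤ) := Nat.prime_iff_prime_int.1 hp
  have hp1 : ¬ (p : ℤ) ∣ 1 := fun h => hp'.not_isUnit (isUnit_of_dvd_one h)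
  obtain ⟨s, ⟨t, ht⟩, -⟩ := exists_lift_sq (p := p) (by omega) (w := 1) (a := -(m * E)) (-1) hp1
    (by rw [dvd_neg]; exact hlt _ hE (by omega)) (by simpa using h2)
  obtain ⟨Z, X, hZX⟩ := H (s / m)
  have hc' : (c.den : ℚ) * c = c.num := by rw [mul_comm]; exact c.mul_den_eq_num
  refine false_of_binary_eq (p := p) (w := 1) (u := -(m * D)) (k := c.num * c.den)
    (n := s ^ 2 - m * E) (Z := m * c.num * Z) (X := c.num * X) hp1
    (hlt _ (mul_ne_zero hcn (by exact_mod_cast c.den_ne_zero)) (by omega)) (by simpa using h1)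
    ⟨1 + p * t, by linear_combination ht⟩ ?_ ?_
  · rintro ⟨r, hr⟩
    refine hp1 ⟨r - t, ?_⟩
    apply mul_left_cancel₀ hp'.ne_zero
    linear_combination hr - ht
  · push_cast
    rw [← eD, ← eE, ← hc']
    field_simp at hZX
    linear_combination c * c.den ^ 2 * hZX

theorem false_of_forall_eq {c₁ c₂ c₁' c₂' d d' : ℚ} (h₁ : c₁ ≠ 0) (h₂ : c₂ ≠ 0) (h₁' : c₁' ≠ 0)
    (hd : ¬ IsSquare d) (hd' : d' ≠ 0) (hne : c₁' * c₂ ≠ c₂' * c₁)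
    (H : ∀ z' x' y' : ℚ, ¬ (z' = 0 ∧ x' = 0 ∧ y' = 0) → ∃ z x y : ℚ,
      c₁ * (z ^ 2 - d * x ^ 2) = c₁' * (z' ^ 2 - d' * x' ^ 2) ∧
      c₂ * (z ^ 2 - d * y ^ 2) = c₂' * (z' ^ 2 - d' * y' ^ 2)) : False := by
  have hd0 : d ≠ 0 := by rintro rfl; exact hd ⟨0, by simp⟩
  obtain ⟨r, hr⟩ := isSquare_mul_of_forall (c := c₁ / c₁') (div_ne_zero h₁ h₁') hd hd' (fun z' => by
    obtain ⟨z, x, -, e, -⟩ := H z' 1 1 (by simp)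
    exact ⟨z, x, by field_simp; linear_combination e⟩)
  have hr0 : r ≠ 0 := by
    rintro rfl
    exact mul_ne_zero hd0 hd' (by simpa using hr)
  refine false_of_forall_norm (α := c₁' / c₁) (β := c₂' / c₂) hd (div_ne_zero h₁' h₁)
    (by rwa [Ne, div_eq_div_iff h₁ h₂]) fun x y hxy => ?_
  have hd2 : d' = r ^ 2 / d := by
    field_simp
    linear_combination hr
  obtain ⟨z, w₁, w₂, e₁, e₂⟩ := H x (d * y / r) (d * y / r) (by
    rintro ⟨rfl, h, -⟩
    have : y = 0 := by simpa [hd0, hr0] using h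
    simp [this] at hxy)
  rw [show x ^ 2 - d' * (d * y / r) ^ 2 = x ^ 2 - d * y ^ 2 by rw [hd2]; field_simp] at e₁ e₂
  exact ⟨z, w₁, w₂, by field_simp; linear_combination e₁, by field_simp; linear_combination e₂⟩

section
open Polynomial

theorem complete_square_of_root {w u v c s : ℚ} (hw : w ≠ 0) (hu : u ≠ 0) (hs : s ≠ 0)
    (h : s ^ 2 * (u * v - c ^ 2) - s * c - 1 / 4 = 0) (x y z : ℚ) :
    s * (w * z ^ 2 + u * x ^ 2 + v * y ^ 2 + 2 * c * x * y) + x * y =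
      w * s * (z ^ 2 - -u / w * (x + (2 * s * c + 1) / (2 * s * u) * y) ^ 2) := by
  field_simp
  linear_combination 4 * y ^ 2 * h

section
variable {A₁ B₁ A₂ B₂ : Matrix (Fin 3) (Fin 3) ℚ} {a b w u v c w' u' v' c' : ℚ} {g : ℚ[X]}

theorem IsNormalForm.u_ne (h : IsNormalForm A₁ B₁ a g w u v c) : u ≠ 0 := by
  rintro rfl
  exact h.u_nsq ⟨0, by simp⟩

theorem IsNormalForm.v_ne (h : IsNormalForm A₁ B₁ a g w u v c) : v ≠ 0 := by
  rintro rfl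
  exact h.v_nsq ⟨0, by simp⟩

theorem IsNormalForm.of_eval_eq_zero (h : IsNormalForm A₁ B₁ a g w u v c) {t : ℚ}
    (ht : g.eval t = 0) :
    t - a ≠ 0 ∧ (t - a) ^ 2 * (u * v - c ^ 2) - (t - a) * c - 1 / 4 = 0 := by
  have e := h.eval_g t
  rw [ht, zero_mul] at e
  refine ⟨fun h0 => ?_, e.symm⟩
  rw [h0] at e
  norm_num at e

theorem IsNormalForm.exists_roots (h : IsNormalForm A₁ B₁ a g w u v c) (huv : IsSquare (u * v)) :
    ∃ t₁ t₂ : ℚ, t₁ ≠ t₂ ∧ g.eval t₁ = 0 ∧ g.eval t₂ = 0 := by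
  obtain ⟨r, hr⟩ := huv
  have hr0 : r ≠ 0 := by
    rintro rfl
    exact mul_ne_zero h.u_ne h.v_ne (by simpa using hr)
  have hd := h.disc_ne
  have key : ∀ e : ℚ, e ^ 2 = 1 → g.eval (a + (c + e * r) / (2 * (u * v - c ^ 2))) = 0 := by
    intro e he
    apply mul_right_cancel₀ hd
    rw [h.eval_g, zero_mul]
    field_simp
    linear_combination 4 * r ^ 2 * he - 4 * hr
  refine ⟨_, _, fun e => hr0 ?_, key 1 (by norm_num), key (-1) (by norm_num)⟩
  field_simp at e
  linear_combination e / 2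

theorem RepPair.not_isSquare_of_normalForm (h : RepPair A₁ B₁ A₂ B₂) (hab : a ≠ b)
    (h₁ : IsNormalForm A₁ B₁ a g w u v c) (h₂ : IsNormalForm A₂ B₂ b g w' u' v' c') :
    ¬ IsSquare (u * v) := by
  intro huv
  obtain ⟨t₁, t₂, ht, ht₁, ht₂⟩ := h₁.exists_roots huv
  obtain ⟨hs₁, hq₁⟩ := h₁.of_eval_eq_zero ht₁
  obtain ⟨hs₂, hq₂⟩ := h₁.of_eval_eq_zero ht₂
  obtain ⟨hs₁', hq₁'⟩ := h₂.of_eval_eq_zero ht₁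
  obtain ⟨hs₂', hq₂'⟩ := h₂.of_eval_eq_zero ht₂
  have hw := h₁.w_ne
  have hw' := h₂.w_ne
  have hu := h₁.u_ne
  have hu' := h₂.u_ne
  have ht' : t₁ - t₂ ≠ 0 := sub_ne_zero.2 ht
  refine false_of_forall_eq (c₁ := w * (t₁ - a)) (c₂ := w * (t₂ - a)) (c₁' := w' * (t₁ - b))
    (c₂' := w' * (t₂ - b)) (d := -u / w) (d' := -u' / w') (mul_ne_zero hw hs₁)
    (mul_ne_zero hw hs₂) (mul_ne_zero hw' hs₁') h₁.u_nsq
    (div_ne_zero (neg_ne_zero.2 hu') hw') ?_ ?_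
  · rw [← sub_ne_zero, show w' * (t₁ - b) * (w * (t₂ - a)) - w' * (t₂ - b) * (w * (t₁ - a)) =
      w' * w * ((t₁ - t₂) * (b - a)) by ring]
    exact mul_ne_zero (mul_ne_zero hw' hw) (mul_ne_zero ht' (sub_ne_zero.2 hab.symm))
  · intro z' X' Y' h0
    obtain ⟨x', y', hX, hY⟩ : ∃ x' y' : ℚ,
        x' + (2 * (t₁ - b) * c' + 1) / (2 * (t₁ - b) * u') * y' = X' ∧
        x' + (2 * (t₂ - b) * c' + 1) / (2 * (t₂ - b) * u') * y' = Y' := by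
      refine ⟨X' - (2 * (t₁ - b) * c' + 1) / (2 * (t₁ - b) * u') *
        ((Y' - X') * (2 * u' * (t₁ - b) * (t₂ - b)) / (t₁ - t₂)),
        (Y' - X') * (2 * u' * (t₁ - b) * (t₂ - b)) / (t₁ - t₂), by ring, ?_⟩
      field_simp
      ring
    obtain ⟨x, y, z, -, e₁, e₂⟩ := h.exists_of_normalForm h₁ h₂ x' y' z' (by
      rintro ⟨rfl, rfl, rfl⟩
      exact h0 ⟨rfl, by simpa using hX.symm, by simpa using hY.symm⟩)
    refine ⟨z, x + (2 * (t₁ - a) * c + 1) / (2 * (t₁ - a) * u) * y,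
      x + (2 * (t₂ - a) * c + 1) / (2 * (t₂ - a) * u) * y, ?_, ?_⟩
    · rw [← hX, ← complete_square_of_root hw' hu' hs₁' hq₁',
        ← complete_square_of_root hw hu hs₁ hq₁ x y z]
      linear_combination (t₁ - a) * e₁ + e₂
    · rw [← hY, ← complete_square_of_root hw' hu' hs₂' hq₂',
        ← complete_square_of_root hw hu hs₂ hq₂ x y z]
      linear_combination (t₂ - a) * e₁ + e₂

theorem RepPair.pencilPoly_eq (h : RepPair A₁ B₁ A₂ B₂) :
    pencilPoly A₁ B₁ = pencilPoly A₂ B₂ := by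
  by_contra hne
  obtain ⟨a, b, g, hab, hg, hg2, hf₁, hf₂, hs₁, hs₂, hga, hgb, -⟩ := h.exists_common_factor hne
  obtain ⟨w, u, v, c, h₁⟩ := exists_isNormalForm h.symmA₁ h.symmB₁ h.an₁ h.det₁ hs₁ hg hg2 hf₁ hga
  obtain ⟨w', u', v', c', h₂⟩ :=
    exists_isNormalForm h.symmA₂ h.symmB₂ h.an₂ h.det₂ hs₂ hg hg2 hf₂ hgb
  exact h.not_isSquare_of_normalForm hab h₁ h₂ (h.isSquare_of_normalForm hab h₁ h₂ hga)

end

end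

theorem eval_detPolyXY (A B : Matrix (Fin 3) (Fin 3) ℚ) (v : Fin 2 → ℚ) :
    MvPolynomial.eval v (detPolyXY A B) = (v 0 • A - v 1 • B).det := by
  rw [detPolyXY, RingHom.map_det]
  congr 1
  ext i j
  simp

theorem exists_det_add_smul_ne_zero {A₁ B₁ A₂ B₂ : Matrix (Fin 3) (Fin 3) ℚ}
    (h₁ : detPolyXY A₁ B₁ ≠ 0) (h₂ : detPolyXY A₂ B₂ ≠ 0) :
    ∃ t : ℚ, (A₁ + t • B₁).det ≠ 0 ∧ (A₂ + t • B₂).det ≠ 0 := by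
  have hne : (MvPolynomial.X 0 * detPolyXY A₁ B₁ * detPolyXY A₂ B₂ : MvPolynomial (Fin 2) ℚ) ≠ 0 :=
    mul_ne_zero (mul_ne_zero (MvPolynomial.X_ne_zero 0) h₁) h₂
  obtain ⟨v, hv⟩ : ∃ v : Fin 2 → ℚ,
      MvPolynomial.eval v (MvPolynomial.X 0 * detPolyXY A₁ B₁ * detPolyXY A₂ B₂) ≠ 0 := by
    by_contra! h
    exact hne (MvPolynomial.funext fun v => by rw [h, map_zero])
  rw [map_mul, map_mul, MvPolynomial.eval_X, eval_detPolyXY, eval_detPolyXY] at hv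
  have hv0 : v 0 ≠ 0 := left_ne_zero_of_mul (left_ne_zero_of_mul hv)
  have key : ∀ A B : Matrix (Fin 3) (Fin 3) ℚ,
      v 0 • A - v 1 • B = v 0 • (A + (-(v 1 / v 0)) • B) := by
    intro A B
    rw [smul_add, smul_smul, show v 0 * -(v 1 / v 0) = -v 1 by field_simp, neg_smul, sub_eq_add_neg]
  rw [key, key, det_smul, det_smul] at hv
  exact ⟨-(v 1 / v 0), right_ne_zero_of_mul (right_ne_zero_of_mul (left_ne_zero_of_mul hv)),
    right_ne_zero_of_mul (right_ne_zero_of_mul hv)⟩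

theorem det_mul_det_smul_sub_smul_eq {A₁ B₁ A₂ B₂ : Matrix (Fin 3) (Fin 3) ℚ}
    (h₁ : A₁.det ≠ 0) (h₂ : A₂.det ≠ 0) (h : pencilPoly A₁ B₁ = pencilPoly A₂ B₂) (x y : ℚ) :
    A₂.det * (x • A₁ - y • B₁).det = A₁.det * (x • A₂ - y • B₂).det := by
  by_cases hy : y = 0
  · simp only [hy, zero_smul, sub_zero, det_smul]
    ring
  · have key : ∀ A B : Matrix (Fin 3) (Fin 3) ℚ, A.det ≠ 0 →
        (x • A - y • B).det = y ^ 3 * (A.det * (pencilPoly A B).eval (x / y)) := by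
      intro A B hA
      rw [← det_smul_sub hA, show x • A - y • B = y • ((x / y) • A - B) by
        rw [smul_sub, smul_smul, mul_div_cancel₀ _ hy], det_smul, Fintype.card_fin]
    rw [key A₁ B₁ h₁, key A₂ B₂ h₂, h]
    ring

theorem quadVal_add_smul (A B : Matrix (Fin 3) (Fin 3) ℚ) (t : ℚ) (x : Fin 3 → ℚ) :
    quadVal (A + t • B) x = quadVal A x + t * quadVal B x := by
  simp [quadVal, add_mulVec, smul_mulVec, dotProduct_add, dotProduct_smul]

theorem exists_of_simRepQ_subset {A₁ B₁ A₂ B₂ : Matrix (Fin 3) (Fin 3) ℚ}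
    (h : simRepQ A₂ B₂ ⊆ simRepQ A₁ B₁) (t : ℚ) (x : Fin 3 → ℚ) (hx : x ≠ 0) :
    ∃ y : Fin 3 → ℚ, y ≠ 0 ∧ quadVal (A₁ + t • B₁) y = quadVal (A₂ + t • B₂) x ∧
      quadVal B₁ y = quadVal B₂ x := by
  obtain ⟨y, hy, e₁, e₂⟩ := h (show (quadVal A₂ x, quadVal B₂ x) ∈ simRepQ A₂ B₂ from
    ⟨x, hx, rfl, rfl⟩)
  have e₁ : quadVal A₁ y = quadVal A₂ x := e₁
  have e₂ : quadVal B₁ y = quadVal B₂ x := e₂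
  exact ⟨y, hy, by rw [quadVal_add_smul, quadVal_add_smul, e₁, e₂], e₂⟩

theorem stmt_1
    (A₁ B₁ A₂ B₂ : Matrix (Fin 3) (Fin 3) ℚ)
    (hsA₁ : A₁.IsSymm) (hsB₁ : B₁.IsSymm) (hsA₂ : A₂.IsSymm) (hsB₂ : B₂.IsSymm)
    -- linear independence over ℚ
    (hli₁ : ∀ a b : ℚ, a • A₁ + b • B₁ = 0 → a = 0 ∧ b = 0)
    (hli₂ : ∀ a b : ℚ, a • A₂ + b • B₂ = 0 → a = 0 ∧ b = 0)
    -- non-singular and anisotropic over ℚ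
    (hns₁ : detPolyXY A₁ B₁ ≠ 0)
    (hns₂ : detPolyXY A₂ B₂ ≠ 0)
    (han₁ : ∀ x : Fin 3 → ℚ, x ⬝ᵥ (A₁ *ᵥ x) = 0 → x ⬝ᵥ (B₁ *ᵥ x) = 0 → x = 0)
    (han₂ : ∀ x : Fin 3 → ℚ, x ⬝ᵥ (A₂ *ᵥ x) = 0 → x ⬝ᵥ (B₂ *ᵥ x) = 0 → x = 0)
    -- equal simultaneous rational representations
    (hrep : simRepQ A₁ B₁ = simRepQ A₂ B₂) :
    ∃ r₁ r₂ : ℤ, r₁ ≠ 0 ∧ r₂ ≠ 0 ∧ IsCoprime r₁ r₂ ∧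
      (r₂ : ℚ) • detPolyXY A₁ B₁ = (r₁ : ℚ) • detPolyXY A₂ B₂ := by
  obtain ⟨t, hd₁, hd₂⟩ := exists_det_add_smul_ne_zero hns₁ hns₂
  have hli : ∀ A B : Matrix (Fin 3) (Fin 3) ℚ, (∀ a b : ℚ, a • A + b • B = 0 → a = 0 ∧ b = 0) →
      ∀ a b : ℚ, a • (A + t • B) + b • B = 0 → a = 0 ∧ b = 0 := by
    intro A B hAB a b h
    obtain ⟨rfl, h⟩ := hAB a (a * t + b) (by rw [← h]; module)
    exact ⟨rfl, by simpa using h⟩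
  have han : ∀ A B : Matrix (Fin 3) (Fin 3) ℚ,
      (∀ x : Fin 3 → ℚ, x ⬝ᵥ (A *ᵥ x) = 0 → x ⬝ᵥ (B *ᵥ x) = 0 → x = 0) →
      ∀ x, quadVal (A + t • B) x = 0 → quadVal B x = 0 → x = 0 := by
    intro A B h x h1 h2
    refine h x ?_ h2
    rw [quadVal_add_smul, h2, mul_zero, add_zero] at h1
    exact h1
  have hR : RepPair (A₁ + t • B₁) B₁ (A₂ + t • B₂) B₂ :=
    { symmA₁ := hsA₁.add (hsB₁.smul t)
      symmB₁ := hsB₁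
      symmA₂ := hsA₂.add (hsB₂.smul t)
      symmB₂ := hsB₂
      li₁ := hli _ _ hli₁
      li₂ := hli _ _ hli₂
      an₁ := han _ _ han₁
      an₂ := han _ _ han₂
      rep₁ := exists_of_simRepQ_subset hrep.ge t
      rep₂ := exists_of_simRepQ_subset hrep.le t
      det₁ := hd₁
      det₂ := hd₂ }
  have key := det_mul_det_smul_sub_smul_eq hd₁ hd₂ hR.pencilPoly_eq
  have hq : (A₁ + t • B₁).det / (A₂ + t • B₂).det ≠ 0 := div_ne_zero hd₁ hd₂
  refine ⟨_, ((A₁ + t • B₁).det / (A₂ + t • B₂).det).den, Rat.num_ne_zero.2 hq,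
    by exact_mod_cast Rat.den_ne_zero _, Rat.isCoprime_num_den _, MvPolynomial.funext fun v => ?_⟩
  have hk := key (v 0) (v 1 + t * v 0)
  have hs : ∀ A B : Matrix (Fin 3) (Fin 3) ℚ,
      v 0 • (A + t • B) - (v 1 + t * v 0) • B = v 0 • A - v 1 • B := by
    intro A B
    module
  rw [hs, hs] at hk
  rw [MvPolynomial.smul_eval, MvPolynomial.smul_eval, eval_detPolyXY, eval_detPolyXY]
  apply mul_left_cancel₀ hd₂
  have hn := Rat.mul_den_eq_num ((A₁ + t • B₁).det / (A₂ + t • B₂).det)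
  rw [div_mul_eq_mul_div, div_eq_iff hd₂] at hn
  push_cast
  linear_combination (((A₁ + t • B₁).det / (A₂ + t • B₂).det).den : ℚ) * hk +
    (v 0 • A₂ - v 1 • B₂).det * hn
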